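/- Let n ≥ 2 and let (u,v) be a solution of Δu = u v², Δv = v u², u > 0, v > 0 on ℝⁿ satisfying the linear growth condition u(x) + v(x) ≤ C₀(1 + |x|) for some constant C₀ > 0. Then there exists a constant C > 0 such that u(x) v(x) ≤ C for all x ∈ ℝⁿ. -/

import Mathlib

open MeasureTheory Metric
open scoped RealInnerProductSpace

noncomputable section

/-- The Laplacian of a function on Euclidean space, as the trace of the second derivative. -/
def lap {n : ℕ} (u : EuclideanSpace ℝ (Fin n) → ℝ) (x : EuclideanSpace ℝ (Fin n)) : ℝ :=
  ∑ i : Fin n, iteratedFDeriv ℝ 2 u x (fun _ => EuclideanSpace.single i 1)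

/-- A (positive classical) solution of the system Δu = u v², Δv = v u², u,v > 0 on ℝⁿ. -/
def IsSolution {n : ℕ} (u v : EuclideanSpace ℝ (Fin n) → ℝ) : Prop :=
  ContDiff ℝ (⊤ : ℕ∞) u ∧ ContDiff ℝ (⊤ : ℕ∞) v ∧ (∀ x, 0 < u x) ∧ (∀ x, 0 < v x) ∧
    (∀ x, lap u x = u x * v x ^ 2) ∧ (∀ x, lap v x = v x * u x ^ 2)

section

open Set Filter Topology

/-! ### Calculus helpers -/

theorem monotoneOn_of_hasDerivAt {f f' : ℝ → ℝ} {a b : ℝ}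
    (h : ∀ t ∈ Icc a b, HasDerivAt f (f' t) t) (h0 : ∀ t ∈ Icc a b, 0 ≤ f' t) :
    MonotoneOn f (Icc a b) :=
  monotoneOn_of_hasDerivWithinAt_nonneg (convex_Icc a b)
    (fun t ht => (h t ht).continuousAt.continuousWithinAt)
    (fun t ht => (h t (interior_subset ht)).hasDerivWithinAt)
    (fun t ht => h0 t (interior_subset ht))

theorem le_of_hasDerivAt_le {f f' g g' : ℝ → ℝ} {a b : ℝ} (hab : a ≤ b)
    (hf : ∀ t ∈ Icc a b, HasDerivAt f (f' t) t) (hg : ∀ t ∈ Icc a b, HasDerivAt g (g' t) t)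
    (h : ∀ t ∈ Icc a b, f' t ≤ g' t) (h0 : f a ≤ g a) : f b ≤ g b := by
  have := monotoneOn_of_hasDerivAt (f := fun t => g t - f t) (f' := fun t => g' t - f' t)
    (fun t ht => (hg t ht).sub (hf t ht)) (fun t ht => sub_nonneg.2 (h t ht))
    (left_mem_Icc.2 hab) (right_mem_Icc.2 hab) hab
  simp only at this
  linarith

/-- At a local maximum the second derivative is nonpositive. -/
theorem second_deriv_nonpos_of_isLocalMax {f f' : ℝ → ℝ} {s c : ℝ} (hmax : IsLocalMax f s)
    (hf : ∀ᶠ t in 𝓝 s, HasDerivAt f (f' t) t) (hf' : HasDerivAt f' c s) : c ≤ 0 := by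
  by_contra! hc
  have hd : deriv f =ᶠ[𝓝 s] f' := hf.mono fun t ht => ht.deriv
  have hdd : deriv (deriv f) s = c := by
    rw [hd.deriv_eq, hf'.deriv]
  have hmin : IsLocalMin f s :=
    isLocalMin_of_deriv_deriv_pos (by rw [hdd]; exact hc) hmax.deriv_eq_zero
      hf.self_of_nhds.continuousAt
  have hconst : f =ᶠ[𝓝 s] fun _ => f s := by
    filter_upwards [hmax, hmin] with t h1 h2 using le_antisymm h1 h2
  have h1 : deriv f =ᶠ[𝓝 s] deriv fun _ => f s := hconst.deriv
  have h2 := h1.deriv_eq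
  rw [hdd] at h2
  simp at h2
  linarith

/-! ### The one-dimensional heteroclinic profile -/

/-- Truncation of a real number to `[a, b]`. -/
def clip (a b x : ℝ) : ℝ := max a (min b x)

theorem clip_mem {a b : ℝ} (h : a ≤ b) (x : ℝ) : a ≤ clip a b x ∧ clip a b x ≤ b :=
  ⟨le_max_left _ _, max_le h (min_le_left _ _)⟩

theorem clip_of_mem {a b x : ℝ} (h1 : a ≤ x) (h2 : x ≤ b) : clip a b x = x := by
  simp [clip, h1, h2]

theorem abs_clip_sub_clip_le (a b x y : ℝ) : |clip a b x - clip a b y| ≤ |x - y| := by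
  refine (abs_max_sub_max_le_max _ _ _ _).trans ?_
  refine max_le (by simp) ((abs_min_sub_min_le_max _ _ _ _).trans (by simp))

/-- The vector field of `U'' = U V ^ 2`, `V'' = V U ^ 2`, truncated to be bounded and Lipschitz. -/
def clippedField (R M : ℝ) (p : ℝ × ℝ × ℝ × ℝ) : ℝ × ℝ × ℝ × ℝ :=
  (clip (-M) M p.2.2.1, clip (-M) M p.2.2.2, clip 1 R p.1 * clip (-1) 1 p.2.1 ^ 2,
    clip (-1) 1 p.2.1 * clip 1 R p.1 ^ 2)

theorem abs_mul_sq_sub_le {x x' y y' X Y d : ℝ} (hx : |x| ≤ X) (hx' : |x'| ≤ X) (hy : |y| ≤ Y)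
    (hy' : |y'| ≤ Y) (h1 : |x - x'| ≤ d) (h2 : |y - y'| ≤ d) :
    |x * y ^ 2 - x' * y' ^ 2| ≤ (Y ^ 2 + 2 * X * Y) * d := by
  have e : x * y ^ 2 - x' * y' ^ 2 = (x - x') * y ^ 2 + x' * (y + y') * (y - y') := by ring
  have hX : 0 ≤ X := (abs_nonneg _).trans hx
  have hY : 0 ≤ Y := (abs_nonneg _).trans hy
  have hd : 0 ≤ d := (abs_nonneg _).trans h1
  rw [e]
  refine (abs_add_le _ _).trans ?_
  rw [abs_mul, abs_mul, abs_mul, abs_pow]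
  have h3 : |y + y'| ≤ 2 * Y := (abs_add_le _ _).trans (by linarith)
  have h4 : |x - x'| * |y| ^ 2 ≤ d * Y ^ 2 := by gcongr
  have h5 : |x'| * |y + y'| * |y - y'| ≤ X * (2 * Y) * d := by gcongr
  linarith

theorem lipschitzWith_clippedField {R M : ℝ} (hR : 1 ≤ R) :
    LipschitzWith (Real.toNNReal ((1 + R) ^ 2)) (clippedField R M) := by
  apply LipschitzWith.of_dist_le_mul
  intro p q
  rw [Real.coe_toNNReal _ (by positivity)]
  have hd : 0 ≤ dist p q := dist_nonneg
  have h1 : |p.1 - q.1| ≤ dist p q := by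
    rw [← Real.dist_eq]; exact le_max_left _ _
  have h2 : |p.2.1 - q.2.1| ≤ dist p q := by
    rw [← Real.dist_eq]; exact (le_max_left _ _).trans (le_max_right _ _)
  have h3 : |p.2.2.1 - q.2.2.1| ≤ dist p q := by
    rw [← Real.dist_eq]
    exact (le_max_left _ _).trans ((le_max_right _ _).trans (le_max_right _ _))
  have h4 : |p.2.2.2 - q.2.2.2| ≤ dist p q := by
    rw [← Real.dist_eq]
    exact (le_max_right _ _).trans ((le_max_right _ _).trans (le_max_right _ _))
  have c1 := fun x => clip_mem hR x
  have c2 := fun x => clip_mem (show (-1 : ℝ) ≤ 1 by norm_num) x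
  have a1 : ∀ x, |clip 1 R x| ≤ R := fun x => abs_le.2 ⟨by linarith [(c1 x).1], (c1 x).2⟩
  have a2 : ∀ x, |clip (-1) 1 x| ≤ 1 := fun x => abs_le.2 (c2 x)
  have hle : 1 * dist p q ≤ (1 + R) ^ 2 * dist p q := by
    gcongr; nlinarith
  refine max_le ?_ (max_le ?_ (max_le ?_ ?_))
  · rw [Real.dist_eq]
    exact ((abs_clip_sub_clip_le _ _ _ _).trans h3).trans (by linarith)
  · rw [Real.dist_eq]
    exact ((abs_clip_sub_clip_le _ _ _ _).trans h4).trans (by linarith)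
  · rw [Real.dist_eq]
    refine (abs_mul_sq_sub_le (a1 _) (a1 _) (a2 _) (a2 _)
      ((abs_clip_sub_clip_le _ _ _ _).trans h1) ((abs_clip_sub_clip_le _ _ _ _).trans h2)).trans ?_
    gcongr; nlinarith
  · rw [Real.dist_eq]
    refine (abs_mul_sq_sub_le (a2 _) (a2 _) (a1 _) (a1 _)
      ((abs_clip_sub_clip_le _ _ _ _).trans h2) ((abs_clip_sub_clip_le _ _ _ _).trans h1)).trans ?_
    gcongr; nlinarith

theorem norm_clippedField_le {R M : ℝ} (hR : 1 ≤ R) (hM : 0 ≤ M) (p : ℝ × ℝ × ℝ × ℝ) :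
    ‖clippedField R M p‖ ≤ R ^ 2 + M := by
  have c1 := fun x => clip_mem hR x
  have c2 := fun x => clip_mem (show (-1 : ℝ) ≤ 1 by norm_num) x
  have c3 := fun x => clip_mem (show -M ≤ M by linarith) x
  have a1 : ∀ x, |clip 1 R x| ≤ R := fun x => abs_le.2 ⟨by linarith [(c1 x).1], (c1 x).2⟩
  have a2 : ∀ x, |clip (-1) 1 x| ≤ 1 := fun x => abs_le.2 (c2 x)
  have a3 : ∀ x, |clip (-M) M x| ≤ M := fun x => abs_le.2 (c3 x)
  have hR2 : R ≤ R ^ 2 := by nlinarith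
  refine max_le ?_ (max_le ?_ (max_le ?_ ?_))
  · exact (a3 _).trans (by nlinarith)
  · exact (a3 _).trans (by nlinarith)
  · show |clip 1 R p.1 * clip (-1) 1 p.2.1 ^ 2| ≤ _
    rw [abs_mul, abs_pow]
    have : |clip 1 R p.1| * |clip (-1) 1 p.2.1| ^ 2 ≤ R * 1 ^ 2 := by
      gcongr
      · exact a1 _
      · exact a2 _
    linarith
  · show |clip (-1) 1 p.2.1 * clip 1 R p.1 ^ 2| ≤ _
    rw [abs_mul, abs_pow]
    have : |clip (-1) 1 p.2.1| * |clip 1 R p.1| ^ 2 ≤ 1 * R ^ 2 := by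
      gcongr
      · exact a2 _
      · exact a1 _
    linarith

theorem exists_clipped_flow {R M : ℝ} (hR : 1 ≤ R) (hM : 0 ≤ M) {N : ℝ} (hN : 0 ≤ N) :
    ∃ α : ℝ → ℝ → ℝ × ℝ × ℝ × ℝ,
      (∀ b ∈ Icc (0 : ℝ) 20, α b 0 = (1, 1, b, -b) ∧
        ∀ t ∈ Icc 0 N, HasDerivAt (α b) (clippedField R M (α b t)) t) ∧
      ∀ t ∈ Icc 0 N, ContinuousOn (fun b => α b t) (Icc 0 20) := by
  have hL : 0 ≤ R ^ 2 + M := by positivity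
  have hPL : IsPicardLindelof (fun _ => clippedField R M) (tmin := -1) (tmax := N + 1)
      ⟨0, by constructor <;> linarith⟩ ((1, 1, 0, 0) : ℝ × ℝ × ℝ × ℝ)
      (Real.toNNReal ((R ^ 2 + M) * (N + 1) + 20)) 20 (Real.toNNReal (R ^ 2 + M))
      (Real.toNNReal ((1 + R) ^ 2)) := by
    apply IsPicardLindelof.of_time_independent
    · intro x _
      rw [Real.coe_toNNReal _ hL]
      exact norm_clippedField_le hR hM x
    · exact (lipschitzWith_clippedField hR).lipschitzOnWith
    · rw [Real.coe_toNNReal _ hL, Real.coe_toNNReal _ (by positivity)]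
      have : max (N + 1 - (0 : ℝ)) (0 - -1) = N + 1 := by
        rw [max_eq_left] <;> linarith
      rw [this]
      simp
  obtain ⟨α, h1, L', h2⟩ := hPL.exists_forall_mem_closedBall_eq_hasDerivWithinAt_lipschitzOnWith
  have hmem : ∀ b ∈ Icc (0 : ℝ) 20, ((1, 1, b, -b) : ℝ × ℝ × ℝ × ℝ) ∈
      closedBall ((1, 1, 0, 0) : ℝ × ℝ × ℝ × ℝ) (20 : NNReal) := by
    intro b hb
    simp only [mem_closedBall, Prod.dist_eq, Real.dist_eq]
    simp [abs_of_nonneg hb.1, hb.2]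
  refine ⟨fun b => α (1, 1, b, -b), fun b hb => ⟨(h1 _ (hmem b hb)).1, fun t ht => ?_⟩,
    fun t ht => ?_⟩
  · exact ((h1 _ (hmem b hb)).2 t ⟨by linarith [ht.1], by linarith [ht.2]⟩).hasDerivAt
      (Icc_mem_nhds (by linarith [ht.1]) (by linarith [ht.2]))
  · exact (h2 t ⟨by linarith [ht.1], by linarith [ht.2]⟩).continuousOn.comp (by fun_prop) hmem

/-- Solutions on `[0, N]` of `U'' = U V ^ 2`, `V'' = V U ^ 2`, `U 0 = V 0 = 1`,
`U' 0 = - V' 0 = b`, with truncated `V`. -/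
structure SemiSol (b N : ℝ) (U V P Q : ℝ → ℝ) : Prop where
  U0 : U 0 = 1
  V0 : V 0 = 1
  P0 : P 0 = b
  Q0 : Q 0 = -b
  dU : ∀ t ∈ Icc 0 N, HasDerivAt U (P t) t
  dV : ∀ t ∈ Icc 0 N, HasDerivAt V (Q t) t
  dP : ∀ t ∈ Icc 0 N, HasDerivAt P (U t * clip (-1) 1 (V t) ^ 2) t
  dQ : ∀ t ∈ Icc 0 N, HasDerivAt Q (clip (-1) 1 (V t) * U t ^ 2) t
  one_le_U : ∀ t ∈ Icc 0 N, 1 ≤ U t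
  P_nonneg : ∀ t ∈ Icc 0 N, 0 ≤ P t

theorem clip_sq_le_one (x : ℝ) : clip (-1) 1 x ^ 2 ≤ 1 := by
  have := clip_mem (show (-1 : ℝ) ≤ 1 by norm_num) x
  nlinarith

theorem abs_clip_le_one (x : ℝ) : |clip (-1) 1 x| ≤ 1 :=
  abs_le.2 (clip_mem (show (-1 : ℝ) ≤ 1 by norm_num) x)

theorem add_le_exp_of_hasDerivAt {b N : ℝ} {U P P' : ℝ → ℝ} (hU0 : U 0 = 1) (hP0 : P 0 = b)
    (hb : b ≤ 20)
    (hU' : ∀ t ∈ Icc 0 N, ∃ c, c ≤ P t ∧ HasDerivAt U c t)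
    (hP : ∀ t ∈ Icc 0 N, HasDerivAt P (P' t) t) (hle : ∀ t ∈ Icc 0 N, P' t ≤ U t) :
    ∀ t ∈ Icc 0 N, U t + P t ≤ 21 * Real.exp t := by
  intro t ht
  choose! c hc hc' using hU'
  have hsub : Icc 0 t ⊆ Icc 0 N := Icc_subset_Icc_right ht.2
  have hd : ∀ s : ℝ, HasDerivAt (fun s => Real.exp (-s)) (-Real.exp (-s)) s := by
    intro s
    simpa using (hasDerivAt_neg s).exp
  have := le_of_hasDerivAt_le (f := fun s => (U s + P s) * Real.exp (-s)) (g := fun _ => 21)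
    (g' := fun _ => 0) ht.1
    (fun s hs => ((hc' s (hsub hs)).add (hP s (hsub hs))).mul (hd s))
    (fun s _ => hasDerivAt_const _ _) (fun s hs => by
      have h1 := hc s (hsub hs)
      have h2 := hle s (hsub hs)
      have h3 := Real.exp_pos (-s)
      simp only [Pi.add_apply]
      nlinarith) (by simp [hU0, hP0]; linarith)
  simp only [Real.exp_neg] at this
  have h3 := Real.exp_pos t
  rwa [← div_eq_mul_inv, div_le_iff₀ h3] at this

namespace SemiSol

variable {b N : ℝ} {U V P Q : ℝ → ℝ}

theorem add_le (h : SemiSol b N U V P Q) (hb : b ≤ 20) :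
    ∀ t ∈ Icc 0 N, U t + P t ≤ 21 * Real.exp t :=
  add_le_exp_of_hasDerivAt h.U0 h.P0 hb (fun t ht => ⟨_, le_rfl, h.dU t ht⟩) h.dP fun t ht => by
    have h1 := h.one_le_U t ht
    have h2 := clip_sq_le_one (V t)
    nlinarith

theorem abs_Q_le (h : SemiSol b N U V P Q) (hb : b ∈ Icc (0 : ℝ) 20) :
    ∀ t ∈ Icc 0 N, |Q t| ≤ 20 + (21 * Real.exp N) ^ 2 * N := by
  intro t ht
  have hsub : Icc 0 t ⊆ Icc 0 N := Icc_subset_Icc_right ht.2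
  set R := 21 * Real.exp N with hR
  have hbd : ∀ s ∈ Icc 0 t, |clip (-1) 1 (V s) * U s ^ 2| ≤ R ^ 2 := by
    intro s hs
    have h1 := h.one_le_U s (hsub hs)
    have h2 := h.add_le hb.2 s (hsub hs)
    have h3 := h.P_nonneg s (hsub hs)
    have h4 : Real.exp s ≤ Real.exp N := Real.exp_le_exp.2 (hsub hs).2
    rw [abs_mul, abs_pow, abs_of_nonneg (by linarith : 0 ≤ U s)]
    have : |clip (-1) 1 (V s)| * U s ^ 2 ≤ 1 * R ^ 2 := by
      gcongr
      · exact abs_clip_le_one _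
      · linarith
    linarith
  have h1 := le_of_hasDerivAt_le (f := Q) (g := fun s => R ^ 2 * s) (g' := fun _ => R ^ 2) ht.1
    (fun s hs => h.dQ s (hsub hs)) (fun s _ => by simpa using (hasDerivAt_id s).const_mul (R ^ 2))
    (fun s hs => (abs_le.1 (hbd s hs)).2) (by simp [h.Q0, hb.1])
  have h2 := le_of_hasDerivAt_le (f := fun s => -20 - R ^ 2 * s) (g := Q) (f' := fun _ => -R ^ 2)
    ht.1
    (fun s _ => by simpa using ((hasDerivAt_id s).const_mul (R ^ 2)).const_sub (-20))
    (fun s hs => h.dQ s (hsub hs))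
    (fun s hs => (abs_le.1 (hbd s hs)).1) (by simp [h.Q0, hb.2])
  have h3 : R ^ 2 * t ≤ R ^ 2 * N := by gcongr; exact ht.2
  rw [abs_le]
  constructor <;> linarith

/-- A semi-truncated solution is an integral curve of the fully truncated field. -/
theorem hasDerivAt_prod (h : SemiSol b N U V P Q) (hb : b ∈ Icc (0 : ℝ) 20) {R M : ℝ}
    (hR : R = 21 * Real.exp N) (hM : M = 20 + R ^ 2 * N + R) (hN : 0 ≤ N) :
    ∀ t ∈ Icc 0 N, HasDerivAt (fun t => (U t, V t, P t, Q t))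
      (clippedField R M (U t, V t, P t, Q t)) t := by
  intro t ht
  have h1 := h.one_le_U t ht
  have h2 := h.add_le hb.2 t ht
  have h3 := h.P_nonneg t ht
  have h4 : Real.exp t ≤ Real.exp N := Real.exp_le_exp.2 ht.2
  have h5 := h.abs_Q_le hb t ht
  have hR0 : 0 < R := by rw [hR]; positivity
  have hRN : 0 ≤ R ^ 2 * N := by positivity
  rw [← hR] at h5
  have e : clippedField R M (U t, V t, P t, Q t) =
      (P t, Q t, U t * clip (-1) 1 (V t) ^ 2, clip (-1) 1 (V t) * U t ^ 2) := by
    have h6 := abs_le.1 h5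
    simp only [clippedField]
    rw [clip_of_mem (by linarith) (by linarith), clip_of_mem (by linarith) (by linarith),
      clip_of_mem h1 (by linarith)]
  rw [e]
  exact (h.dU t ht).prodMk ((h.dV t ht).prodMk ((h.dP t ht).prodMk (h.dQ t ht)))

/-- Conversely, integral curves of the truncated field are semi-truncated solutions. -/
theorem of_hasDerivAt (hb : b ∈ Icc (0 : ℝ) 20) {R M : ℝ}
    (hR : R = 21 * Real.exp N) (hM : M = 20 + R ^ 2 * N + R) (hN : 0 ≤ N)
    {α : ℝ → ℝ × ℝ × ℝ × ℝ} (h0 : α 0 = (1, 1, b, -b))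
    (hα : ∀ t ∈ Icc 0 N, HasDerivAt α (clippedField R M (α t)) t) :
    SemiSol b N (fun t => (α t).1) (fun t => (α t).2.1) (fun t => (α t).2.2.1)
      (fun t => (α t).2.2.2) := by
  have hexp : 1 ≤ Real.exp N := Real.one_le_exp hN
  have hR1 : 1 ≤ R := by rw [hR]; linarith
  have hRN : 0 ≤ R ^ 2 * N := by positivity
  have c1 := fun x => clip_mem hR1 x
  have c3 := fun x => clip_mem (show -M ≤ M by linarith) x
  have dU : ∀ t ∈ Icc 0 N, HasDerivAt (fun t => (α t).1) (clip (-M) M (α t).2.2.1) t :=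
    fun t ht => (hα t ht).fst
  have dV : ∀ t ∈ Icc 0 N, HasDerivAt (fun t => (α t).2.1) (clip (-M) M (α t).2.2.2) t :=
    fun t ht => (hα t ht).snd.fst
  have dP : ∀ t ∈ Icc 0 N, HasDerivAt (fun t => (α t).2.2.1)
      (clip 1 R (α t).1 * clip (-1) 1 (α t).2.1 ^ 2) t :=
    fun t ht => (hα t ht).snd.snd.fst
  have dQ : ∀ t ∈ Icc 0 N, HasDerivAt (fun t => (α t).2.2.2)
      (clip (-1) 1 (α t).2.1 * clip 1 R (α t).1 ^ 2) t :=
    fun t ht => (hα t ht).snd.snd.snd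
  have hP0 : ∀ t ∈ Icc 0 N, 0 ≤ (α t).2.2.1 := fun t ht =>
    le_of_hasDerivAt_le (f := fun _ => 0) (f' := fun _ => 0) ht.1 (fun s _ => hasDerivAt_const _ _)
      (fun s hs => dP s (Icc_subset_Icc_right ht.2 hs))
      (fun s _ => by have := (c1 (α s).1).1; positivity) (by simp [h0, hb.1])
  have hclip : ∀ t ∈ Icc 0 N, 0 ≤ clip (-M) M (α t).2.2.1 := fun t ht =>
    le_max_of_le_right (le_min (by linarith) (hP0 t ht))
  have hclip' : ∀ t ∈ Icc 0 N, clip (-M) M (α t).2.2.1 ≤ (α t).2.2.1 := fun t ht =>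
    max_le (by linarith [hP0 t ht]) (min_le_right _ _)
  have hU1 : ∀ t ∈ Icc 0 N, 1 ≤ (α t).1 := fun t ht =>
    le_of_hasDerivAt_le (f := fun _ => 1) (f' := fun _ => 0) ht.1 (fun s _ => hasDerivAt_const _ _)
      (fun s hs => dU s (Icc_subset_Icc_right ht.2 hs))
      (fun s hs => hclip s (Icc_subset_Icc_right ht.2 hs)) (by simp [h0])
  have hUle : ∀ t ∈ Icc 0 N, (α t).1 + (α t).2.2.1 ≤ R := fun t ht => by
    refine (add_le_exp_of_hasDerivAt (U := fun t => (α t).1) (P := fun t => (α t).2.2.1)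
      (b := b) (by simp [h0]) (by simp [h0]) hb.2
      (fun t ht => ⟨_, hclip' t ht, dU t ht⟩) dP (fun s hs => ?_) t ht).trans ?_
    · have e1 : clip 1 R (α s).1 ≤ (α s).1 := max_le (hU1 s hs) (min_le_right _ _)
      have e2 := (c1 (α s).1).1
      have e3 := clip_sq_le_one (α s).2.1
      nlinarith
    · rw [hR]
      have : Real.exp t ≤ Real.exp N := Real.exp_le_exp.2 ht.2
      linarith
  have eU : ∀ t ∈ Icc 0 N, clip 1 R (α t).1 = (α t).1 := fun t ht =>
    clip_of_mem (hU1 t ht) (by linarith [hUle t ht, hP0 t ht])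
  have eP : ∀ t ∈ Icc 0 N, clip (-M) M (α t).2.2.1 = (α t).2.2.1 := fun t ht =>
    clip_of_mem (by linarith [hP0 t ht]) (by linarith [hUle t ht, hU1 t ht])
  have hQbd : ∀ s ∈ Icc 0 N, |clip (-1) 1 (α s).2.1 * clip 1 R (α s).1 ^ 2| ≤ R ^ 2 := by
    intro s hs
    have e1 := c1 (α s).1
    rw [abs_mul, abs_pow, abs_of_nonneg (by linarith : 0 ≤ clip 1 R (α s).1)]
    have : |clip (-1) 1 (α s).2.1| * clip 1 R (α s).1 ^ 2 ≤ 1 * R ^ 2 := by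
      gcongr
      · exact abs_clip_le_one _
      · linarith
      · exact e1.2
    linarith
  have eQ : ∀ t ∈ Icc 0 N, clip (-M) M (α t).2.2.2 = (α t).2.2.2 := by
    intro t ht
    have hsub : Icc 0 t ⊆ Icc 0 N := Icc_subset_Icc_right ht.2
    have h1 := le_of_hasDerivAt_le (g := fun s => R ^ 2 * s) (g' := fun _ => R ^ 2)
      ht.1 (fun s hs => dQ s (hsub hs))
      (fun s _ => by simpa using (hasDerivAt_id s).const_mul (R ^ 2))
      (fun s hs => (abs_le.1 (hQbd s (hsub hs))).2) (by simp [h0, hb.1])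
    have h2 := le_of_hasDerivAt_le (f := fun s => -20 - R ^ 2 * s) (f' := fun _ => -R ^ 2)
      ht.1 (fun s _ => by simpa using ((hasDerivAt_id s).const_mul (R ^ 2)).const_sub (-20))
      (fun s hs => dQ s (hsub hs))
      (fun s hs => (abs_le.1 (hQbd s (hsub hs))).1) (by simp [h0, hb.2])
    have h3 : R ^ 2 * t ≤ R ^ 2 * N := by gcongr; exact ht.2
    exact clip_of_mem (by linarith) (by linarith)
  refine ⟨by simp [h0], by simp [h0], by simp [h0], by simp [h0], fun t ht => ?_, fun t ht => ?_,
    fun t ht => ?_, fun t ht => ?_, hU1, hP0⟩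
  · simpa only [eP t ht] using dU t ht
  · simpa only [eQ t ht] using dV t ht
  · simpa only [eU t ht] using dP t ht
  · simpa only [eU t ht] using dQ t ht

end SemiSol

namespace SemiSol

variable {b N : ℝ} {U V P Q : ℝ → ℝ}

theorem mono (h : SemiSol b N U V P Q) {M : ℝ} (hM : M ≤ N) : SemiSol b M U V P Q := by
  have hsub : Icc 0 M ⊆ Icc 0 N := Icc_subset_Icc_right hM
  exact ⟨h.U0, h.V0, h.P0, h.Q0, fun t ht => h.dU t (hsub ht), fun t ht => h.dV t (hsub ht),
    fun t ht => h.dP t (hsub ht), fun t ht => h.dQ t (hsub ht),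
    fun t ht => h.one_le_U t (hsub ht), fun t ht => h.P_nonneg t (hsub ht)⟩

theorem continuousOn_V (h : SemiSol b N U V P Q) : ContinuousOn V (Icc 0 N) :=
  fun t ht => (h.dV t ht).continuousAt.continuousWithinAt

/-- Minimum principle. -/
theorem V_nonneg (h : SemiSol b N U V P Q) (hN : 0 ≤ N) (hVN : 0 ≤ V N) :
    ∀ t ∈ Icc 0 N, 0 ≤ V t := by
  obtain ⟨s, hs, hmin⟩ := isCompact_Icc.exists_isMinOn ⟨0, left_mem_Icc.2 hN⟩ h.continuousOn_V
  intro t ht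
  refine le_trans ?_ (hmin ht)
  by_contra! hneg
  have hs0 : s ≠ 0 := by rintro rfl; linarith [h.V0]
  have hsN : s ≠ N := by rintro rfl; linarith
  have hs' : s ∈ Ioo 0 N := ⟨lt_of_le_of_ne hs.1 (Ne.symm hs0), lt_of_le_of_ne hs.2 hsN⟩
  have hmax : IsLocalMax (fun t => - V t) s := by
    filter_upwards [Icc_mem_nhds hs'.1 hs'.2] with x hx
    exact neg_le_neg (hmin hx)
  have := second_deriv_nonpos_of_isLocalMax hmax (f' := fun t => - Q t)
    (by filter_upwards [Icc_mem_nhds hs'.1 hs'.2] with x hx using (h.dV x hx).neg)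
    (h.dQ s hs).neg
  have hc : clip (-1) 1 (V s) < 0 := by
    simp [clip, hneg]
  have hU := h.one_le_U s hs
  have : clip (-1) 1 (V s) * U s ^ 2 < 0 := mul_neg_of_neg_of_pos hc (by positivity)
  linarith

theorem Q_nonpos (h : SemiSol b N U V P Q) (hN : 0 ≤ N) (hVN : V N = 0) :
    ∀ t ∈ Ico 0 N, Q t ≤ 0 := by
  have hV := h.V_nonneg hN hVN.ge
  intro t ht
  by_contra! hpos
  have hsub : Icc t N ⊆ Icc 0 N := Icc_subset_Icc_left ht.1
  have hmono := monotoneOn_of_hasDerivAt (fun s hs => h.dQ s (hsub hs)) (fun s hs => by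
    have : 0 ≤ clip (-1) 1 (V s) :=
      le_max_of_le_right (le_min (by norm_num) (hV s (hsub hs)))
    positivity)
  have := le_of_hasDerivAt_le (f := fun s => V t + Q t * (s - t)) (f' := fun _ => Q t) (g := V)
    ht.2.le (fun s _ => by simpa using (((hasDerivAt_id s).sub_const t).const_mul (Q t)).const_add (V t))
    (fun s hs => h.dV s (hsub hs))
    (fun s hs => hmono (left_mem_Icc.2 ht.2.le) hs hs.1) (by simp)
  have h2 := hV t ⟨ht.1, ht.2.le⟩
  have h3 : 0 < Q t * (N - t) := mul_pos hpos (sub_pos.2 ht.2)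
  linarith

theorem pos_of_zero_slope (h : SemiSol 0 N U V P Q) (hN : 0 ≤ N) : 0 ≤ V N := by
  have hmono : ∀ t ∈ Icc 0 N, 0 ≤ V t * Q t := fun t ht => by
    refine le_of_hasDerivAt_le (f := fun _ => 0) (f' := fun _ => 0) (g := V * Q) ht.1
      (fun s _ => hasDerivAt_const _ _)
      (fun s hs => (h.dV s (Icc_subset_Icc_right ht.2 hs)).mul (h.dQ s (Icc_subset_Icc_right ht.2 hs)))
      (fun s hs => ?_) (by simp [h.Q0])
    have : 0 ≤ V s * clip (-1) 1 (V s) := by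
      rcases le_total 0 (V s) with hv | hv
      · exact mul_nonneg hv (le_max_of_le_right (le_min (by norm_num) hv))
      · exact mul_nonneg_of_nonpos_of_nonpos hv
          (max_le (by norm_num) ((min_le_right _ _).trans hv))
    have h2 : 0 ≤ V s * clip (-1) 1 (V s) * U s ^ 2 := by positivity
    nlinarith [sq_nonneg (Q s)]
  have hsq : ∀ t ∈ Icc 0 N, 1 ≤ V t ^ 2 := fun t ht => by
    refine le_of_hasDerivAt_le (f := fun _ => 1) (f' := fun _ => 0) (g := V ^ 2) ht.1
      (fun s _ => hasDerivAt_const _ _)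
      (fun s hs => (h.dV s (Icc_subset_Icc_right ht.2 hs)).pow 2)
      (fun s hs => ?_) (by simp [h.V0])
    have := hmono s (Icc_subset_Icc_right ht.2 hs)
    simp only [Nat.cast_ofNat, Nat.add_one_sub_one, pow_one]
    linarith
  by_contra! hneg
  obtain ⟨s, hs, hs0⟩ := intermediate_value_Icc' hN h.continuousOn_V
    (show (0 : ℝ) ∈ Icc (V N) (V 0) from ⟨hneg.le, by rw [h.V0]; norm_num⟩)
  have := hsq s hs
  rw [hs0] at this
  norm_num at this

theorem nonpos_of_large_slope (h : SemiSol 20 N U V P Q) (hN : 1 ≤ N) : V N ≤ 0 := by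
  by_contra! hpos
  have hV := h.V_nonneg (by linarith) hpos.le
  have hsub : ∀ t : ℝ, t ≤ 1 / 10 → Icc 0 t ⊆ Icc 0 N := fun t ht =>
    Icc_subset_Icc_right (by linarith)
  have hexp : Real.exp (1 / 10) ≤ 10 / 9 := by
    have h1 := Real.add_one_le_exp (-(1 / 10) : ℝ)
    rw [Real.exp_neg] at h1
    have h2 := Real.exp_pos (1 / 10 : ℝ)
    have h3 : (9 / 10 : ℝ) * Real.exp (1 / 10) ≤ 1 := by
      have : (9 / 10 : ℝ) ≤ (Real.exp (1 / 10))⁻¹ := by linarith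
      calc (9 / 10 : ℝ) * Real.exp (1 / 10) ≤ (Real.exp (1 / 10))⁻¹ * Real.exp (1 / 10) := by gcongr
        _ = 1 := by field_simp
    linarith
  have hU24 : ∀ t ∈ Icc (0 : ℝ) (1 / 10), U t ≤ 24 := fun t ht => by
    have h1 := h.add_le le_rfl t (hsub _ le_rfl ht)
    have h2 := h.P_nonneg t (hsub _ le_rfl ht)
    have h3 : Real.exp t ≤ Real.exp (1 / 10) := Real.exp_le_exp.2 ht.2
    linarith
  have hP24 : ∀ t ∈ Icc (0 : ℝ) (1 / 10), P t ≤ 20 + 24 * t := fun t ht => by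
    refine le_of_hasDerivAt_le (g := fun t => 20 + 24 * t) (g' := fun _ => 24) ht.1
      (fun s hs => h.dP s (hsub _ ht.2 hs))
      (fun s _ => by simpa using ((hasDerivAt_id s).const_mul 24).const_add 20)
      (fun s hs => ?_) (by simp [h.P0])
    have h1 := hU24 s ⟨hs.1, hs.2.trans ht.2⟩
    have h2 := clip_sq_le_one (V s)
    have h3 := h.one_le_U s (hsub _ ht.2 hs)
    nlinarith
  have hU4 : ∀ t ∈ Icc (0 : ℝ) (1 / 10), U t ≤ 1 + 23 * t := fun t ht => by
    refine le_of_hasDerivAt_le (g := fun t => 1 + 23 * t) (g' := fun _ => 23) ht.1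
      (fun s hs => h.dU s (hsub _ ht.2 hs))
      (fun s _ => by simpa using ((hasDerivAt_id s).const_mul 23).const_add 1)
      (fun s hs => ?_) (by simp [h.U0])
    have h1 := hP24 s ⟨hs.1, hs.2.trans ht.2⟩
    linarith [hs.2, ht.2]
  have hQ : ∀ t ∈ Icc (0 : ℝ) (1 / 10), Q t ≤ -20 + 16 * t := fun t ht => by
    refine le_of_hasDerivAt_le (g := fun t => -20 + 16 * t) (g' := fun _ => 16) ht.1
      (fun s hs => h.dQ s (hsub _ ht.2 hs))
      (fun s _ => by simpa using ((hasDerivAt_id s).const_mul 16).const_add (-20))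
      (fun s hs => ?_) (by simp [h.Q0])
    have h1 := hU4 s ⟨hs.1, hs.2.trans ht.2⟩
    have h2 := (clip_mem (show (-1 : ℝ) ≤ 1 by norm_num) (V s)).2
    have h3 := h.one_le_U s (hsub _ ht.2 hs)
    have h4 : U s ≤ 4 := by linarith [hs.2, ht.2]
    have h5 : U s ^ 2 ≤ 16 := by nlinarith
    nlinarith [sq_nonneg (U s)]
  have hV' : V (1 / 10) ≤ 1 - 18 * (1 / 10) := by
    refine le_of_hasDerivAt_le (g := fun t => 1 - 18 * t) (g' := fun _ => -18) (by norm_num)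
      (fun s hs => h.dV s (hsub _ le_rfl hs))
      (fun s _ => by simpa using ((hasDerivAt_id s).const_mul 18).const_sub 1)
      (fun s hs => ?_) (by simp [h.V0])
    have h1 := hQ s hs
    linarith [hs.2]
  have := hV (1 / 10) (hsub (1 / 10) le_rfl ⟨by norm_num, le_rfl⟩)
  norm_num at hV'
  linarith

end SemiSol

/-- Genuine solutions on `[0, N]` of the shooting problem. -/
structure GoodSol (b N : ℝ) (U V P Q : ℝ → ℝ) : Prop extends SemiSol b N U V P Q where
  V_nonneg' : ∀ t ∈ Icc 0 N, 0 ≤ V t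
  V_le_one : ∀ t ∈ Icc 0 N, V t ≤ 1
  Q_nonpos' : ∀ t ∈ Icc 0 N, Q t ≤ 0

theorem GoodSol.mono {b N : ℝ} {U V P Q : ℝ → ℝ} (h : GoodSol b N U V P Q) {M : ℝ} (hM : M ≤ N) :
    GoodSol b M U V P Q := by
  have hsub : Icc 0 M ⊆ Icc 0 N := Icc_subset_Icc_right hM
  exact ⟨h.toSemiSol.mono hM, fun t ht => h.V_nonneg' t (hsub ht),
    fun t ht => h.V_le_one t (hsub ht), fun t ht => h.Q_nonpos' t (hsub ht)⟩

/-- The flow of the truncated system: it represents all semi-truncated solutions. -/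
theorem exists_semi_flow {N : ℝ} (hN : 0 ≤ N) :
    ∃ α : ℝ → ℝ → ℝ × ℝ × ℝ × ℝ,
      (∀ b ∈ Icc (0 : ℝ) 20, SemiSol b N (fun t => (α b t).1) (fun t => (α b t).2.1)
        (fun t => (α b t).2.2.1) (fun t => (α b t).2.2.2)) ∧
      (∀ t ∈ Icc 0 N, ContinuousOn (fun b => α b t) (Icc 0 20)) ∧
      ∀ b ∈ Icc (0 : ℝ) 20, ∀ U V P Q, SemiSol b N U V P Q →
        ∀ t ∈ Icc 0 N, (U t, V t, P t, Q t) = α b t := by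
  have hexp : 1 ≤ Real.exp N := Real.one_le_exp hN
  have hR1 : 1 ≤ 21 * Real.exp N := by linarith
  obtain ⟨α, h1, h2⟩ := exists_clipped_flow hR1
    (M := 20 + (21 * Real.exp N) ^ 2 * N + 21 * Real.exp N) (by positivity) hN
  refine ⟨α, fun b hb => SemiSol.of_hasDerivAt hb rfl rfl hN (h1 b hb).1 (h1 b hb).2, h2,
    fun b hb U V P Q h => ?_⟩
  have hd := h.hasDerivAt_prod hb rfl rfl hN
  refine ODE_solution_unique (v := fun _ => clippedField _ _) (a := 0) (b := N)
    (f := fun t => (U t, V t, P t, Q t)) (g := α b)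
    (fun _ => lipschitzWith_clippedField hR1)
    (fun t ht => (hd t ht).continuousAt.continuousWithinAt)
    (fun t ht => (hd t (Ico_subset_Icc_self ht)).hasDerivWithinAt)
    (fun t ht => ((h1 b hb).2 t ht).continuousAt.continuousWithinAt)
    (fun t ht => ((h1 b hb).2 t (Ico_subset_Icc_self ht)).hasDerivWithinAt) ?_
  simp [h.U0, h.V0, h.P0, h.Q0, (h1 b hb).1]

theorem exists_goodSol {N : ℝ} (hN : 0 ≤ N) :
    ∃ b ∈ Icc (0 : ℝ) 20, ∃ U V P Q, GoodSol b N U V P Q := by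
  have hN1 : 0 ≤ N + 1 := by linarith
  obtain ⟨α, h1, h2, -⟩ := exists_semi_flow hN1
  have hmem : N + 1 ∈ Icc 0 (N + 1) := right_mem_Icc.2 hN1
  have hcont : ContinuousOn (fun b => (α b (N + 1)).2.1) (Icc 0 20) :=
    (continuous_fst.comp continuous_snd).comp_continuousOn (h2 _ hmem)
  obtain ⟨b, hb, hb0⟩ := intermediate_value_Icc' (by norm_num) hcont
    (show (0 : ℝ) ∈ Icc _ _ from
      ⟨(h1 20 (by norm_num)).nonpos_of_large_slope (by linarith),
       (h1 0 (by norm_num)).pos_of_zero_slope hN1⟩)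
  have hs := h1 b hb
  have hV := hs.V_nonneg hN1 hb0.ge
  have hQ := hs.Q_nonpos hN1 hb0
  have hsub : Icc 0 N ⊆ Icc 0 (N + 1) := Icc_subset_Icc_right (by linarith)
  refine ⟨b, hb, _, _, _, _, hs.mono (by linarith), fun t ht => hV t (hsub ht), fun t ht => ?_,
    fun t ht => hQ t ⟨ht.1, by linarith [ht.2]⟩⟩
  exact le_of_hasDerivAt_le (g := fun _ => 1) (g' := fun _ => 0) ht.1
    (fun s hs' => hs.dV s (hsub (Icc_subset_Icc_right ht.2 hs')))
    (fun s _ => hasDerivAt_const _ _)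
    (fun s hs' => hQ s ⟨hs'.1, by linarith [hs'.2, ht.2]⟩) hs.V0.le

/-- A slope for which the shooting problem has a solution on every bounded interval. -/
theorem exists_goodSol_all : ∃ b ∈ Icc (0 : ℝ) 20, ∀ N : ℝ, ∃ U V P Q, GoodSol b N U V P Q := by
  choose b hb hgood using fun k : ℕ => exists_goodSol (N := k) k.cast_nonneg
  obtain ⟨b', hb', φ, hφ, hlim⟩ := isCompact_Icc.tendsto_subseq hb
  refine ⟨b', hb', fun N => ?_⟩
  wlog hN : 0 ≤ N
  · obtain ⟨U, V, P, Q, h⟩ := this b hb hgood b' hb' φ hφ hlim 0 le_rfl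
    exact ⟨U, V, P, Q, h.mono (by linarith)⟩
  obtain ⟨α, h1, h2, h3⟩ := exists_semi_flow hN
  have hlim' : Tendsto (b ∘ φ) atTop (𝓝[Icc 0 20] b') :=
    tendsto_nhdsWithin_iff.2 ⟨hlim, Eventually.of_forall fun k => hb _⟩
  have hlimα : ∀ t ∈ Icc 0 N, Tendsto (fun k => α (b (φ k)) t) atTop (𝓝 (α b' t)) := fun t ht =>
    Tendsto.comp (h2 t ht b' hb') hlim'
  have hev : ∀ᶠ k in atTop, ∀ t ∈ Icc 0 N, 0 ≤ (α (b (φ k)) t).2.1 ∧ (α (b (φ k)) t).2.1 ≤ 1 ∧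
      (α (b (φ k)) t).2.2.2 ≤ 0 := by
    filter_upwards [eventually_ge_atTop ⌈N⌉₊] with k hk t ht
    obtain ⟨U, V, P, Q, h⟩ := hgood (φ k)
    have hle : N ≤ (φ k : ℕ) :=
      (Nat.le_ceil N).trans (by exact_mod_cast hk.trans (hφ.id_le k))
    have h' := h.mono hle
    have e := h3 _ (hb (φ k)) _ _ _ _ h'.toSemiSol t ht
    rw [← e]
    exact ⟨h'.V_nonneg' t ht, h'.V_le_one t ht, h'.Q_nonpos' t ht⟩
  have c1 : Continuous fun p : ℝ × ℝ × ℝ × ℝ => p.2.1 := by fun_prop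
  have c2 : Continuous fun p : ℝ × ℝ × ℝ × ℝ => p.2.2.2 := by fun_prop
  refine ⟨_, _, _, _, h1 b' hb', fun t ht => ?_, fun t ht => ?_, fun t ht => ?_⟩
  · exact ge_of_tendsto ((c1.tendsto _).comp (hlimα t ht)) (hev.mono fun k hk => (hk t ht).1)
  · exact le_of_tendsto ((c1.tendsto _).comp (hlimα t ht)) (hev.mono fun k hk => (hk t ht).2.1)
  · exact le_of_tendsto ((c2.tendsto _).comp (hlimα t ht)) (hev.mono fun k hk => (hk t ht).2.2)

/-- A global solution of the shooting problem. -/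
theorem exists_global_goodSol :
    ∃ b, ∃ U V P Q : ℝ → ℝ, U 0 = 1 ∧ V 0 = 1 ∧ P 0 = b ∧ Q 0 = -b ∧
      ∀ t, 0 ≤ t → HasDerivAt U (P t) t ∧ HasDerivAt V (Q t) t ∧
        HasDerivAt P (U t * V t ^ 2) t ∧ HasDerivAt Q (V t * U t ^ 2) t ∧
        1 ≤ U t ∧ 0 ≤ P t ∧ 0 ≤ V t ∧ V t ≤ 1 ∧ Q t ≤ 0 := by
  obtain ⟨b, hb, hgood⟩ := exists_goodSol_all
  choose U V P Q h using hgood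
  have huniq : ∀ M N : ℝ, 0 ≤ M → M ≤ N → ∀ t ∈ Icc 0 M,
      (U M t, V M t, P M t, Q M t) = (U N t, V N t, P N t, Q N t) := by
    intro M N hM hMN t ht
    obtain ⟨α, -, -, h3⟩ := exists_semi_flow hM
    rw [h3 b hb _ _ _ _ (h M).toSemiSol t ht,
      h3 b hb _ _ _ _ ((h N).mono hMN).toSemiSol t ht]
  have huniq' : ∀ M N t : ℝ, 0 ≤ t → t ≤ M → t ≤ N →
      (U M t, V M t, P M t, Q M t) = (U N t, V N t, P N t, Q N t) := by
    intro M N t h0 h1 h2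
    rcases le_total M N with h | h
    · exact huniq M N (h0.trans h1) h t ⟨h0, h1⟩
    · exact (huniq N M (h0.trans h2) h t ⟨h0, h2⟩).symm
  have key : ∀ (F : ℝ → ℝ → ℝ) (G : ℝ → ℝ) (hF : ∀ M N t, 0 ≤ t → t ≤ M → t ≤ N → F M t = F N t)
      (hd : ∀ N, ∀ t ∈ Icc 0 N, HasDerivAt (F N) (G t) t) (t : ℝ) (ht : 0 ≤ t),
      HasDerivAt (fun t => F (max t 0 + 1) (max t 0) + (min t 0) * G 0) (G t) t := by
    intro F G hF hd t ht
    rcases ht.eq_or_lt with rfl | ht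
    · have hl : HasDerivWithinAt (fun t => F (max t 0 + 1) (max t 0) + (min t 0) * G 0) (G 0)
          (Iic 0) 0 := by
        have : HasDerivAt (fun t : ℝ => F (0 + 1) 0 + t * G 0) (G 0) 0 := by
          simpa using ((hasDerivAt_id (0 : ℝ)).mul_const (G 0)).const_add (F (0 + 1) 0)
        refine this.hasDerivWithinAt.congr (fun x hx => ?_) (by simp)
        simp only [mem_Iic] at hx
        simp [hx]
      have hr : HasDerivWithinAt (fun t => F (max t 0 + 1) (max t 0) + (min t 0) * G 0) (G 0)
          (Ici 0 ∩ Iio 1) 0 := by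
        refine ((hd 2 0 (by norm_num)).hasDerivWithinAt (s := Ici 0 ∩ Iio 1)).congr
          (fun x hx => ?_) ?_
        · have hx0 : (0 : ℝ) ≤ x := hx.1
          have hx1 : x < 1 := hx.2
          rw [max_eq_left hx0, min_eq_right hx0]
          simp [hF (x + 1) 2 x hx0 (by linarith) (by linarith)]
        · simpa using hF 1 2 0 le_rfl (by norm_num) (by norm_num)
      have hr' := (hasDerivWithinAt_inter (Iio_mem_nhds (zero_lt_one' ℝ))).1 hr
      have := hl.union hr'
      rwa [Iic_union_Ici, hasDerivWithinAt_univ] at this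
    · refine (hd (t + 1) t ⟨ht.le, by linarith⟩).congr_of_eventuallyEq ?_
      filter_upwards [Ioo_mem_nhds ht (show t < t + 1 by linarith)] with x hx
      rw [max_eq_left hx.1.le, min_eq_right hx.1.le]
      simp [hF (x + 1) (t + 1) x hx.1.le (by linarith) hx.2.le]
  have eU := fun M N t h0 h1 h2 => congrArg Prod.fst (huniq' M N t h0 h1 h2)
  have eV := fun M N t h0 h1 h2 => congrArg (fun p => p.2.1) (huniq' M N t h0 h1 h2)
  have eP := fun M N t h0 h1 h2 => congrArg (fun p => p.2.2.1) (huniq' M N t h0 h1 h2)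
  have eQ := fun M N t h0 h1 h2 => congrArg (fun p => p.2.2.2) (huniq' M N t h0 h1 h2)
  simp only at eU eV eP eQ
  have hclip : ∀ N, ∀ t ∈ Icc 0 N, clip (-1) 1 (V N t) = V N t := fun N t ht =>
    clip_of_mem (by linarith [(h N).V_nonneg' t ht]) ((h N).V_le_one t ht)
  have hU := key U (fun t => P (t + 1) t) eU (fun N t ht => by
    have := (h N).dU t ht
    rwa [eP N (t + 1) t ht.1 ht.2 (by linarith)] at this)
  have hV := key V (fun t => Q (t + 1) t) eV (fun N t ht => by
    have := (h N).dV t ht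
    rwa [eQ N (t + 1) t ht.1 ht.2 (by linarith)] at this)
  have hP := key P (fun t => U (t + 1) t * V (t + 1) t ^ 2) eP (fun N t ht => by
    have := (h N).dP t ht
    rwa [hclip N t ht, eU N (t + 1) t ht.1 ht.2 (by linarith),
      eV N (t + 1) t ht.1 ht.2 (by linarith)] at this)
  have hQ := key Q (fun t => V (t + 1) t * U (t + 1) t ^ 2) eQ (fun N t ht => by
    have := (h N).dQ t ht
    rwa [hclip N t ht, eU N (t + 1) t ht.1 ht.2 (by linarith),
      eV N (t + 1) t ht.1 ht.2 (by linarith)] at this)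
  refine ⟨b, fun t => U (max t 0 + 1) (max t 0) + min t 0 * P (0 + 1) 0,
    fun t => V (max t 0 + 1) (max t 0) + min t 0 * Q (0 + 1) 0,
    fun t => P (max t 0 + 1) (max t 0) + min t 0 * (U (0 + 1) 0 * V (0 + 1) 0 ^ 2),
    fun t => Q (max t 0 + 1) (max t 0) + min t 0 * (V (0 + 1) 0 * U (0 + 1) 0 ^ 2),
    ?_, ?_, ?_, ?_, fun t ht => ?_⟩
  rotate_left 4
  · have hm : t ∈ Icc 0 (t + 1) := ⟨ht, by linarith⟩
    have e1 : max t 0 = t := max_eq_left ht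
    have e2 : min t 0 = 0 := min_eq_right ht
    refine ⟨(hU t ht).congr_deriv ?_, (hV t ht).congr_deriv ?_, (hP t ht).congr_deriv ?_,
      (hQ t ht).congr_deriv ?_, ?_⟩
    rotate_left 4
    · simp only [e1, e2, zero_mul, add_zero]
      exact ⟨(h _).one_le_U t hm, (h _).P_nonneg t hm, (h _).V_nonneg' t hm, (h _).V_le_one t hm,
        (h _).Q_nonpos' t hm⟩
    all_goals simp [e1, e2]
  · simp [(h _).U0]
  · simp [(h _).V0]
  · simp [(h _).P0]
  · simp [(h _).Q0]

/-- Positive increasing solutions of `U'' = U (U ∘ neg) ^ 2`, normalised to have slope one at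
infinity, together with the quantitative bounds used later. -/
structure Profile (U U' : ℝ → ℝ) (a C : ℝ) : Prop where
  a_pos : 0 < a
  a_le : a ≤ 1
  C_pos : 0 < C
  dU : ∀ s, HasDerivAt U (U' s) s
  dU' : ∀ s, HasDerivAt U' (U s * U (-s) ^ 2) s
  pos : ∀ s, 0 < U s
  pos' : ∀ s, 0 < U' s
  zero : U 0 = a
  mul_le : ∀ s, U s * U (-s) ≤ U' s
  deriv_le_one : ∀ s, U' s ≤ 1
  deriv_le : ∀ s, U' s ≤ C * U s * (U (-s) + 1)
  self_le : ∀ s, s ≤ U s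
  le_max : ∀ s, U s ≤ max s 0 + a
  le_exp : ∀ s ≤ 0, U s ≤ a * Real.exp (a * s)

/-- Even-odd gluing of two functions on the half line. -/
theorem hasDerivAt_glue {F G F' G' : ℝ → ℝ} (hF : ∀ t, 0 ≤ t → HasDerivAt F (F' t) t)
    (hG : ∀ t, 0 ≤ t → HasDerivAt G (G' t) t) (h0 : F 0 = G 0) (h1 : F' 0 = -G' 0) (s : ℝ) :
    HasDerivAt (fun s => if 0 ≤ s then F s else G (-s)) (if 0 ≤ s then F' s else -G' (-s)) s := by
  have hG' : ∀ t, t ≤ 0 → HasDerivAt (fun s => G (-s)) (-G' (-t)) t := fun t ht => by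
    simpa [Function.comp_def] using (hG (-t) (by linarith)).comp t (hasDerivAt_neg t)
  rcases lt_trichotomy s 0 with h | rfl | h
  · rw [if_neg (not_le.2 h)]
    refine (hG' s h.le).congr_of_eventuallyEq ?_
    filter_upwards [Iio_mem_nhds h] with x hx
    simp [not_le.2 (show x < 0 from hx)]
  · have e1 : HasDerivWithinAt (fun s => if 0 ≤ s then F s else G (-s)) (F' 0) (Ici 0) 0 :=
      (hF 0 le_rfl).hasDerivWithinAt.congr (fun x hx => if_pos hx) (by simp)
    have e2 : HasDerivWithinAt (fun s => if 0 ≤ s then F s else G (-s)) (F' 0) (Iic 0) 0 := by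
      have := hG' 0 le_rfl
      rw [neg_zero, ← h1] at this
      refine this.hasDerivWithinAt.congr (fun x hx => ?_) (by simp [h0])
      rcases (show x ≤ 0 from hx).eq_or_lt with rfl | hx
      · simp [h0]
      · simp [not_le.2 (show x < 0 from hx)]
    have := e2.union e1
    rw [Iic_union_Ici, hasDerivWithinAt_univ] at this
    simpa using this
  · rw [if_pos h.le]
    refine (hF s h.le).congr_of_eventuallyEq ?_
    filter_upwards [Ioi_mem_nhds h] with x hx
    simp [(show (0 : ℝ) < x from hx).le]

theorem exists_profile : ∃ U U' a C, Profile U U' a C := by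
  obtain ⟨b, U, V, P, Q, U0, V0, P0, Q0, h⟩ := exists_global_goodSol
  have dU := fun t ht => (h t ht).1
  have dV := fun t ht => (h t ht).2.1
  have dP := fun t ht => (h t ht).2.2.1
  have dQ := fun t ht => (h t ht).2.2.2.1
  have hU1 := fun t ht => (h t ht).2.2.2.2.1
  have hP0 := fun t ht => (h t ht).2.2.2.2.2.1
  have hV0 := fun t ht => (h t ht).2.2.2.2.2.2.1
  have hV1 := fun t ht => (h t ht).2.2.2.2.2.2.2.1
  have hQ0 := fun t ht => (h t ht).2.2.2.2.2.2.2.2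
  clear h
  -- monotonicity on the half line
  have mono : ∀ {f f' : ℝ → ℝ}, (∀ t, 0 ≤ t → HasDerivAt f (f' t) t) → (∀ t, 0 ≤ t → 0 ≤ f' t) →
      ∀ {s t}, 0 ≤ s → s ≤ t → f s ≤ f t := fun {f f'} hf hf' s t hs hst =>
    monotoneOn_of_hasDerivAt (fun x hx => hf x (hs.trans hx.1))
      (fun x hx => hf' x (hs.trans hx.1)) (left_mem_Icc.2 hst) (right_mem_Icc.2 hst) hst
  have hVpos : ∀ t, 0 ≤ t → 0 < V t := by
    intro t ht
    by_contra! hle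
    have hz : V t = 0 := le_antisymm hle (hV0 t ht)
    have htp : 0 < t := ht.lt_of_ne (by rintro rfl; linarith)
    have hQz : Q t = 0 := by
      refine IsLocalMin.hasDerivAt_eq_zero ?_ (dV t ht)
      filter_upwards [Ioi_mem_nhds htp] with x hx
      rw [hz]; exact hV0 x (le_of_lt hx)
    have hM := hU1 t ht
    have h1 : ∀ s ∈ Icc 0 t, Q s ^ 2 ≤ U t ^ 2 * V s ^ 2 := by
      intro s hs
      have := monotoneOn_of_hasDerivAt (a := s) (b := t)
        (f := fun x => Q x ^ 2 - U t ^ 2 * V x ^ 2)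
        (f' := fun x => 2 * Q x * (V x * U x ^ 2) - U t ^ 2 * (2 * V x * Q x)) (fun x hx => by
          have h0 := hs.1.trans hx.1
          have := ((dQ x h0).pow 2).sub (((dV x h0).pow 2).const_mul (U t ^ 2))
          refine this.congr_deriv ?_
          norm_num) (fun x hx => by
          have h0 := hs.1.trans hx.1
          have e : U x ^ 2 ≤ U t ^ 2 := by
            have := hU1 x h0
            have := mono dU hP0 h0 hx.2
            gcongr
          have : 0 ≤ (-Q x) * V x := mul_nonneg (by linarith [hQ0 x h0]) (hV0 x h0)
          nlinarith) (left_mem_Icc.2 hs.2) (right_mem_Icc.2 hs.2) hs.2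
      simp only [hz, hQz] at this
      linarith
    have h2 := monotoneOn_of_hasDerivAt (a := 0) (b := t) (f := fun x => V x * Real.exp (U t * x))
      (f' := fun x => Q x * Real.exp (U t * x) + V x * (Real.exp (U t * x) * (U t * 1)))
      (fun x hx => (dV x hx.1).mul (((hasDerivAt_id x).const_mul (U t)).exp)) (fun x hx => by
        have := abs_le_of_sq_le_sq' (a := Q x) (b := U t * V x) (by
          rw [mul_pow]; exact h1 x hx) (mul_nonneg (by linarith) (hV0 x hx.1))
        have e := Real.exp_pos (U t * x)
        nlinarith) (left_mem_Icc.2 ht) (right_mem_Icc.2 ht) ht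
    simp [hz, V0] at h2
    linarith
  -- conserved energy
  obtain ⟨E, hE⟩ : ∃ E, E = 2 * b ^ 2 - 1 := ⟨_, rfl⟩
  have hen : ∀ t, 0 ≤ t → P t ^ 2 + Q t ^ 2 - U t ^ 2 * V t ^ 2 = E := by
    intro t ht
    have hd : ∀ x, 0 ≤ x → HasDerivAt (fun t => P t ^ 2 + Q t ^ 2 - U t ^ 2 * V t ^ 2) 0 x := by
      intro x hx
      refine ((((dP x hx).pow 2).add ((dQ x hx).pow 2)).sub
        (((dU x hx).pow 2).mul ((dV x hx).pow 2))).congr_deriv ?_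
      simp; ring
    have i1 := mono hd (fun _ _ => le_rfl) le_rfl ht
    have i2 := mono (fun x hx => (hd x hx).neg) (fun _ _ => by simp) le_rfl ht
    simp only [U0, V0, P0, Q0, Pi.neg_apply] at i1 i2
    rw [hE]; linarith
  have hPm : ∀ {s t}, 0 ≤ s → s ≤ t → P s ≤ P t := fun hs hst =>
    mono dP (fun x hx => by have := hU1 x hx; positivity) hs hst
  have hQm : ∀ {s t}, 0 ≤ s → s ≤ t → Q s ≤ Q t := fun hs hst =>
    mono dQ (fun x hx => by have := hV0 x hx; positivity) hs hst
  have hUm : ∀ {s t}, 0 ≤ s → s ≤ t → U s ≤ U t := fun hs hst => mono dU hP0 hs hst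
  have hH : ∀ t, 0 ≤ t → P t ^ 2 ≤ E := by
    intro s hs
    by_contra! hlt
    obtain ⟨d, hd⟩ : ∃ d, d = Real.sqrt (P s ^ 2 - E) := ⟨_, rfl⟩
    have hdpos : 0 < d := by rw [hd]; exact Real.sqrt_pos.2 (by linarith)
    have hd2 : d ^ 2 = P s ^ 2 - E := by rw [hd, Real.sq_sqrt (by linarith)]
    have key : ∀ t, s ≤ t → d ≤ V t * U t ^ 2 := by
      intro t hst
      have ht := hs.trans hst
      have e1 := hen t ht
      have e2 : P s ^ 2 ≤ P t ^ 2 := by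
        have := hP0 s hs
        have := hPm hs hst
        gcongr
      have hu := hU1 t ht
      have hv := hV0 t ht
      have : d ≤ U t * V t := by
        refine abs_le_of_sq_le_sq' (a := d) (b := U t * V t) ?_ (by positivity) |>.2
        nlinarith [sq_nonneg (Q t)]
      nlinarith [mul_nonneg hv (by linarith : 0 ≤ U t)]
    have ht : s ≤ s + (-Q s + 1) / d := by
      have := hQ0 s hs
      have : 0 ≤ (-Q s + 1) / d := by apply div_nonneg <;> linarith
      linarith
    have := le_of_hasDerivAt_le (f := fun x => d * x) (f' := fun _ => d) (g := fun x => Q x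
      - Q s + d * s) (g' := fun x => V x * U x ^ 2) ht
      (fun x _ => by simpa using (hasDerivAt_id x).const_mul d)
      (fun x hx => ((dQ x (hs.trans hx.1)).sub_const _).add_const _)
      (fun x hx => key x hx.1) (by linarith)
    have e3 : d * (s + (-Q s + 1) / d) = d * s + (-Q s + 1) := by field_simp
    rw [e3] at this
    linarith [hQ0 _ (hs.trans ht)]
  have hUVQ : ∀ t, 0 ≤ t → U t * V t ≤ -Q t := by
    intro t ht
    refine abs_le_of_sq_le_sq' (b := -Q t) ?_ (by linarith [hQ0 t ht]) |>.2
    nlinarith [hen t ht, hH t ht]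
  have hb : 1 ≤ b := by simpa [U0, V0, Q0] using hUVQ 0 le_rfl
  obtain ⟨e, he, hepos⟩ : ∃ e, e ^ 2 = E ∧ 0 < e :=
    ⟨Real.sqrt E, Real.sq_sqrt (by nlinarith), Real.sqrt_pos.2 (by nlinarith)⟩
  have he1 : 1 ≤ e := by nlinarith
  have hbe : b ≤ e := by nlinarith
  have hPe : ∀ t, 0 ≤ t → P t ≤ e := fun t ht =>
    abs_le_of_sq_le_sq' (by rw [he]; exact hH t ht) hepos.le |>.2
  have hPQ : ∀ t, 0 ≤ t → e + Q t ≤ P t := by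
    intro t ht
    have := hP0 t ht
    have := hQ0 t ht
    by_contra! hlt
    have h1 : P t ^ 2 < (e + Q t) ^ 2 := by gcongr
    nlinarith [hen t ht, sq_nonneg (U t * V t)]
  have hUl : ∀ t, 0 ≤ t → e * t ≤ U t := by
    intro t ht
    have := le_of_hasDerivAt_le (f := fun x => e * x + V x) (g := U)
      (f' := fun x => e + Q x) (g' := P) ht
      (fun x hx => (by simpa using ((hasDerivAt_id x).const_mul e).add (dV x hx.1) :
        HasDerivAt ((fun y => e * y) + V) _ x))
      (fun x hx => dU x hx.1) (fun x hx => hPQ x hx.1) (by simp [U0, V0])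
    linarith [hV0 t ht]
  have hUu : ∀ t, 0 ≤ t → U t ≤ e * t + 1 := fun t ht =>
    le_of_hasDerivAt_le (f := U) (g := fun x => e * x + 1) (f' := P) (g' := fun _ => e) ht
      (fun x hx => dU x hx.1)
      (fun x _ => by simpa using ((hasDerivAt_id x).const_mul e).add_const 1)
      (fun x hx => hPe x hx.1) (by simp [U0])
  have hW : ∀ t, 0 ≤ t → e ≤ V t ^ 2 / 2 + P t := by
    intro s hs
    by_contra! hlt
    obtain ⟨d, hd⟩ : ∃ d, d = e - (V s ^ 2 / 2 + P s) := ⟨_, rfl⟩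
    have hdp : 0 < d := by linarith
    have key : ∀ t, s ≤ t → d ≤ -Q t := by
      intro t hst
      have := le_of_hasDerivAt_le (f := fun x => V x ^ 2 / 2 + P x) (g := fun _ => e - d)
        (f' := fun x => V x * (Q x + U x * V x)) (g' := fun _ => 0) hst
        (fun x hx => by
          have h0 := hs.trans hx.1
          refine ((((dV x h0).pow 2).div_const 2).add (dP x h0)).congr_deriv ?_
          simp; ring) (fun x _ => hasDerivAt_const x _) (fun x hx => by
          have h0 := hs.trans hx.1
          exact mul_nonpos_of_nonneg_of_nonpos (hV0 x h0) (by linarith [hUVQ x h0]))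
        (by linarith)
      linarith [hPQ t (hs.trans hst), sq_nonneg (V t)]
    have ht : s ≤ s + 2 / d := by
      have : 0 ≤ 2 / d := by positivity
      linarith
    have := le_of_hasDerivAt_le (f := fun x => d * x) (f' := fun _ => d)
      (g := fun x => - V x + V s + d * s) (g' := fun x => -Q x) ht
      (fun x _ => by simpa using (hasDerivAt_id x).const_mul d)
      (fun x hx => ((dV x (hs.trans hx.1)).neg.add_const _).add_const _)
      (fun x hx => key x hx.1) (by linarith)
    have e3 : d * (s + 2 / d) = d * s + 2 := by field_simp
    simp only [e3] at this
    linarith [hV0 _ (hs.trans ht), hV1 s hs]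
  have hQle : ∀ t, 0 ≤ t → -Q t ≤ (1 + e) * V t * U t := by
    intro t ht
    have h1 := hU1 t ht
    have h2 := hV0 t ht
    refine abs_le_of_sq_le_sq' (b := (1 + e) * V t * U t) ?_ (by positivity) |>.2
    have h3 : E - P t ^ 2 ≤ e * V t ^ 2 := by
      have h4 := hW t ht
      have h5 := hPe t ht
      have h6 := hP0 t ht
      nlinarith [mul_nonneg (by linarith : 0 ≤ e - P t) (by linarith : 0 ≤ e + P t),
        mul_le_mul_of_nonneg_right (by linarith : e - P t ≤ V t ^ 2 / 2)
          (by linarith : 0 ≤ e + P t), mul_nonneg (sq_nonneg (V t)) (by linarith : 0 ≤ e - P t)]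
    have h4 : V t ^ 2 ≤ V t ^ 2 * U t ^ 2 :=
      le_mul_of_one_le_right (sq_nonneg _) (one_le_pow₀ h1)
    have h5 : 0 ≤ V t ^ 2 * U t ^ 2 := by positivity
    nlinarith [hen t ht, mul_le_mul_of_nonneg_left h4 hepos.le, mul_nonneg hepos.le h5,
      mul_nonneg (sq_nonneg e) h5]
  have hVexp : ∀ t, 0 ≤ t → V t ≤ Real.exp (-t) := by
    intro t ht
    have := le_of_hasDerivAt_le (f := fun x => V x * Real.exp x) (g := fun _ => 1)
      (f' := fun x => Q x * Real.exp x + V x * Real.exp x) (g' := fun _ => 0) ht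
      (fun x hx => (dV x hx.1).mul (Real.hasDerivAt_exp x)) (fun x _ => hasDerivAt_const x _)
      (fun x hx => by
        have := hUVQ x hx.1
        have h1 := hU1 x hx.1
        have h2 := hV0 x hx.1
        have h3 := Real.exp_pos x
        have : Q x + V x ≤ 0 := by nlinarith
        nlinarith) (by simp [V0])
    rw [Real.exp_neg, ← one_div, le_div_iff₀ (Real.exp_pos t)]
    exact this
  -- glue and normalise
  obtain ⟨l, hl, hlpos⟩ : ∃ l, l ^ 2 * e = 1 ∧ 0 < l := by
    refine ⟨Real.sqrt (1 / e), ?_, Real.sqrt_pos.2 (by positivity)⟩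
    rw [Real.sq_sqrt (by positivity)]; field_simp
  have hl1 : l ≤ 1 := by nlinarith
  set W : ℝ → ℝ := fun s => if 0 ≤ s then U s else V (-s) with hWd
  set W' : ℝ → ℝ := fun s => if 0 ≤ s then P s else - Q (-s) with hWd'
  have dW : ∀ s, HasDerivAt W (W' s) s :=
    hasDerivAt_glue dU dV (by rw [U0, V0]) (by rw [P0, Q0]; ring)
  have dW' : ∀ s, HasDerivAt W' (W s * W (-s) ^ 2) s := by
    intro s
    have := hasDerivAt_glue (F := P) (G := fun t => - Q t) dP (fun t ht => (dQ t ht).neg)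
      (by simp [P0, Q0]) (by simp [U0, V0]) s
    refine this.congr_deriv ?_
    simp only [hWd]
    rcases lt_trichotomy s 0 with hs | rfl | hs
    · rw [if_neg (not_le.2 hs), if_neg (not_le.2 hs), if_pos (by linarith)]; ring
    · simp [U0, V0]
    · rw [if_pos hs.le, if_pos hs.le, if_neg (by linarith), neg_neg]
  have Wp : ∀ s, 0 ≤ s → W s = U s := fun s hs => if_pos hs
  have Wn : ∀ s, s ≤ 0 → W s = V (-s) := fun s hs => by
    rcases hs.eq_or_lt with rfl | hs
    · simp [hWd, U0, V0]
    · exact if_neg (not_le.2 hs)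
  have Wp' : ∀ s, 0 ≤ s → W' s = P s := fun s hs => if_pos hs
  have Wn' : ∀ s, s ≤ 0 → W' s = -Q (-s) := fun s hs => by
    rcases hs.eq_or_lt with rfl | hs
    · simp [hWd', P0, Q0]
    · exact if_neg (not_le.2 hs)
  have Wpos : ∀ s, 0 < W s := fun s => by
    rcases le_total 0 s with hs | hs
    · rw [Wp s hs]; linarith [hU1 s hs]
    · rw [Wn s hs]; exact hVpos _ (by linarith)
  have hQb : ∀ t, 0 ≤ t → -Q t ≤ b := fun t ht => by have := hQm le_rfl ht; linarith
  have hPb : ∀ t, 0 ≤ t → b ≤ P t := fun t ht => by have := hPm le_rfl ht; linarith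
  have Wmul : ∀ s, W s * W (-s) ≤ W' s := fun s => by
    rcases le_total 0 s with hs | hs
    · rw [Wp s hs, Wn (-s) (by linarith), Wp' s hs, neg_neg]
      linarith [hUVQ s hs, hQb s hs, hPb s hs]
    · rw [Wn s hs, Wp (-s) (by linarith), Wn' s hs, mul_comm]
      exact hUVQ _ (by linarith)
  have We : ∀ s, W' s ≤ e := fun s => by
    rcases le_total 0 s with hs | hs
    · rw [Wp' s hs]; exact hPe s hs
    · rw [Wn' s hs]; exact (hQb _ (by linarith)).trans hbe
  have Wle : ∀ s, W' s ≤ (1 + e) * W s * (W (-s) + 1) := fun s => by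
    rcases le_total 0 s with hs | hs
    · have h1 := Wpos (-s)
      rw [Wp' s hs, Wp s hs]
      have := hU1 s hs
      have := hPe s hs
      nlinarith [mul_nonneg (mul_nonneg (by linarith : 0 ≤ 1 + e) (by linarith : 0 ≤ U s)) h1.le]
    · rw [Wn' s hs, Wn s hs, Wp (-s) (by linarith)]
      have := hQle (-s) (by linarith)
      have := hVpos (-s) (by linarith)
      nlinarith [mul_pos (by linarith : 0 < 1 + e) this]
  have hlin : ∀ s, HasDerivAt (fun s => l * s) l s := fun s => by
    simpa using (hasDerivAt_id s).const_mul l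
  refine ⟨fun s => l * W (l * s), fun s => l ^ 2 * W' (l * s), l, 1 + e, hlpos, hl1, by linarith,
    fun s => ?_, fun s => ?_, fun s => mul_pos hlpos (Wpos _), fun s => ?_, ?_, fun s => ?_,
    fun s => ?_, fun s => ?_, fun s => ?_, fun s => ?_, fun s hs => ?_⟩
  · exact (((dW (l * s)).comp s (hlin s)).const_mul l).congr_deriv (by ring)
  · refine (((dW' (l * s)).comp s (hlin s)).const_mul (l ^ 2)).congr_deriv ?_
    rw [mul_neg]; ring
  · exact mul_pos (by positivity) ((mul_pos (Wpos _) (Wpos _)).trans_le (Wmul _))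
  · simp [Wp 0 le_rfl, U0]
  · have := Wmul (l * s)
    rw [mul_neg]
    nlinarith [sq_nonneg l]
  · nlinarith [We (l * s), sq_nonneg l]
  · have h1 := Wle (l * s)
    rw [mul_neg]
    have h2 := Wpos (l * s)
    have h3 := Wpos (-(l * s))
    calc l ^ 2 * W' (l * s) ≤ l ^ 2 * ((1 + e) * W (l * s) * (W (-(l * s)) + 1)) := by gcongr
      _ = (1 + e) * (l * W (l * s)) * (l * W (-(l * s)) + l) := by ring
      _ ≤ _ := by gcongr
  · rcases le_total 0 s with hs | hs
    · rw [Wp _ (by positivity)]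
      have := hUl (l * s) (by positivity)
      calc s = l * (e * (l * s)) := by linear_combination (-s) * hl
        _ ≤ _ := by gcongr
    · exact hs.trans (mul_pos hlpos (Wpos _)).le
  · rcases le_total 0 s with hs | hs
    · rw [Wp _ (by positivity), max_eq_left hs]
      have := hUu (l * s) (by positivity)
      calc l * U (l * s) ≤ l * (e * (l * s) + 1) := by gcongr
        _ = _ := by linear_combination s * hl
    · have hs' : l * s ≤ 0 := mul_nonpos_of_nonneg_of_nonpos hlpos.le hs
      rw [Wn _ hs', max_eq_right hs]
      nlinarith [hV1 (-(l * s)) (by linarith)]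
  · have hs' : l * s ≤ 0 := mul_nonpos_of_nonneg_of_nonpos hlpos.le hs
    rw [Wn _ hs']
    have := hVexp (-(l * s)) (by linarith)
    rw [neg_neg] at this
    gcongr

/-! ### Barrier pairs -/

/-- A smooth perturbation of the identity with slope going from `1 - η` to `1 + η` at scale `A`. -/
def bend (η A h : ℝ) : ℝ := h + η * (Real.sqrt (A ^ 2 + h ^ 2) - A)

/-- The derivative of `bend`. -/
def bend' (η A h : ℝ) : ℝ := 1 + η * (h / Real.sqrt (A ^ 2 + h ^ 2))

/-- The second derivative of `bend`. -/
def bend'' (η A h : ℝ) : ℝ := η * (A ^ 2 / Real.sqrt (A ^ 2 + h ^ 2) ^ 3)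

section bend

variable {η A : ℝ}

theorem root_facts (hA : 0 < A) (h : ℝ) : A ≤ √(A ^ 2 + h ^ 2) ∧ h ≤ √(A ^ 2 + h ^ 2) ∧
    -h ≤ √(A ^ 2 + h ^ 2) ∧ √(A ^ 2 + h ^ 2) ^ 2 = A ^ 2 + h ^ 2 :=
  ⟨Real.le_sqrt_of_sq_le (by nlinarith), Real.le_sqrt_of_sq_le (by nlinarith),
    Real.le_sqrt_of_sq_le (by nlinarith), Real.sq_sqrt (by positivity)⟩

theorem hasDerivAt_root (hA : 0 < A) (h : ℝ) :
    HasDerivAt (fun h => √(A ^ 2 + h ^ 2)) (h / √(A ^ 2 + h ^ 2)) h := by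
  have h1 : HasDerivAt (fun h : ℝ => A ^ 2 + h ^ 2) (2 * h) h := by
    simpa using (hasDerivAt_pow 2 h).const_add (A ^ 2)
  refine (h1.sqrt (by positivity)).congr_deriv ?_
  field_simp

theorem hasDerivAt_bend (hA : 0 < A) (h : ℝ) : HasDerivAt (bend η A) (bend' η A h) h :=
  (hasDerivAt_id h).add (((hasDerivAt_root hA h).sub_const A).const_mul η)

theorem hasDerivAt_bend' (hA : 0 < A) (h : ℝ) : HasDerivAt (bend' η A) (bend'' η A h) h := by
  obtain ⟨h1, -, -, h2⟩ := root_facts hA h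
  have h0 : 0 < √(A ^ 2 + h ^ 2) := hA.trans_le h1
  refine ((((hasDerivAt_id h).div (hasDerivAt_root hA h) h0.ne').const_mul η).const_add
    1).congr_deriv ?_
  rw [bend'']
  generalize √(A ^ 2 + h ^ 2) = w at *
  simp only [id]
  field_simp
  linear_combination η * h2

theorem bend''_bounds (hη : 0 < η) (hA : 0 < A) (h : ℝ) :
    0 ≤ bend'' η A h ∧ bend'' η A h ≤ η / A := by
  obtain ⟨h1, -, -, -⟩ := root_facts hA h
  rw [bend'']
  generalize √(A ^ 2 + h ^ 2) = w at *
  have h0 : 0 < w := hA.trans_le h1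
  refine ⟨by positivity, ?_⟩
  rw [div_eq_mul_one_div η A]
  refine mul_le_mul_of_nonneg_left ?_ hη.le
  rw [div_le_div_iff₀ (by positivity) hA, one_mul]
  calc A ^ 2 * A = A ^ 3 := by ring
    _ ≤ w ^ 3 := by gcongr

theorem bend'_bounds (hη : 0 < η) (hA : 0 < A) (h : ℝ) :
    1 - η ≤ bend' η A h ∧ bend' η A h ≤ 1 + η ∧
    (h ≤ A / 4 → bend' η A h ≤ 1 + η / 4) ∧ (-(A / 4) ≤ h → 1 - η / 4 ≤ bend' η A h) := by
  obtain ⟨h1, h2, h3, -⟩ := root_facts hA h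
  rw [bend']
  generalize √(A ^ 2 + h ^ 2) = w at *
  have h0 : 0 < w := hA.trans_le h1
  have e1 : h / w ≤ 1 := (div_le_one h0).2 h2
  have e2 : -1 ≤ h / w := by rw [le_div_iff₀ h0]; linarith
  refine ⟨by nlinarith, by nlinarith, fun h4 => ?_, fun h4 => ?_⟩
  · have : h / w ≤ 1 / 4 := by rw [div_le_iff₀ h0]; linarith
    nlinarith
  · have : -(1 / 4) ≤ h / w := by rw [le_div_iff₀ h0]; linarith
    nlinarith

theorem bend_bounds (hη : 0 < η) (hA : 0 < A) (h : ℝ) :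
    h ≤ bend η A h ∧ (0 ≤ h → (1 + η) * h - η * A ≤ bend η A h) ∧
    (0 ≤ h → bend η A h ≤ (1 + η) * h) ∧ (h ≤ 0 → bend η A h ≤ (1 - η) * h) ∧
    (h ≤ 0 → - bend η A h ≤ (1 - η) * (-h) + η * A) := by
  obtain ⟨h1, h2, h3, h4⟩ := root_facts hA h
  rw [bend]
  generalize √(A ^ 2 + h ^ 2) = w at *
  refine ⟨by nlinarith, fun _ => by nlinarith, fun _ => ?_, fun _ => ?_, fun _ => by nlinarith⟩
  · have : w ≤ A + h := by nlinarith
    nlinarith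
  · have : w ≤ A - h := by nlinarith
    nlinarith

end bend

/-- Derivatives of a scaled sigmoid. -/
theorem hasDerivAt_sigmoid_mul (b h : ℝ) : HasDerivAt (fun h => Real.sigmoid (b * h))
    (b * (Real.sigmoid (b * h) * (1 - Real.sigmoid (b * h)))) h := by
  have h1 : HasDerivAt (fun h : ℝ => b * h) b h := by simpa using (hasDerivAt_id h).const_mul b
  exact ((Real.hasDerivAt_sigmoid (b * h)).comp h h1).congr_deriv (by ring)

theorem hasDerivAt_sigmoid_mul' (b h : ℝ) :
    HasDerivAt (fun h => b * (Real.sigmoid (b * h) * (1 - Real.sigmoid (b * h))))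
      (b ^ 2 * (Real.sigmoid (b * h) * (1 - Real.sigmoid (b * h)) *
        (1 - 2 * Real.sigmoid (b * h)))) h := by
  have h1 := hasDerivAt_sigmoid_mul b h
  exact ((h1.mul (h1.const_sub 1)).const_mul b).congr_deriv (by ring)

theorem sigmoid_le_exp (x : ℝ) : Real.sigmoid x ≤ Real.exp x := by
  rw [Real.sigmoid_def, ← neg_neg x, Real.exp_neg (-x), neg_neg]
  have := Real.exp_pos (-x)
  gcongr
  linarith

theorem le_sigmoid (x : ℝ) : 1 / 2 * min 1 (Real.exp x) ≤ Real.sigmoid x := by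
  rcases le_total 0 x with hx | hx
  · have := Real.sigmoid_le hx
    rw [Real.sigmoid_zero] at this
    refine le_trans ?_ this
    have := min_le_left 1 (Real.exp x)
    linarith
  · have h1 : Real.exp x = Real.sigmoid x * (1 + Real.exp x) := by
      have := Real.exp_pos x
      rw [Real.sigmoid_def, Real.exp_neg]
      field_simp
      ring
    have h2 : Real.exp x ≤ 1 := Real.exp_le_one_iff.2 hx
    rw [min_eq_right h2]
    have := Real.sigmoid_pos x
    nlinarith

/-- A pair of barrier functions: `F` increasing, `G` decreasing, with the differential inequalities
used in the two-point maximum principle. -/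
structure Barrier (a C b c η A ε : ℝ) (F F1 F2 G G1 G2 : ℝ → ℝ) : Prop where
  dF : ∀ h, HasDerivAt F (F1 h) h
  dF1 : ∀ h, HasDerivAt F1 (F2 h) h
  dG : ∀ h, HasDerivAt G (G1 h) h
  dG1 : ∀ h, HasDerivAt G1 (G2 h) h
  F_pos : ∀ h, 0 < F h
  F1_pos : ∀ h, 0 < F1 h
  G1_neg : ∀ h, G1 h < 0
  ineqF : ∀ h q, 0 ≤ q → q ≤ 1 + η / 4 → F2 h * q ^ 2 ≤ F h * max (G h) 0 ^ 2 + ε * F1 h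
  ineqG : ∀ h q, 0 < G h → 1 - η / 4 ≤ q → q ≤ 1 + η / 4 →
    G h * F h ^ 2 ≤ G2 h * q ^ 2 + ε * (-G1 h)
  le_F : ∀ h, h - η * A ≤ F h
  G_exp : ∀ h, 0 < G h → c < a * Real.exp (-(a * h))
  G_le : ∀ h, G h ≤ max (-h) 0 + 2 * (η * A) + 2 * a
  F_le : ∀ h, 0 ≤ h → F h ≤ h + a + 1
  F_le_exp : ∀ h, h ≤ 0 → F h ≤ (a + 1) * Real.exp (b * h)
  exp_le_F : ∀ h, c / 2 * min 1 (Real.exp (b * h)) ≤ F h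
  le_G : ∀ h, h ≤ 0 → -h - 2 * c ≤ G h
  F1_le : ∀ h, F1 h ≤ (2 * C + 1) * F h * (max (-h) 0 + a + 1)

section construction

variable {U U' : ℝ → ℝ} {a C : ℝ}

theorem Profile.mono (hp : Profile U U' a C) : Monotone U :=
  monotone_of_hasDerivAt_nonneg hp.dU fun s => (hp.pos' s).le

theorem Profile.mono' (hp : Profile U U' a C) : Monotone U' :=
  monotone_of_hasDerivAt_nonneg hp.dU' fun s => by have := hp.pos s; positivity

set_option maxHeartbeats 1000000 in
/-- The algebraic core of the inequality for `F`. -/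
theorem barrier_ineqF {u v u1 p p2 k k1 k2 q η A c a m E : ℝ} (hη : 0 < η) (hη' : η ≤ 1 / 10)
    (hA : 0 < A) (hc : 0 < c) (hu : 0 < u) (hv : 0 < v) (huv : u * v ≤ u1) (hk1 : 0 ≤ k1)
    (hp : 1 - η ≤ p) (hp' : p ≤ 1 + η) (hp2 : p2 ≤ η / A) (hq : 0 ≤ q) (hq' : q ≤ 1 + η / 4)
    (hm : m = max ((v - c) / (1 - η)) 0) (hE : 0 ≤ E) (ha : 0 < a)
    (hcase : p ≤ 1 + η / 4 ∨ v ≤ a * E)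
    (hk : k2 * q ^ 2 ≤ k * m ^ 2) :
    ((u * v ^ 2 * p * p + u1 * p2) / (1 + η) + c * k2) * q ^ 2 ≤
      (u / (1 + η) + c * k) * m ^ 2 +
        (2 * (η / A) + 3 * c + 2 * a * E) * (u1 * p / (1 + η) + c * k1) := by
  have hu1 : 0 < u1 := (mul_pos hu hv).trans_le huv
  obtain ⟨X, hX⟩ : ∃ X, X = u1 / (1 + η) := ⟨_, rfl⟩
  obtain ⟨Y, hY⟩ : ∃ Y, Y = u / (1 + η) := ⟨_, rfl⟩
  have hX0 : 0 < X := by rw [hX]; positivity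
  have hY0 : 0 < Y := by rw [hY]; positivity
  have hYX : Y * v ≤ X := by
    rw [hX, hY, div_mul_eq_mul_div]; gcongr
  have hq2 : q ^ 2 ≤ (1 + η / 4) ^ 2 := by gcongr
  have hq2' : q ^ 2 ≤ 1.06 := by nlinarith
  have hp0 : 0.9 ≤ p := by linarith
  have hXF : 0.9 * X ≤ u1 * p / (1 + η) + c * k1 := by
    have : u1 * p / (1 + η) = X * p := by rw [hX]; ring
    rw [this]; nlinarith [mul_nonneg hc.le hk1]
  obtain ⟨F1, hF1⟩ : ∃ F1, F1 = u1 * p / (1 + η) + c * k1 := ⟨_, rfl⟩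
  rw [← hF1] at hXF ⊢
  have hF10 : 0 < F1 := by linarith
  have hηA : 0 < η / A := by positivity
  have t1 : X * p2 * q ^ 2 ≤ 2 * (η / A) * F1 := by
    calc X * p2 * q ^ 2 ≤ X * (η / A) * 1.06 := by gcongr
      _ ≤ 2 * (η / A) * F1 := by nlinarith
  have t2 := mul_le_mul_of_nonneg_left hk hc.le
  have t3 : Y * v ^ 2 * p * p * q ^ 2 ≤ Y * m ^ 2 + (3 * c + 2 * a * E) * F1 := by
    rcases hcase with h | h
    · have hpq : (1 - η) ^ 2 * (p * p * q ^ 2) ≤ 1 := by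
        have h1 : p * p * q ^ 2 ≤ ((1 + η / 4) ^ 2) ^ 2 := by
          calc p * p * q ^ 2 ≤ (1 + η / 4) * (1 + η / 4) * (1 + η / 4) ^ 2 := by gcongr
            _ = _ := by ring
        have h2 : (1 - η) * (1 + η / 4) ^ 2 ≤ 1 := by nlinarith [mul_pos hη hη]
        have h3 : 0 ≤ (1 - η) * (1 + η / 4) ^ 2 := by
          have : 0 ≤ 1 - η := by linarith
          positivity
        calc (1 - η) ^ 2 * (p * p * q ^ 2) ≤ (1 - η) ^ 2 * ((1 + η / 4) ^ 2) ^ 2 := by gcongr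
          _ = ((1 - η) * (1 + η / 4) ^ 2) ^ 2 := by ring
          _ ≤ 1 ^ 2 := by gcongr
          _ = 1 := one_pow 2
      have hm2 : v ^ 2 - 2 * c * v ≤ (1 - η) ^ 2 * m ^ 2 := by
        have h1 : v - c ≤ (1 - η) * m := by
          have := le_max_left ((v - c) / (1 - η)) 0
          rw [← hm, div_le_iff₀ (by linarith)] at this
          linarith
        have h0 : 0 ≤ (1 - η) * m := by
          rw [hm]; exact mul_nonneg (by linarith) (le_max_right _ _)
        rw [← mul_pow]
        rcases le_total c v with hcv | hcv
        · have : (v - c) ^ 2 ≤ ((1 - η) * m) ^ 2 := by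
            have : 0 ≤ v - c := by linarith
            gcongr
          linarith [sq_nonneg c, sub_sq v c]
        · have h2 := mul_le_mul_of_nonneg_left hcv hv.le
          have h3 : 0 ≤ v * c := by positivity
          linarith [sq_nonneg ((1 - η) * m)]
      have h5 : 0 ≤ p * p * q ^ 2 := by positivity
      have h60 : (0.81 : ℝ) ≤ (1 - η) ^ 2 := by nlinarith
      have e5 : Y * v ^ 2 * p * p * q ^ 2 = Y * (v ^ 2 * (p * p * q ^ 2)) := by ring
      rw [e5]
      generalize p * p * q ^ 2 = T at *
      generalize (1 - η) ^ 2 = S at *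
      have h4 : v ^ 2 * T ≤ m ^ 2 + 2 * c * v * T := by
        have i1 := mul_le_mul_of_nonneg_right hm2 h5
        have i2 := mul_le_mul_of_nonneg_left hpq (sq_nonneg m)
        linarith
      have h6 : T ≤ 1.25 := by nlinarith
      have h7 : Y * v * T ≤ X * 1.25 := by gcongr
      have h8 := mul_le_mul_of_nonneg_left h4 hY0.le
      have h9 : 0 ≤ 2 * a * E * F1 := by positivity
      have h10 := mul_le_mul_of_nonneg_left h7 hc.le
      have h11 := mul_le_mul_of_nonneg_left hXF hc.le
      have h12 : 0 ≤ c * F1 := by positivity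
      linarith
    · have h1 : p * p * q ^ 2 ≤ 1.21 * 1.06 := by
        calc p * p * q ^ 2 ≤ 1.1 * 1.1 * 1.06 := by gcongr <;> linarith
          _ = _ := by norm_num
      have h2 : Y * v ^ 2 * p * p * q ^ 2 ≤ X * (a * E) * (1.21 * 1.06) := by
        calc Y * v ^ 2 * p * p * q ^ 2 = (Y * v) * v * (p * p * q ^ 2) := by ring
          _ ≤ _ := by gcongr
      have h3 : 0 ≤ a * E := by positivity
      have h4 : 0 ≤ Y * m ^ 2 := by positivity
      have h5 : 0 ≤ 3 * c * F1 := by positivity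
      have h6 := mul_le_mul_of_nonneg_left hXF h3
      have h7 : 0 ≤ a * E * F1 := by positivity
      linarith
  have e1 : ((u * v ^ 2 * p * p + u1 * p2) / (1 + η) + c * k2) * q ^ 2 =
      Y * v ^ 2 * p * p * q ^ 2 + X * p2 * q ^ 2 + c * k2 * q ^ 2 := by
    rw [hX, hY]; field_simp
  rw [e1, ← hY]
  linarith

/-- The algebraic core of the inequality for `G`. -/
theorem barrier_ineqG {u v v1 p p2 k q η A c a E : ℝ} (hη : 0 < η) (hη' : η ≤ 1 / 10)
    (hA : 0 < A) (hc : 0 < c) (hu : 0 < u) (hv : 0 < v) (huv : u * v ≤ v1)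
    (hp : 1 - η ≤ p) (hp2 : p2 ≤ η / A) (hq : 1 - η / 4 ≤ q)
    (hq' : q ≤ 1 + η / 4) (hE : 0 ≤ E) (ha : 0 < a) (hk : 0 ≤ k) (hk' : k ≤ 1)
    (hcase : 1 - η / 4 ≤ p ∨ u ≤ a * E)
    (hkv : c * k ^ 2 * v ≤ 2.5 / a ^ 2 * v1) :
    (v - c) / (1 - η) * (u / (1 + η) + c * k) ^ 2 ≤
      (v * u ^ 2 * p * p - v1 * p2) / (1 - η) * q ^ 2 +
        (2 * (η / A) + (3 + 3 / a ^ 2) * c + 2 * a * E) * (v1 * p / (1 - η)) := by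
  have hv1 : 0 < v1 := (mul_pos hu hv).trans_le huv
  have hη1 : 0 < 1 - η := by linarith
  have hp0 : 0.9 ≤ p := by linarith
  have hq2' : q ^ 2 ≤ 1.06 := by nlinarith
  have hηA : 0 < η / A := by positivity
  obtain ⟨Y, hY⟩ : ∃ Y, Y = u / (1 + η) := ⟨_, rfl⟩
  have hY0 : 0 < Y := by rw [hY]; positivity
  have hYu : Y * (1 + η) = u := by rw [hY]; field_simp
  have hYu' : Y ≤ u := by nlinarith
  rw [← hY]
  have goal' : (v - c) * (Y + c * k) ^ 2 ≤ (v * u ^ 2 * p * p - v1 * p2) * q ^ 2 +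
        (2 * (η / A) + (3 + 3 / a ^ 2) * c + 2 * a * E) * (v1 * p) := by
    have t1 : v1 * p2 * q ^ 2 ≤ 2 * (η / A) * (v1 * p) := by
      calc v1 * p2 * q ^ 2 ≤ v1 * (η / A) * 1.06 := by gcongr
        _ ≤ 2 * (η / A) * (v1 * p) := by nlinarith [mul_pos hv1 hηA]
    have t2 : v * Y ^ 2 ≤ v * u ^ 2 * p * p * q ^ 2 + 2 * a * E * (v1 * p) := by
      rcases hcase with h | h
      · have h1 : 1 ≤ (1 + η) ^ 2 * (p * p * q ^ 2) := by
          have h2 : 1 ≤ (1 + η) * (1 - η / 4) ^ 2 := by nlinarith [mul_pos hη hη]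
          have h3 : 0 ≤ 1 - η / 4 := by linarith
          calc (1 : ℝ) = 1 ^ 2 := (one_pow 2).symm
            _ ≤ ((1 + η) * (1 - η / 4) ^ 2) ^ 2 := by gcongr
            _ = (1 + η) ^ 2 * ((1 - η / 4) * (1 - η / 4) * (1 - η / 4) ^ 2) := by ring
            _ ≤ _ := by gcongr
        have h4 : 0 ≤ 2 * a * E * (v1 * p) := by positivity
        have h5 : v * u ^ 2 * p * p * q ^ 2 = v * Y ^ 2 * ((1 + η) ^ 2 * (p * p * q ^ 2)) := by
          rw [← hYu]; ring
        rw [h5]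
        have : 0 ≤ v * Y ^ 2 := by positivity
        have := mul_le_mul_of_nonneg_left h1 this
        linarith
      · have h1 : v * Y ^ 2 ≤ v1 * (a * E) := by
          calc v * Y ^ 2 ≤ v * u ^ 2 := by gcongr
            _ = (u * v) * u := by ring
            _ ≤ _ := by gcongr
        have h2 : 0 ≤ v * u ^ 2 * p * p * q ^ 2 := by positivity
        have h3 : 0 ≤ v1 * (a * E) := by positivity
        have h4 := mul_le_mul_of_nonneg_left hp0 h3
        linarith
    have t3 : 2 * c * k * (v * Y) ≤ 3 * c * (v1 * p) := by
      have h1 : v * Y ≤ v1 := by nlinarith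
      have h2 : 0 ≤ v * Y := by positivity
      have h3 : k * (v * Y) ≤ v1 := by nlinarith
      have h4 := mul_le_mul_of_nonneg_left h3 hc.le
      have h5 := mul_le_mul_of_nonneg_left hp0 (mul_pos hc hv1).le
      have h6 := mul_pos hc hv1
      linarith
    have t4 : c ^ 2 * k ^ 2 * v ≤ 3 / a ^ 2 * c * (v1 * p) := by
      have h1 := mul_le_mul_of_nonneg_left hkv hc.le
      have h2 : 3 / a ^ 2 = 3 * (1 / a ^ 2) := by ring
      have h3 : 2.5 / a ^ 2 = 2.5 * (1 / a ^ 2) := by ring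
      have h4 : 0 < 1 / a ^ 2 := by positivity
      rw [h3] at h1
      rw [h2]
      generalize 1 / a ^ 2 = z at *
      have h5 := mul_le_mul_of_nonneg_left hp0 (mul_pos (mul_pos hc h4) hv1).le
      have h6 := mul_pos (mul_pos hc h4) hv1
      linarith
    have t5 : 0 ≤ c * (Y + c * k) ^ 2 := by positivity
    generalize 3 / a ^ 2 = z at *
    linarith
  have e2 : (v - c) / (1 - η) * (Y + c * k) ^ 2 = (v - c) * (Y + c * k) ^ 2 / (1 - η) := by ring
  have e3 : (v * u ^ 2 * p * p - v1 * p2) / (1 - η) * q ^ 2 +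
        (2 * (η / A) + (3 + 3 / a ^ 2) * c + 2 * a * E) * (v1 * p / (1 - η)) =
      ((v * u ^ 2 * p * p - v1 * p2) * q ^ 2 +
        (2 * (η / A) + (3 + 3 / a ^ 2) * c + 2 * a * E) * (v1 * p)) / (1 - η) := by ring
  rw [e2, e3]
  gcongr

end construction

set_option maxHeartbeats 1000000 in
theorem exists_barrier {U U' : ℝ → ℝ} {a C η A c : ℝ} (hp : Profile U U' a C) (hη : 0 < η)
    (hη' : η ≤ 1 / 10) (hA : 0 < A) (hc : 0 < c) (hca : c ≤ a / 2) :
    ∃ F F1 F2 G G1 G2, Barrier a C (a / 4) c η A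
      (2 * (η / A) + (3 + 3 / a ^ 2) * c + 2 * a * Real.exp (-(a * (A / 5)))) F F1 F2 G G1 G2 := by
  have ha := hp.a_pos
  have ha1 := hp.a_le
  have hη1 : 0 < 1 - η := by linarith
  have hU0 : ∀ s, 0 ≤ s → a ≤ U s := fun s hs => hp.zero ▸ hp.mono hs
  have hUa : ∀ s, s ≤ 0 → U s ≤ a := fun s hs => hp.zero ▸ hp.mono hs
  have hUsq : ∀ s, U s * U (-s) ≤ U' (-s) := fun s => by
    have := hp.mul_le (-s); rwa [neg_neg, mul_comm] at this
  have hU'0 : ∀ s, 0 ≤ s → a ^ 2 ≤ U' s := fun s hs => by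
    refine le_trans ?_ (hp.mono' hs)
    have := hp.mul_le 0
    rwa [neg_zero, hp.zero, ← sq] at this
  have bβ := bend_bounds hη hA
  have bβ' := bend'_bounds hη hA
  have bβ'' := bend''_bounds hη hA
  set β := bend η A with hβd
  set β' := bend' η A
  set β'' := bend'' η A
  have dβ : ∀ h, HasDerivAt β (β' h) h := hasDerivAt_bend hA
  have dβ' : ∀ h, HasDerivAt β' (β'' h) h := hasDerivAt_bend' hA
  obtain ⟨b, hb⟩ : ∃ b, b = a / 4 := ⟨_, rfl⟩
  have hb0 : 0 < b := by linarith
  rw [← hb]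
  set κ : ℝ → ℝ := fun h => Real.sigmoid (b * h) with hκ
  set κ' : ℝ → ℝ := fun h => b * (κ h * (1 - κ h)) with hκ'
  set κ'' : ℝ → ℝ := fun h => b ^ 2 * (κ h * (1 - κ h) * (1 - 2 * κ h)) with hκ''
  have dκ : ∀ h, HasDerivAt κ (κ' h) h := hasDerivAt_sigmoid_mul b
  have dκ' : ∀ h, HasDerivAt κ' (κ'' h) h := hasDerivAt_sigmoid_mul' b
  have κ0 : ∀ h, 0 < κ h := fun h => Real.sigmoid_pos _
  have κ1 : ∀ h, κ h < 1 := fun h => Real.sigmoid_lt_one _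
  have κ'0 : ∀ h, 0 < κ' h := fun h =>
    mul_pos hb0 (mul_pos (κ0 h) (by linarith [κ1 h]))
  have dUβ : ∀ h, HasDerivAt (fun h => U (β h)) (U' (β h) * β' h) h := fun h =>
    (hp.dU (β h)).comp h (dβ h)
  have dU'β : ∀ h, HasDerivAt (fun h => U' (β h)) (U (β h) * U (-β h) ^ 2 * β' h) h := fun h =>
    (hp.dU' (β h)).comp h (dβ h)
  have dVβ : ∀ h, HasDerivAt (fun h => U (-β h)) (U' (-β h) * (-β' h)) h := fun h =>
    (hp.dU (-β h)).comp h (dβ h).neg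
  have dV'β : ∀ h, HasDerivAt (fun h => U' (-β h)) (U (-β h) * U (β h) ^ 2 * (-β' h)) h := fun h =>
    ((hp.dU' (-β h)).comp h (dβ h).neg).congr_deriv (by rw [neg_neg])
  have hVle : ∀ h, U (-β h) ≤ max (-h) 0 + a := fun h => by
    refine (hp.mono (neg_le_neg (bβ h).1)).trans ?_
    exact hp.le_max _
  have hE : ∀ A' B', 0 ≤ B' → B' ≤ A' → U (-A') ≤ a * Real.exp (-(a * B')) := fun A' B' h0 h => by
    refine (hp.le_exp (-A') (by linarith)).trans ?_
    gcongr
    nlinarith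
  refine ⟨fun h => U (β h) / (1 + η) + c * κ h,
    fun h => U' (β h) * β' h / (1 + η) + c * κ' h,
    fun h => (U (β h) * U (-β h) ^ 2 * β' h * β' h + U' (β h) * β'' h) / (1 + η) + c * κ'' h,
    fun h => (U (-β h) - c) / (1 - η),
    fun h => U' (-β h) * (-β' h) / (1 - η),
    fun h => (U (-β h) * U (β h) ^ 2 * β' h * β' h - U' (-β h) * β'' h) / (1 - η), ?_⟩
  refine ⟨fun h => ?_, fun h => ?_, fun h => ?_, fun h => ?_, fun h => ?_, fun h => ?_,
    fun h => ?_, fun h q hq hq' => ?_, fun h q hG hq hq' => ?_, fun h => ?_, fun h hG => ?_,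
    fun h => ?_, fun h hh => ?_, fun h hh => ?_, fun h => ?_, fun h hh => ?_, fun h => ?_⟩
  · exact ((dUβ h).div_const _).add ((dκ h).const_mul c)
  · exact (((dU'β h).mul (dβ' h)).div_const _).add ((dκ' h).const_mul c)
  · exact ((dVβ h).sub_const c).div_const _
  · refine (((dV'β h).mul (dβ' h).neg).div_const (1 - η)).congr_deriv ?_
    rw [Pi.neg_apply]
    ring
  · have := hp.pos (β h)
    have := κ0 h
    positivity
  · have := hp.pos' (β h)
    have := κ'0 h
    have : 0 < β' h := by linarith [(bβ' h).1]
    positivity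
  · have := hp.pos' (-β h)
    have : 0 < β' h := by linarith [(bβ' h).1]
    rw [mul_neg, neg_div]
    have : 0 < U' (-β h) * β' h / (1 - η) := by positivity
    linarith
  · -- ineqF
    have key := barrier_ineqF (u := U (β h)) (v := U (-β h)) (u1 := U' (β h)) (p := β' h)
      (p2 := β'' h) (k := κ h) (k1 := κ' h) (k2 := κ'' h) (q := q) (A := A) (a := a)
      (E := Real.exp (-(a * (A / 5)))) hη hη' hA hc (hp.pos _) (hp.pos _) (hp.mul_le _)
      (κ'0 h).le (bβ' h).1 (bβ' h).2.1 (bβ'' h).2 hq hq' rfl (Real.exp_pos _).le ha ?_ ?_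
    · refine key.trans ?_
      have h1 : 0 < U' (β h) * β' h / (1 + η) + c * κ' h := by
        have := hp.pos' (β h)
        have := κ'0 h
        have : 0 < β' h := by linarith [(bβ' h).1]
        positivity
      have h2 : (3 : ℝ) ≤ 3 + 3 / a ^ 2 := by
        have : 0 ≤ 3 / a ^ 2 := by positivity
        linarith
      gcongr
    · rcases le_total h (A / 4) with hh | hh
      · exact Or.inl ((bβ' h).2.2.1 hh)
      · exact Or.inr (hE _ _ (by linarith) (by linarith [(bβ h).1]))
    · rcases le_total 0 h with hh | hh
      · have h1 : 1 / 2 ≤ κ h := by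
          have := Real.sigmoid_le (mul_nonneg hb0.le hh)
          rw [Real.sigmoid_zero] at this
          simp only [hκ]; linarith
        have h2 : κ'' h ≤ 0 := by
          have := mul_nonneg (κ0 h).le (by linarith [κ1 h] : 0 ≤ 1 - κ h)
          simp only [hκ'']
          exact mul_nonpos_of_nonneg_of_nonpos (sq_nonneg b)
            (mul_nonpos_of_nonneg_of_nonpos this (by linarith))
        have h3 := κ0 h
        have : κ'' h * q ^ 2 ≤ 0 := mul_nonpos_of_nonpos_of_nonneg h2 (sq_nonneg q)
        have : 0 ≤ κ h * max ((U (-β h) - c) / (1 - η)) 0 ^ 2 := by positivity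
        linarith
      · have hβ0 : β h ≤ 0 := ((bβ h).2.2.2.1 hh).trans (mul_nonpos_of_nonneg_of_nonpos hη1.le hh)
        have hv := hU0 (-β h) (by linarith)
        have h1 : a / 2 ≤ max ((U (-β h) - c) / (1 - η)) 0 := by
          refine le_trans ?_ (le_max_left _ _)
          rw [le_div_iff₀ hη1]
          nlinarith
        have h2 : κ'' h ≤ b ^ 2 * κ h := by
          have := κ0 h
          have := κ1 h
          simp only [hκ'']
          gcongr
          have h3 : κ h * (1 - κ h) ≤ κ h := by nlinarith
          have h4 : 0 ≤ κ h * (1 - κ h) := mul_nonneg (κ0 h).le (by linarith)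
          nlinarith
        have h3 : b * q ≤ a / 2 := by rw [hb]; nlinarith
        calc κ'' h * q ^ 2 ≤ b ^ 2 * κ h * q ^ 2 := by gcongr
          _ = κ h * (b * q) ^ 2 := by ring
          _ ≤ _ := by
            have := κ0 h
            gcongr
            exact h3.trans h1
  · -- ineqG
    have key := barrier_ineqG (u := U (β h)) (v := U (-β h)) (v1 := U' (-β h)) (p := β' h)
      (p2 := β'' h) (k := κ h) (q := q) (A := A) (a := a)
      (E := Real.exp (-(a * (A / 5)))) hη hη' hA hc (hp.pos _) (hp.pos _) (hUsq _)
      (bβ' h).1 (bβ'' h).2 hq hq' (Real.exp_pos _).le ha (κ0 h).le (κ1 h).le ?_ ?_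
    · refine key.trans (le_of_eq ?_)
      ring
    · rcases le_total (-(A / 4)) h with hh | hh
      · exact Or.inl ((bβ' h).2.2.2 hh)
      · right
        have := hE (-β h) (A / 5) (by positivity) (by
          have := (bβ h).2.2.2.1 (by linarith)
          nlinarith)
        rwa [neg_neg] at this
    · have k0 := κ0 h
      have k1 := κ1 h
      have v0 := hp.pos (-β h)
      have v1 := hp.pos' (-β h)
      have hk2 : κ h ^ 2 ≤ κ h := by nlinarith
      rw [div_mul_eq_mul_div, le_div_iff₀ (by positivity)]
      rcases le_total 0 h with hh | hh
      · have h1 := hU0 (β h) (hh.trans (bβ h).1)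
        have h2 := hUsq (β h)
        have h3 : a * U (-β h) ≤ U' (-β h) := by nlinarith
        calc c * κ h ^ 2 * U (-β h) * a ^ 2 ≤ (a / 2) * 1 * U (-β h) * a ^ 2 := by
              gcongr
              linarith
          _ = a ^ 2 / 2 * (a * U (-β h)) := by ring
          _ ≤ 1 * U' (-β h) := by
              gcongr
              nlinarith
          _ ≤ _ := by linarith
      · have hβ0 : β h ≤ 0 := ((bβ h).2.2.2.1 hh).trans (mul_nonpos_of_nonneg_of_nonpos hη1.le hh)
        have h1 := hU'0 (-β h) (by linarith)
        have h2 := hVle h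
        rw [max_eq_left (by linarith)] at h2
        have h3 : κ h * (-h) * b ≤ 1 := by
          have h4 : κ h ≤ Real.exp (b * h) := sigmoid_le_exp _
          have h5 := Real.add_one_le_exp (-(b * h))
          have h6 : Real.exp (b * h) * Real.exp (-(b * h)) = 1 := by
            rw [← Real.exp_add]; simp
          have h7 := Real.exp_pos (b * h)
          have h8 : 0 ≤ -h * b := by nlinarith
          calc κ h * (-h) * b = κ h * (-h * b) := by ring
            _ ≤ Real.exp (b * h) * Real.exp (-(b * h)) := by
              gcongr
              linarith
            _ = 1 := h6
        rw [hb] at h3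
        have h4 : κ h * U (-β h) * a ≤ 5 := by
          have : κ h * U (-β h) ≤ κ h * (-h + a) := by gcongr
          nlinarith
        have h9 : c * (κ h ^ 2 * U (-β h)) ≤ 2.5 := by
          have : κ h ^ 2 * U (-β h) ≤ κ h * U (-β h) := by gcongr
          have h10 : 0 ≤ κ h * U (-β h) := by positivity
          calc c * (κ h ^ 2 * U (-β h)) ≤ a / 2 * (κ h * U (-β h)) := by gcongr
            _ ≤ 2.5 := by linarith
        calc c * κ h ^ 2 * U (-β h) * a ^ 2 = c * (κ h ^ 2 * U (-β h)) * a ^ 2 := by ring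
          _ ≤ 2.5 * U' (-β h) := by gcongr
  · have k0 := κ0 h
    have h0 : 0 < c * κ h := by positivity
    have hη2 : 0 < 1 + η := by linarith
    rcases le_total 0 h with hh | hh
    · have h1 := (bβ h).2.1 hh
      have h2 := hp.self_le (β h)
      have h3 : h - η * A ≤ U (β h) / (1 + η) := by
        rw [le_div_iff₀ hη2]
        nlinarith [mul_pos (mul_pos hη hη) hA]
      linarith
    · have := hp.pos (β h)
      have : 0 < U (β h) / (1 + η) := by positivity
      nlinarith [mul_pos hη hA]
  · have h1 : c < U (-β h) := by
      simp only [div_pos_iff_of_pos_right hη1] at hG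
      linarith
    rcases le_total 0 h with hh | hh
    · exact h1.trans_le (hE _ _ hh (bβ h).1)
    · have := Real.one_le_exp (show 0 ≤ -(a * h) by nlinarith)
      nlinarith
  · rw [div_le_iff₀ hη1]
    rcases le_total 0 h with hh | hh
    · rw [max_eq_right (by linarith)]
      have := hUa (-β h) (by linarith [(bβ h).1])
      nlinarith [mul_pos hη hA, mul_pos (mul_pos hη hη) hA]
    · rw [max_eq_left (by linarith)]
      have h1 := hp.le_max (-β h)
      have h2 := (bβ h).2.2.2.2 hh
      have h3 : max (-β h) 0 ≤ (1 - η) * -h + η * A := by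
        refine max_le h2 ?_
        have : 0 ≤ (1 - η) * -h := mul_nonneg hη1.le (by linarith)
        nlinarith [mul_pos hη hA]
      nlinarith [mul_pos hη hA, mul_pos (mul_pos hη hη) hA]
  · have h1 := (bβ h).2.2.1 hh
    have h2 := hp.le_max (β h)
    rw [max_eq_left (hh.trans (bβ h).1)] at h2
    have h3 : U (β h) / (1 + η) ≤ h + a := by
      rw [div_le_iff₀ (by linarith)]
      nlinarith
    nlinarith [κ0 h, κ1 h]
  · have h1 := (bβ h).2.2.2.1 hh
    have h2 := hp.le_exp (β h) (h1.trans (mul_nonpos_of_nonneg_of_nonpos hη1.le hh))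
    have h3 : Real.exp (a * β h) ≤ Real.exp (b * h) := by
      rw [Real.exp_le_exp, hb]
      have : β h ≤ h / 4 := by nlinarith
      nlinarith
    have h4 : U (β h) / (1 + η) ≤ U (β h) := div_le_self (hp.pos _).le (by linarith)
    have h5 : κ h ≤ Real.exp (b * h) := sigmoid_le_exp _
    have h6 := Real.exp_pos (b * h)
    have h7 := κ0 h
    have h8 : c * κ h ≤ 1 * Real.exp (b * h) := by
      gcongr
      linarith
    nlinarith
  · have h1 := le_sigmoid (b * h)
    have := hp.pos (β h)
    have : 0 < U (β h) / (1 + η) := by positivity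
    simp only [hκ]
    nlinarith
  · rw [le_div_iff₀ hη1]
    have h1 := hp.self_le (-β h)
    have h2 := (bβ h).2.2.2.1 hh
    nlinarith
  · have h1 := hp.deriv_le (β h)
    have h2 := hVle h
    have h3 := (bβ' h).2.1
    have h4 := hp.pos (β h)
    have h5 := κ0 h
    have h6 := κ1 h
    have hC := hp.C_pos
    have h7 : 0 ≤ max (-h) 0 := le_max_right _ _
    obtain ⟨D, hD⟩ : ∃ D, D = max (-h) 0 + a + 1 := ⟨_, rfl⟩
    rw [← hD]
    have hD1 : 1 ≤ D := by linarith
    have h8 : U' (β h) ≤ C * U (β h) * D := h1.trans (by gcongr; linarith)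
    have h9 : U' (β h) * β' h / (1 + η) ≤ 2 * C * (U (β h) / (1 + η)) * D := by
      have : U' (β h) * β' h ≤ C * U (β h) * D * 2 := by
        have := hp.pos' (β h)
        have : 0 ≤ β' h := by linarith [(bβ' h).1]
        gcongr
        linarith
      calc U' (β h) * β' h / (1 + η) ≤ C * U (β h) * D * 2 / (1 + η) := by gcongr
        _ = _ := by ring
    have h10 : c * κ' h ≤ c * κ h * D := by
      have h11 : κ' h ≤ κ h := by
        simp only [hκ']
        have h12 : κ h * (1 - κ h) ≤ κ h := by nlinarith
        have h13 : 0 ≤ κ h * (1 - κ h) := mul_nonneg h5.le (by linarith)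
        nlinarith
      have h12 : c * κ' h ≤ c * κ h := by gcongr
      have : 0 ≤ c * κ h := by positivity
      nlinarith
    have h14 : 0 ≤ U (β h) / (1 + η) * D := by positivity
    have h15 : 0 ≤ 2 * C * (c * κ h * D) := by positivity
    nlinarith

theorem exists_inverse {F F1 : ℝ → ℝ} (hF : ∀ h, HasDerivAt F (F1 h) h) (hF1 : ∀ h, 0 < F1 h)
    (hsurj : ∀ y, 0 < y → ∃ h, F h = y) :
    ∃ I : ℝ → ℝ, (∀ y, 0 < y → F (I y) = y) ∧
      ∀ y, 0 < y → HasDerivAt I (F1 (I y))⁻¹ y := by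
  choose! I hI using hsurj
  have hmono : StrictMono F := strictMono_of_hasDerivAt_pos hF hF1
  refine ⟨I, hI, fun y hy => ?_⟩
  have hc : ContinuousAt I y := by
    rw [Metric.continuousAt_iff']
    intro e he
    have h1 : F (I y - e) < y := by
      conv_rhs => rw [← hI y hy]
      exact hmono (by linarith)
    have h2 : y < F (I y + e) := by
      conv_lhs => rw [← hI y hy]
      exact hmono (by linarith)
    filter_upwards [lt_mem_nhds hy, lt_mem_nhds h1, gt_mem_nhds h2] with z hz hz1 hz2
    rw [← hI z hz] at hz1 hz2
    have h3 := hmono.lt_iff_lt.1 hz1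
    have h4 := hmono.lt_iff_lt.1 hz2
    rw [Real.dist_eq, abs_lt]
    constructor <;> linarith
  refine HasDerivAt.of_local_left_inverse hc (hF (I y)) (hF1 _).ne' ?_
  filter_upwards [lt_mem_nhds hy] with z hz using hI z hz

theorem exists_inverse_of_neg {G G1 : ℝ → ℝ} (hG : ∀ h, HasDerivAt G (G1 h) h)
    (hG1 : ∀ h, G1 h < 0) (hsurj : ∀ y, 0 < y → ∃ h, G h = y) :
    ∃ J : ℝ → ℝ, (∀ y, 0 < y → G (J y) = y) ∧
      ∀ y, 0 < y → HasDerivAt J (G1 (J y))⁻¹ y := by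
  obtain ⟨I, hI, hI'⟩ := exists_inverse (F := fun h => G (-h)) (F1 := fun h => -G1 (-h))
    (fun h => by
      have := (hG (-h)).comp h (hasDerivAt_neg h)
      rw [mul_neg_one] at this
      exact this)
    (fun h => by have := hG1 (-h); linarith)
    (fun y hy => by obtain ⟨h, hh⟩ := hsurj y hy; exact ⟨-h, by simpa using hh⟩)
  refine ⟨fun y => -I y, hI, fun y hy => ?_⟩
  have := (hI' y hy).neg
  rw [inv_neg, neg_neg] at this
  exact this

section barrier

variable {a C b c η A ε : ℝ} {F F1 F2 G G1 G2 : ℝ → ℝ}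

theorem Barrier.surj_F (hB : Barrier a C b c η A ε F F1 F2 G G1 G2) (ha : 0 < a) (hb : 0 < b)
    (y : ℝ) (hy : 0 < y) : ∃ h, F h = y := by
  have hcont : Continuous F := continuous_iff_continuousAt.2 fun h => (hB.dF h).continuousAt
  refine mem_range_of_exists_le_of_exists_ge hcont ?_ ⟨y + η * A, by linarith [hB.le_F (y + η * A)]⟩
  have hz : 0 < y / (a + 1) := by positivity
  refine ⟨min 0 (Real.log (y / (a + 1)) / b), (hB.F_le_exp _ (min_le_left _ _)).trans ?_⟩
  have h1 : b * min 0 (Real.log (y / (a + 1)) / b) ≤ Real.log (y / (a + 1)) := by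
    calc _ ≤ b * (Real.log (y / (a + 1)) / b) := by gcongr; exact min_le_right _ _
      _ = _ := by field_simp
  calc _ ≤ (a + 1) * Real.exp (Real.log (y / (a + 1))) := by gcongr
    _ = y := by rw [Real.exp_log hz]; field_simp

theorem Barrier.surj_G (hB : Barrier a C b c η A ε F F1 F2 G G1 G2) (ha : 0 < a) (hc : 0 < c)
    (y : ℝ) (hy : 0 < y) : ∃ h, G h = y := by
  have hcont : Continuous G := continuous_iff_continuousAt.2 fun h => (hB.dG h).continuousAt
  refine mem_range_of_exists_le_of_exists_ge hcont ?_
    ⟨-(y + 2 * c), by linarith [hB.le_G (-(y + 2 * c)) (by linarith)]⟩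
  refine ⟨-Real.log (c / a) / a, le_trans (not_lt.1 fun h => ?_) hy.le⟩
  have := hB.G_exp _ h
  have e : -(a * (-Real.log (c / a) / a)) = Real.log (c / a) := by field_simp
  rw [e, Real.exp_log (by positivity)] at this
  have : a * (c / a) = c := by field_simp
  linarith

end barrier

/-- A function `ψ` has gradient `w` and Hessian quadratic form `H`, of trace `L`, at `x`. -/
structure Jet {n : ℕ} (ψ : EuclideanSpace ℝ (Fin n) → ℝ) (x w : EuclideanSpace ℝ (Fin n))
    (H : EuclideanSpace ℝ (Fin n) → ℝ) (L : ℝ) : Prop where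
  line : ∀ b, ∃ d : ℝ → ℝ, (∀ t, HasDerivAt (fun t : ℝ => ψ (x + t • b)) (d t) t) ∧
    d 0 = ⟪w, b⟫ ∧ HasDerivAt d (H b) 0
  trace : ∀ B : OrthonormalBasis (Fin n) ℝ (EuclideanSpace ℝ (Fin n)), ∑ i, H (B i) = L

section jet

variable {n : ℕ} {u : EuclideanSpace ℝ (Fin n) → ℝ} {x w : EuclideanSpace ℝ (Fin n)}

theorem hasDerivAt_add_smul (x b : EuclideanSpace ℝ (Fin n)) (t : ℝ) :
    HasDerivAt (fun t : ℝ => x + t • b) b t := by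
  simpa using ((hasDerivAt_id t).smul_const b).const_add x

theorem exists_jet (hu : ContDiff ℝ (⊤ : ℕ∞) u) (x : EuclideanSpace ℝ (Fin n)) :
    ∃ w H, Jet u x w H (lap u x) := by
  refine ⟨(InnerProductSpace.toDual ℝ _).symm (fderiv ℝ u x),
    fun b => fderiv ℝ (fderiv ℝ u) x b b, fun b => ?_, fun B => ?_⟩
  · have hd : Differentiable ℝ u := hu.differentiable (by simp)
    have hd2 : Differentiable ℝ (fderiv ℝ u) :=
      (hu.fderiv_right (m := (⊤ : ℕ∞)) (by simp)).differentiable (by simp)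
    refine ⟨fun t => fderiv ℝ u (x + t • b) b, fun t => ?_, ?_, ?_⟩
    · exact (hd (x + t • b)).hasFDerivAt.comp_hasDerivAt t (hasDerivAt_add_smul x b t)
    · simp [InnerProductSpace.toDual_symm_apply]
    · have h1 := (hd2 (x + (0 : ℝ) • b)).hasFDerivAt.comp_hasDerivAt 0 (hasDerivAt_add_smul x b 0)
      have h2 := h1.clm_apply (hasDerivAt_const (0 : ℝ) b)
      simpa using h2
  · have h1 := congrFun (InnerProductSpace.laplacian_eq_iteratedFDeriv_orthonormalBasis u B) x
    have h2 := congrFun (InnerProductSpace.laplacian_eq_iteratedFDeriv_orthonormalBasis u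
      (EuclideanSpace.basisFun (Fin n) ℝ)) x
    rw [h1] at h2
    simp only [iteratedFDeriv_two_apply] at h2
    simp only [lap, iteratedFDeriv_two_apply]
    simpa using h2

theorem Jet.comp {H : EuclideanSpace ℝ (Fin n) → ℝ} {L : ℝ} (hj : Jet u x w H L)
    (hu : ∀ x, 0 < u x) {F1 F2 I : ℝ → ℝ} (hF1 : ∀ h, HasDerivAt F1 (F2 h) h)
    (hne : ∀ h, F1 h ≠ 0) (hI : ∀ y, 0 < y → HasDerivAt I (F1 (I y))⁻¹ y) :
    Jet (fun z => I (u z)) x ((F1 (I (u x)))⁻¹ • w)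
      (fun b => (H b - F2 (I (u x)) * ⟪(F1 (I (u x)))⁻¹ • w, b⟫ ^ 2) / F1 (I (u x)))
      ((L - F2 (I (u x)) * ‖(F1 (I (u x)))⁻¹ • w‖ ^ 2) / F1 (I (u x))) := by
  refine ⟨fun b => ?_, fun B => ?_⟩
  · obtain ⟨d, hd, hd0, hd'⟩ := hj.line b
    refine ⟨fun t => (F1 (I (u (x + t • b))))⁻¹ * d t, fun t => ?_, ?_, ?_⟩
    · exact (hI _ (hu _)).comp t (hd t)
    · simp [hd0, real_inner_smul_left]
    · have h1 : HasDerivAt (fun t : ℝ => I (u (x + t • b)))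
          ((F1 (I (u (x + (0 : ℝ) • b))))⁻¹ * d 0) 0 := (hI _ (hu _)).comp (0 : ℝ) (hd 0)
      have h2 := (((hF1 _).comp (0 : ℝ) h1).inv (hne _)).mul hd'
      refine h2.congr_deriv ?_
      have := hne (I (u x))
      simp only [Function.comp_apply, zero_smul, add_zero, real_inner_smul_left, Pi.inv_apply, hd0]
      field_simp
      ring
  · have h1 := hj.trace B
    have h2 := B.sum_sq_norm_inner_left ((F1 (I (u x)))⁻¹ • w)
    simp only [Real.norm_eq_abs, sq_abs] at h2
    rw [← Finset.sum_div, Finset.sum_sub_distrib, h1, ← Finset.mul_sum, h2]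

end jet

section twoPoint

variable {n : ℕ}

theorem deriv_nonpos_of_right_max {f : ℝ → ℝ} {d : ℝ} (hf : HasDerivAt f d 0)
    (hmax : ∀ᶠ t in 𝓝[>] (0 : ℝ), f t ≤ f 0) : d ≤ 0 := by
  have h1 : Tendsto (slope f 0) (𝓝[>] 0) (𝓝 d) :=
    (hasDerivAt_iff_tendsto_slope.1 hf).mono_left
      (nhdsWithin_mono (0 : ℝ) (fun t (ht : (0 : ℝ) < t) => ht.ne'))
  refine le_of_tendsto h1 ?_
  filter_upwards [hmax, self_mem_nhdsWithin] with t ht ht0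
  have : (0 : ℝ) < t := ht0
  rw [slope_def_field]
  exact div_nonpos_of_nonpos_of_nonneg (by linarith) (by linarith)

theorem hasDerivAt_norm_sq_line (x b : EuclideanSpace ℝ (Fin n)) (t : ℝ) :
    HasDerivAt (fun t : ℝ => ‖x + t • b‖ ^ 2) (2 * ⟪x + t • b, b⟫) t :=
  (hasDerivAt_add_smul x b t).norm_sq

theorem hasDerivAt_inner_line (x b : EuclideanSpace ℝ (Fin n)) :
    HasDerivAt (fun t : ℝ => ⟪x + t • b, b⟫) ⟪b, b⟫ 0 := by
  simpa using (hasDerivAt_add_smul x b 0).inner ℝ (hasDerivAt_const (0 : ℝ) b)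

theorem hasDerivAt_norm_line {x : EuclideanSpace ℝ (Fin n)} (hx : x ≠ 0)
    (b : EuclideanSpace ℝ (Fin n)) :
    HasDerivAt (fun t : ℝ => ‖x + t • b‖) (⟪x, b⟫ / ‖x‖) 0 := by
  have h1 := (hasDerivAt_norm_sq_line x b 0).sqrt (by simpa using hx)
  have h2 : ‖x‖ ≠ 0 := norm_ne_zero_iff.2 hx
  simp only [Real.sqrt_sq (norm_nonneg _), zero_smul, add_zero] at h1
  refine h1.congr_deriv ?_
  field_simp

/-- The doubled test function. -/
def doubled (α β κ : ℝ) (x₀ : EuclideanSpace ℝ (Fin n)) (ψ₁ ψ₂ : EuclideanSpace ℝ (Fin n) → ℝ)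
    (p : EuclideanSpace ℝ (Fin n) × EuclideanSpace ℝ (Fin n)) : ℝ :=
  ψ₁ p.1 + ψ₂ p.2 - (α * ‖p.1 - p.2‖ - β * ‖p.1 - p.2‖ ^ 2) - κ * ‖p.1 - x₀‖ ^ 2

variable {α β κ : ℝ} {x₀ x y w₁ w₂ : EuclideanSpace ℝ (Fin n)}
  {ψ₁ ψ₂ H₁ H₂ : EuclideanSpace ℝ (Fin n) → ℝ} {L₁ L₂ : ℝ}

theorem isLocalMax_doubled_line (hmax : IsLocalMax (doubled α β κ x₀ ψ₁ ψ₂) (x, y))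
    (b b' : EuclideanSpace ℝ (Fin n)) :
    IsLocalMax (fun t : ℝ => doubled α β κ x₀ ψ₁ ψ₂ (x + t • b, y + t • b')) 0 := by
  have hc : Continuous fun t : ℝ => (x + t • b, y + t • b') := by fun_prop
  have h1 : Tendsto (fun t : ℝ => (x + t • b, y + t • b')) (𝓝 0) (𝓝 (x, y)) := by
    simpa using hc.tendsto 0
  filter_upwards [h1.eventually hmax] with t ht
  simpa using ht

theorem gradient_eq_of_isLocalMax (hxy : x ≠ y) (h₁ : Jet ψ₁ x w₁ H₁ L₁) (h₂ : Jet ψ₂ y w₂ H₂ L₂)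
    (hmax : IsLocalMax (doubled α β κ x₀ ψ₁ ψ₂) (x, y)) :
    w₁ = ((α - 2 * β * ‖x - y‖) / ‖x - y‖) • (x - y) + (2 * κ) • (x - x₀) ∧
      w₂ = -(((α - 2 * β * ‖x - y‖) / ‖x - y‖) • (x - y)) := by
  have hne : x - y ≠ 0 := sub_ne_zero.2 hxy
  have hne' : ‖x - y‖ ≠ 0 := norm_ne_zero_iff.2 hne
  constructor
  · refine ext_inner_right ℝ fun b => ?_
    obtain ⟨d, hd, hd0, -⟩ := h₁.line b
    have h1 := isLocalMax_doubled_line hmax b 0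
    have e1 : HasDerivAt (fun t : ℝ => ψ₁ (x + t • b) + ψ₂ y -
        (α * ‖x - y + t • b‖ - β * ‖x - y + t • b‖ ^ 2) - κ * ‖x - x₀ + t • b‖ ^ 2)
        (d 0 - (α * (⟪x - y, b⟫ / ‖x - y‖) - β * (2 * ⟪x - y + (0 : ℝ) • b, b⟫)) -
          κ * (2 * ⟪x - x₀ + (0 : ℝ) • b, b⟫)) 0 :=
      (((hd 0).add_const _).sub (((hasDerivAt_norm_line hne b).const_mul α).sub
        ((hasDerivAt_norm_sq_line (x - y) b 0).const_mul β))).sub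
        ((hasDerivAt_norm_sq_line (x - x₀) b 0).const_mul κ)
    have e2 : (fun t : ℝ => doubled α β κ x₀ ψ₁ ψ₂ (x + t • b, y + t • (0 : EuclideanSpace ℝ (Fin n)))) =
        (fun t : ℝ => ψ₁ (x + t • b) + ψ₂ y -
        (α * ‖x - y + t • b‖ - β * ‖x - y + t • b‖ ^ 2) - κ * ‖x - x₀ + t • b‖ ^ 2) := by
      funext t
      simp only [doubled, smul_zero, add_zero]
      rw [show x + t • b - y = x - y + t • b by abel, show x + t • b - x₀ = x - x₀ + t • b by abel]
    rw [e2] at h1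
    have h2 := h1.hasDerivAt_eq_zero e1
    rw [hd0] at h2
    simp only [zero_smul, add_zero] at h2
    rw [inner_add_left, real_inner_smul_left, real_inner_smul_left]
    have : (α - 2 * β * ‖x - y‖) / ‖x - y‖ * ⟪x - y, b⟫ =
      α * (⟪x - y, b⟫ / ‖x - y‖) - β * (2 * ⟪x - y, b⟫) := by field_simp
    linarith
  · refine ext_inner_right ℝ fun b => ?_
    obtain ⟨d, hd, hd0, -⟩ := h₂.line b
    have h1 := isLocalMax_doubled_line hmax 0 b
    have hne2 : y - x ≠ 0 := sub_ne_zero.2 hxy.symm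
    have e1 : HasDerivAt (fun t : ℝ => ψ₁ x + ψ₂ (y + t • b) -
        (α * ‖y - x + t • b‖ - β * ‖y - x + t • b‖ ^ 2) - κ * ‖x - x₀‖ ^ 2)
        (d 0 - (α * (⟪y - x, b⟫ / ‖y - x‖) - β * (2 * ⟪y - x + (0 : ℝ) • b, b⟫))) 0 :=
      (((hd 0).const_add _).sub (((hasDerivAt_norm_line hne2 b).const_mul α).sub
        ((hasDerivAt_norm_sq_line (y - x) b 0).const_mul β))).sub_const _
    have e2 : (fun t : ℝ => doubled α β κ x₀ ψ₁ ψ₂ (x + t • (0 : EuclideanSpace ℝ (Fin n)), y + t • b)) =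
        (fun t : ℝ => ψ₁ x + ψ₂ (y + t • b) -
        (α * ‖y - x + t • b‖ - β * ‖y - x + t • b‖ ^ 2) - κ * ‖x - x₀‖ ^ 2) := by
      funext t
      simp only [doubled, smul_zero, add_zero]
      rw [show y - x + t • b = -(x - (y + t • b)) by abel, norm_neg]
    rw [e2] at h1
    have h2 := h1.hasDerivAt_eq_zero e1
    rw [hd0] at h2
    simp only [zero_smul, add_zero] at h2
    rw [← neg_sub x y, norm_neg, inner_neg_left] at h2
    rw [inner_neg_left, real_inner_smul_left]
    have : (α - 2 * β * ‖x - y‖) / ‖x - y‖ * ⟪x - y, b⟫ =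
      α * (⟪x - y, b⟫ / ‖x - y‖) - β * (2 * ⟪x - y, b⟫) := by field_simp
    have e3 : α * (-⟪x - y, b⟫ / ‖x - y‖) = -(α * (⟪x - y, b⟫ / ‖x - y‖)) := by ring
    linarith

theorem sum_inner_sq (B : OrthonormalBasis (Fin n) ℝ (EuclideanSpace ℝ (Fin n)))
    (e : EuclideanSpace ℝ (Fin n)) : ∑ i, ⟪e, B i⟫ ^ 2 = ‖e‖ ^ 2 := by
  have h2 := B.sum_sq_norm_inner_left e
  simpa only [Real.norm_eq_abs, sq_abs] using h2

theorem laplacian_le_of_isLocalMax_ne (hxy : x ≠ y) (h₁ : Jet ψ₁ x w₁ H₁ L₁)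
    (h₂ : Jet ψ₂ y w₂ H₂ L₂) (hmax : IsLocalMax (doubled α β κ x₀ ψ₁ ψ₂) (x, y)) :
    L₁ + L₂ + 8 * β ≤ 2 * κ * n := by
  have hne : x - y ≠ 0 := sub_ne_zero.2 hxy
  have hpos : 0 < ‖x - y‖ := norm_pos_iff.2 hne
  set ρ := ‖x - y‖ with hρ
  set e := ρ⁻¹ • (x - y) with he
  have hen : ‖e‖ = 1 := by rw [he, norm_smul, norm_inv, Real.norm_of_nonneg hpos.le, ← hρ]; field_simp
  have hxe : x - y = ρ • e := by rw [he, smul_smul, mul_inv_cancel₀ hpos.ne', one_smul]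
  set R := (Submodule.span ℝ {e})ᗮ.reflection with hR
  have hRb : ∀ b, R b = b - (2 * ⟪e, b⟫) • e := by
    intro b
    rw [hR, Submodule.reflection_orthogonal_apply, Submodule.reflection_singleton_apply, hen]
    simp only [RCLike.ofReal_real_eq_id, id, one_pow, div_one, neg_sub]
    rw [two_mul, add_smul, two_smul]
  have key : ∀ b, ‖b‖ = 1 → H₁ b + H₂ (R b) + 8 * β * ⟪e, b⟫ ^ 2 - 2 * κ ≤ 0 := by
    intro b hb
    obtain ⟨d₁, hd₁, -, hd₁'⟩ := h₁.line b
    obtain ⟨d₂, hd₂, -, hd₂'⟩ := h₂.line (R b)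
    have h1 := isLocalMax_doubled_line hmax b (R b)
    set s := ⟪e, b⟫ with hs
    have hlin : ∀ t : ℝ, HasDerivAt (fun t : ℝ => ρ + 2 * t * s) (2 * s) t := fun t => by
      have := (((hasDerivAt_id t).const_mul 2).mul_const s).const_add ρ
      simpa using this
    have hf : ∀ t : ℝ, HasDerivAt (fun t : ℝ => ψ₁ (x + t • b) + ψ₂ (y + t • R b) -
        (α * (ρ + 2 * t * s) - β * (ρ + 2 * t * s) ^ 2) - κ * ‖x - x₀ + t • b‖ ^ 2)
        (d₁ t + d₂ t - (α * (2 * s) - β * (2 * (ρ + 2 * t * s) * (2 * s))) -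
          κ * (2 * ⟪x - x₀ + t • b, b⟫)) t := fun t => by
      have h3 := ((hlin t).pow 2)
      have h4 := (((hd₁ t).add (hd₂ t)).sub (((hlin t).const_mul α).sub (h3.const_mul β))).sub
        ((hasDerivAt_norm_sq_line (x - x₀) b t).const_mul κ)
      refine h4.congr_deriv ?_
      simp
    have hf' : HasDerivAt (fun t : ℝ =>
        d₁ t + d₂ t - (α * (2 * s) - β * (2 * (ρ + 2 * t * s) * (2 * s))) -
          κ * (2 * ⟪x - x₀ + t • b, b⟫))
        (H₁ b + H₂ (R b) - (0 - β * (2 * (2 * s) * (2 * s))) - κ * (2 * ⟪b, b⟫)) 0 := by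
      have h3 := hasDerivAt_inner_line (x - x₀) b
      exact ((hd₁'.add hd₂').sub ((hasDerivAt_const (0 : ℝ) (α * (2 * s))).sub
        (((((hlin 0).const_mul 2).mul_const (2 * s))).const_mul β))).sub
        ((h3.const_mul 2).const_mul κ)
    have hev : ∀ᶠ t : ℝ in 𝓝 0, 0 < ρ + 2 * t * s :=
      (hlin 0).continuousAt.eventually (lt_mem_nhds (by simpa using hpos))
    have hm : IsLocalMax (fun t : ℝ => ψ₁ (x + t • b) + ψ₂ (y + t • R b) -
        (α * (ρ + 2 * t * s) - β * (ρ + 2 * t * s) ^ 2) - κ * ‖x - x₀ + t • b‖ ^ 2) 0 := by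
      refine (h1.congr (?_ : _ =ᶠ[𝓝 (0 : ℝ)] _))
      filter_upwards [hev] with t ht
      simp only [doubled]
      have e1 : x + t • b - (y + t • R b) = (ρ + 2 * t * s) • e := by
        rw [hRb, add_smul, ← hxe, smul_sub, smul_smul, show 2 * t * s = t * (2 * s) by ring]
        abel
      rw [e1, norm_smul, hen, mul_one, Real.norm_of_nonneg ht.le,
        show x + t • b - x₀ = x - x₀ + t • b by abel]
    have h5 := second_deriv_nonpos_of_isLocalMax hm (Eventually.of_forall hf) hf'
    rw [real_inner_self_eq_norm_sq, hb] at h5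
    linarith
  set B := EuclideanSpace.basisFun (Fin n) ℝ
  have h6 : ∑ i, (H₁ (B i) + H₂ (R (B i)) + 8 * β * ⟪e, B i⟫ ^ 2 - 2 * κ) ≤ 0 :=
    Finset.sum_nonpos fun i _ => key _ (B.norm_eq_one i)
  have h7 := h₁.trace B
  have h8 := h₂.trace (B.map R)
  simp only [OrthonormalBasis.map_apply] at h8
  rw [Finset.sum_sub_distrib, Finset.sum_add_distrib, Finset.sum_add_distrib, h7, h8,
    ← Finset.mul_sum, sum_inner_sq, hen] at h6
  simp at h6
  linarith

theorem laplacian_le_of_isLocalMax_eq (h₁ : Jet ψ₁ x w₁ H₁ L₁)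
    (h₂ : Jet ψ₂ x w₂ H₂ L₂) (hmax : IsLocalMax (doubled α β κ x₀ ψ₁ ψ₂) (x, x)) :
    L₁ + L₂ ≤ 2 * κ * n := by
  have key : ∀ b, ‖b‖ = 1 → H₁ b + H₂ b - 2 * κ ≤ 0 := by
    intro b hb
    obtain ⟨d₁, hd₁, -, hd₁'⟩ := h₁.line b
    obtain ⟨d₂, hd₂, -, hd₂'⟩ := h₂.line b
    have h1 := isLocalMax_doubled_line hmax b b
    have hf : ∀ t : ℝ, HasDerivAt (fun t : ℝ => ψ₁ (x + t • b) + ψ₂ (x + t • b) -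
        κ * ‖x - x₀ + t • b‖ ^ 2) (d₁ t + d₂ t - κ * (2 * ⟪x - x₀ + t • b, b⟫)) t := fun t =>
      ((hd₁ t).add (hd₂ t)).sub ((hasDerivAt_norm_sq_line (x - x₀) b t).const_mul κ)
    have hf' : HasDerivAt (fun t : ℝ => d₁ t + d₂ t - κ * (2 * ⟪x - x₀ + t • b, b⟫))
        (H₁ b + H₂ b - κ * (2 * ⟪b, b⟫)) 0 := by
      have h3 := hasDerivAt_inner_line (x - x₀) b
      exact (hd₁'.add hd₂').sub ((h3.const_mul 2).const_mul κ)
    have hm : IsLocalMax (fun t : ℝ => ψ₁ (x + t • b) + ψ₂ (x + t • b) -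
        κ * ‖x - x₀ + t • b‖ ^ 2) 0 := by
      refine (h1.congr (?_ : _ =ᶠ[𝓝 (0 : ℝ)] _))
      filter_upwards with t
      simp [doubled, show x + t • b - x₀ = x - x₀ + t • b by abel]
    have h5 := second_deriv_nonpos_of_isLocalMax hm (Eventually.of_forall hf) hf'
    rw [real_inner_self_eq_norm_sq, hb] at h5
    linarith
  set B := EuclideanSpace.basisFun (Fin n) ℝ
  have h6 : ∑ i, (H₁ (B i) + H₂ (B i) - 2 * κ) ≤ 0 :=
    Finset.sum_nonpos fun i _ => key _ (B.norm_eq_one i)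
  have h7 := h₁.trace B
  have h8 := h₂.trace B
  rw [Finset.sum_sub_distrib, Finset.sum_add_distrib, h7, h8] at h6
  simp at h6
  linarith

theorem gradient_le_of_isLocalMax_eq (hκ : 0 ≤ κ) (hα : 0 ≤ α) (h₁ : Jet ψ₁ x w₁ H₁ L₁)
    (h₂ : Jet ψ₂ x w₂ H₂ L₂) (hmax : IsLocalMax (doubled α β κ x₀ ψ₁ ψ₂) (x, x)) :
    ‖w₁‖ ≤ α + 2 * κ * ‖x - x₀‖ ∧ ‖w₂‖ ≤ α := by
  have norm_le : ∀ (w : EuclideanSpace ℝ (Fin n)) (q : ℝ), 0 ≤ q → ⟪w, w⟫ ≤ q * ‖w‖ → ‖w‖ ≤ q := by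
    intro w q hq h
    rcases (norm_nonneg w).eq_or_lt with h0 | h0
    · rw [← h0]; exact hq
    · rw [real_inner_self_eq_norm_sq, sq] at h
      exact le_of_mul_le_mul_right h h0
  have hlin : ∀ b : EuclideanSpace ℝ (Fin n), HasDerivAt
      (fun t : ℝ => α * (t * ‖b‖) - β * (t * ‖b‖) ^ 2) (α * ‖b‖) 0 := fun b => by
    have h1 := (hasDerivAt_id (0 : ℝ)).mul_const ‖b‖
    have h2 := (h1.const_mul α).sub ((h1.pow 2).const_mul β)
    refine h2.congr_deriv ?_
    simp
  constructor
  · refine norm_le _ _ (by positivity) ?_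
    obtain ⟨d, hd, hd0, -⟩ := h₁.line w₁
    have h1 := isLocalMax_doubled_line hmax w₁ 0
    have e1 : HasDerivAt (fun t : ℝ => ψ₁ (x + t • w₁) + ψ₂ x -
        (α * (t * ‖w₁‖) - β * (t * ‖w₁‖) ^ 2) - κ * ‖x - x₀ + t • w₁‖ ^ 2)
        (d 0 - (α * ‖w₁‖) - κ * (2 * ⟪x - x₀ + (0 : ℝ) • w₁, w₁⟫)) 0 :=
      (((hd 0).add_const _).sub (hlin w₁)).sub
        ((hasDerivAt_norm_sq_line (x - x₀) w₁ 0).const_mul κ)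
    have h2 := deriv_nonpos_of_right_max e1 ?_
    · rw [hd0, zero_smul, add_zero] at h2
      have h3 := real_inner_le_norm (x - x₀) w₁
      have h4 := mul_le_mul_of_nonneg_left h3 hκ
      linarith
    · filter_upwards [h1.filter_mono nhdsWithin_le_nhds, self_mem_nhdsWithin] with t ht ht0
      have : (0 : ℝ) < t := ht0
      simp only [doubled, smul_zero, add_zero, zero_smul, sub_self, norm_zero,
        add_sub_cancel_left, norm_smul, Real.norm_of_nonneg this.le] at ht
      rw [show x + t • w₁ - x₀ = x - x₀ + t • w₁ by abel] at ht
      simp only [add_zero, zero_smul, zero_mul]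
      linarith
  · refine norm_le _ _ hα ?_
    obtain ⟨d, hd, hd0, -⟩ := h₂.line w₂
    have h1 := isLocalMax_doubled_line hmax 0 w₂
    have e1 : HasDerivAt (fun t : ℝ => ψ₁ x + ψ₂ (x + t • w₂) -
        (α * (t * ‖w₂‖) - β * (t * ‖w₂‖) ^ 2)) (d 0 - (α * ‖w₂‖)) 0 :=
      ((hd 0).const_add _).sub (hlin w₂)
    have h2 := deriv_nonpos_of_right_max e1 ?_
    · rw [hd0] at h2
      linarith
    · filter_upwards [h1.filter_mono nhdsWithin_le_nhds, self_mem_nhdsWithin] with t ht ht0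
      have : (0 : ℝ) < t := ht0
      simp only [doubled, smul_zero, add_zero, zero_smul, sub_self, norm_zero,
        sub_add_cancel_left, norm_neg, norm_smul, Real.norm_of_nonneg this.le] at ht
      simp only [add_zero, zero_smul, zero_mul]
      linarith

end twoPoint

/-- The height of the pair `(u, v)` over the curve `(F, G)`, where `I = F⁻¹` and `J = G⁻¹`. -/
def height {n : ℕ} (I J : ℝ → ℝ) (u v : EuclideanSpace ℝ (Fin n) → ℝ)
    (x : EuclideanSpace ℝ (Fin n)) : ℝ := max (I (u x)) (J (v x))

/-- Information carried by a smooth function touching the height `h` from below at a point where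
the pair takes the values `(u, v)`. -/
structure Touch (η ε : ℝ) (F F1 G : ℝ → ℝ) (u v h q L : ℝ) : Prop where
  lower : 1 - η / 4 ≤ q → q ≤ 1 + η / 4 → -ε ≤ L
  cases : (F h = u ∧ G h ≤ v ∧ (q ≤ 1 + η / 4 →
      -ε ≤ L ∧ F h * (v ^ 2 - max (G h) 0 ^ 2) - ε * F1 h ≤ F1 h * L)) ∨ (G h = v ∧ u ≤ F h)

section

variable {n : ℕ} {a C b c η A ε : ℝ} {F F1 F2 G G1 G2 I J : ℝ → ℝ}

theorem IsSolution.symm {u v : EuclideanSpace ℝ (Fin n) → ℝ} (h : IsSolution u v) :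
    IsSolution v u :=
  ⟨h.2.1, h.1, h.2.2.2.1, h.2.2.1, h.2.2.2.2.2, h.2.2.2.2.1⟩

theorem Barrier.mono_F (hB : Barrier a C b c η A ε F F1 F2 G G1 G2) : StrictMono F :=
  strictMono_of_hasDerivAt_pos hB.dF hB.F1_pos

theorem Barrier.anti_G (hB : Barrier a C b c η A ε F F1 F2 G G1 G2) : StrictAnti G :=
  strictAnti_of_hasDerivAt_neg hB.dG hB.G1_neg

theorem continuous_height (hI : ∀ y, 0 < y → HasDerivAt I (F1 (I y))⁻¹ y)
    (hJ : ∀ y, 0 < y → HasDerivAt J (G1 (J y))⁻¹ y) {u v : EuclideanSpace ℝ (Fin n) → ℝ}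
    (hu : Continuous u) (hv : Continuous v) (hu0 : ∀ x, 0 < u x) (hv0 : ∀ x, 0 < v x) :
    Continuous (height I J u v) := by
  refine Continuous.max ?_ ?_ <;> rw [continuous_iff_continuousAt] <;> intro x
  · exact ContinuousAt.comp (f := u) (hI _ (hu0 x)).continuousAt hu.continuousAt
  · exact ContinuousAt.comp (f := v) (hJ _ (hv0 x)).continuousAt hv.continuousAt

theorem exists_touch (hB : Barrier a C b c η A ε F F1 F2 G G1 G2)
    (hFI : ∀ y, 0 < y → F (I y) = y) (hI : ∀ y, 0 < y → HasDerivAt I (F1 (I y))⁻¹ y)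
    (hGJ : ∀ y, 0 < y → G (J y) = y) (hJ : ∀ y, 0 < y → HasDerivAt J (G1 (J y))⁻¹ y)
    {u v : EuclideanSpace ℝ (Fin n) → ℝ} (hs : IsSolution u v) (x : EuclideanSpace ℝ (Fin n)) :
    ∃ ψ w H L, (∀ z, ψ z ≤ height I J u v z) ∧ ψ x = height I J u v x ∧ Jet ψ x w H L ∧
      Touch η ε F F1 G (u x) (v x) (height I J u v x) ‖w‖ L := by
  obtain ⟨hu, hv, hu0, hv0, hlu, hlv⟩ := hs
  rcases le_or_gt (J (v x)) (I (u x)) with hle | hlt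
  · obtain ⟨w, H, hj⟩ := exists_jet hu x
    have hj' := hj.comp hu0 hB.dF1 (fun h => (hB.F1_pos h).ne') hI
    refine ⟨_, _, _, _, fun z => le_max_left _ _, (max_eq_left hle).symm, hj', ?_⟩
    rw [height, max_eq_left hle]
    have hF : F (I (u x)) = u x := hFI _ (hu0 x)
    have hG : G (I (u x)) ≤ v x := by
      conv_rhs => rw [← hGJ _ (hv0 x)]
      exact hB.anti_G.antitone hle
    have h1 := hB.F1_pos (I (u x))
    set h := I (u x)
    set q := ‖(F1 h)⁻¹ • w‖ with hq
    have key : q ≤ 1 + η / 4 → F h * (v x ^ 2 - max (G h) 0 ^ 2) - ε * F1 h ≤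
        F1 h * ((lap u x - F2 h * q ^ 2) / F1 h) := by
      intro hq'
      have h2 := hB.ineqF h q (norm_nonneg _) hq'
      rw [mul_div_cancel₀ _ h1.ne', hlu, ← hF]
      linarith
    have key2 : q ≤ 1 + η / 4 → -ε ≤ (lap u x - F2 h * q ^ 2) / F1 h := by
      intro hq'
      have h2 := key hq'
      have h3 : max (G h) 0 ^ 2 ≤ v x ^ 2 := by
        have : max (G h) 0 ≤ v x := max_le hG (hv0 x).le
        gcongr
      have h4 : 0 ≤ F h * (v x ^ 2 - max (G h) 0 ^ 2) := by
        have := hB.F_pos h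
        exact mul_nonneg this.le (by linarith)
      refine le_of_mul_le_mul_left ?_ h1
      linarith
    exact ⟨fun _ => key2, Or.inl ⟨hF, hG, fun hq' => ⟨key2 hq', key hq'⟩⟩⟩
  · obtain ⟨w, H, hj⟩ := exists_jet hv x
    have hj' := hj.comp hv0 hB.dG1 (fun h => (hB.G1_neg h).ne) hJ
    refine ⟨_, _, _, _, fun z => le_max_right _ _, (max_eq_right hlt.le).symm, hj', ?_⟩
    rw [height, max_eq_right hlt.le]
    have hG : G (J (v x)) = v x := hGJ _ (hv0 x)
    have hF : u x ≤ F (J (v x)) := by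
      conv_lhs => rw [← hFI _ (hu0 x)]
      exact hB.mono_F.monotone hlt.le
    have h1 := hB.G1_neg (J (v x))
    set h := J (v x)
    set q := ‖(G1 h)⁻¹ • w‖ with hq
    refine ⟨fun hq1 hq2 => ?_, Or.inr ⟨hG, hF⟩⟩
    have h2 := hB.ineqG h q (by rw [hG]; exact hv0 x) hq1 hq2
    have h3 : v x * u x ^ 2 ≤ G h * F h ^ 2 := by
      rw [hG]
      have := hv0 x
      have := hu0 x
      gcongr
    rw [hlv, le_div_iff_of_neg h1]
    linarith

/-- Values where both heights come from the first branch. -/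
theorem touch_contra_of_le (hB : Barrier a C b c η A ε F F1 F2 G G1 G2) (ha : 0 < a)
    (hC : 0 < C) {φ₀ h₁ h₂ u L₁ L₂ M : ℝ}
    (hφ1 : 4 * (3 * (η * A) + 2 * a) ≤ φ₀)
    (hφ2 : 16 * (2 * C + 1) ≤ φ₀) (hηA : 0 ≤ η * A) (hM : 2 * ε + M < 1) (hL : L₁ + L₂ ≤ M)
    (hsum : φ₀ < h₁ + h₂) (hle : h₂ ≤ h₁) (hu : F h₁ = u) (hL1 : -ε ≤ L₁)
    (hL2 : F h₂ * (u ^ 2 - max (G h₂) 0 ^ 2) - ε * F1 h₂ ≤ F1 h₂ * L₂) : False := by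
  have h1 : φ₀ / 2 < h₁ := by linarith
  have hF2 := hB.F_pos h₂
  have hF1 := hB.F1_pos h₂
  have hφ : 0 < φ₀ := by linarith
  have e1 := hB.le_F h₁
  have e2 : max (G h₂) 0 ≤ max (-h₂) 0 + 2 * (η * A) + 2 * a :=
    max_le (hB.G_le h₂) (by have := le_max_right (-h₂) 0; linarith)
  have e0 := le_max_right (G h₂) 0
  have e3 : φ₀ / 4 ≤ u - max (G h₂) 0 := by
    rcases le_total h₂ 0 with h | h
    · rw [max_eq_left (by linarith : (0 : ℝ) ≤ -h₂)] at e2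
      linarith
    · rw [max_eq_right (by linarith : -h₂ ≤ 0)] at e2
      linarith
  have e4 : h₁ / 2 ≤ u := by linarith
  have e5 : φ₀ / 4 * (h₁ / 2) ≤ u ^ 2 - max (G h₂) 0 ^ 2 := by
    calc φ₀ / 4 * (h₁ / 2) ≤ (u - max (G h₂) 0) * (u + max (G h₂) 0) := by
          apply mul_le_mul e3 (by linarith) (by linarith) (by linarith)
      _ = _ := by ring
  have e6 : F1 h₂ ≤ (2 * C + 1) * F h₂ * (2 * h₁) := by
    refine (hB.F1_le h₂).trans ?_
    have : max (-h₂) 0 ≤ h₁ := max_le (by linarith) (by linarith)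
    have h0 : 0 ≤ (2 * C + 1) * F h₂ := by positivity
    exact mul_le_mul_of_nonneg_left (by linarith) h0
  have e7 : F1 h₂ ≤ F h₂ * (φ₀ / 4 * (h₁ / 2)) := by
    refine e6.trans ?_
    have : (2 * C + 1) * (2 * h₁) ≤ φ₀ / 4 * (h₁ / 2) := by
      have : 16 * (2 * C + 1) * h₁ ≤ φ₀ * h₁ := mul_le_mul_of_nonneg_right hφ2 (by linarith)
      linarith
    calc _ = F h₂ * ((2 * C + 1) * (2 * h₁)) := by ring
      _ ≤ _ := by gcongr
  have e8 : F h₂ * (φ₀ / 4 * (h₁ / 2)) ≤ F h₂ * (u ^ 2 - max (G h₂) 0 ^ 2) := by gcongr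
  have e9 : F1 h₂ * (1 - ε) ≤ F1 h₂ * L₂ := by linarith
  have e10 := le_of_mul_le_mul_left e9 hF1
  linarith

theorem touch_sum_le (hB : Barrier a C b c η A ε F F1 F2 G G1 G2) (ha : 0 < a)
    (hC : 0 < C) {φ₀ K h₁ h₂ u v q₁ q₂ L₁ L₂ M : ℝ}
    (hφ1 : 4 * (3 * (η * A) + 2 * a) ≤ φ₀)
    (hφ2 : 16 * (2 * C + 1) ≤ φ₀) (hφ3 : 2 * K ≤ φ₀)
    (hηA : 0 ≤ η * A) (hKc : a * Real.exp (-(a * K)) ≤ c)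
    (hu0 : 0 < u) (hv0 : 0 < v) (hM : 2 * ε + M < 1) (hL : L₁ + L₂ ≤ M)
    (hq₁ : q₁ ≤ 1 + η / 4) (hq₂ : q₂ ≤ 1 + η / 4)
    (h₁' : Touch η ε F F1 G u v h₁ q₁ L₁) (h₂' : Touch η ε F F1 G v u h₂ q₂ L₂) :
    h₁ + h₂ ≤ φ₀ := by
  by_contra! hsum
  have hKlt : ∀ h, 0 < G h → h < K := by
    intro h hG
    have h1 := hB.G_exp h hG
    have h2 : Real.exp (-(a * K)) < Real.exp (-(a * h)) := by
      refine lt_of_mul_lt_mul_left (hKc.trans_lt h1) ha.le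
    have h3 := Real.exp_lt_exp.1 h2
    exact lt_of_mul_lt_mul_left (by linarith) ha.le
  have mixed : ∀ h k y, 0 < y → F h = y → G k = y → h + k ≤ φ₀ := by
    intro h k y hy hF hG
    have h1 := hKlt k (by rw [hG]; exact hy)
    have h2 := hB.le_F h
    have h3 := hB.G_le k
    rcases le_total k 0 with h | h
    · rw [max_eq_left (by linarith : (0 : ℝ) ≤ -k)] at h3
      linarith
    · rw [max_eq_right (by linarith : -k ≤ 0)] at h3
      linarith
  rcases h₁'.cases with ⟨a1, a2, a3⟩ | ⟨b1, b2⟩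
  · rcases h₂'.cases with ⟨c1, c2, c3⟩ | ⟨d1, d2⟩
    · rcases le_total h₂ h₁ with hle | hle
      · exact touch_contra_of_le hB ha hC hφ1 hφ2 hηA hM hL hsum hle a1
          (a3 hq₁).1 (c3 hq₂).2
      · exact touch_contra_of_le hB ha hC hφ1 hφ2 hηA hM (by linarith) (by linarith) hle
          c1 (c3 hq₂).1 (a3 hq₁).2
    · have := mixed h₁ h₂ u hu0 a1 d1
      linarith
  · rcases h₂'.cases with ⟨c1, c2, c3⟩ | ⟨d1, d2⟩
    · have := mixed h₂ h₁ v hv0 c1 b1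
      linarith
    · have e1 := hKlt h₁ (by rw [b1]; exact hv0)
      have e2 := hKlt h₂ (by rw [d1]; exact hu0)
      linarith

theorem exists_isLocalMax_doubled {S₁ S₂ : EuclideanSpace ℝ (Fin n) → ℝ} (hS₁ : Continuous S₁)
    (hS₂ : Continuous S₂) {x₀ y₀ : EuclideanSpace ℝ (Fin n)} {α β κ φ₀ D r e : ℝ} (hD : 0 < D)
    (hβ : 0 ≤ β) (hκ : 0 ≤ κ) (hr : 0 < r) (hφ : 2 * e ≤ φ₀) (hφ0 : 0 ≤ φ₀)
    (hαr : r ≤ α * r - β * r ^ 2)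
    (hκD : r + 2 * e ≤ κ * D ^ 2)
    (hbd : ∀ x y, ‖x - x₀‖ ≤ D → ‖x - y‖ ≤ r → S₁ x + S₂ y ≤ r + 2 * e)
    (hy₀ : ‖x₀ - y₀‖ ≤ r) (hneg : φ₀ + α * ‖x₀ - y₀‖ < S₁ x₀ + S₂ y₀) :
    ∃ x y, ‖x - x₀‖ < D ∧ ‖x - y‖ < r ∧ φ₀ < S₁ x + S₂ y ∧
      IsLocalMax (doubled α β κ x₀ S₁ S₂) (x, y) := by
  set K : Set (EuclideanSpace ℝ (Fin n) × EuclideanSpace ℝ (Fin n)) :=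
    {p | ‖p.1 - x₀‖ ≤ D ∧ ‖p.1 - p.2‖ ≤ r} with hK
  have hKc : IsCompact K := by
    refine Metric.isCompact_of_isClosed_isBounded ?_ ?_
    · have h1 : IsClosed {p : EuclideanSpace ℝ (Fin n) × EuclideanSpace ℝ (Fin n) |
          ‖p.1 - x₀‖ ≤ D} := isClosed_le (by fun_prop) (by fun_prop)
      have h2 : IsClosed {p : EuclideanSpace ℝ (Fin n) × EuclideanSpace ℝ (Fin n) |
          ‖p.1 - p.2‖ ≤ r} := isClosed_le (by fun_prop) (by fun_prop)
      exact h1.inter h2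
    · refine (Metric.isBounded_closedBall (x := (x₀, x₀)) (r := D + r)).subset fun p hp => ?_
      rw [Metric.mem_closedBall, Prod.dist_eq, max_le_iff, dist_eq_norm, dist_eq_norm]
      refine ⟨by linarith [hp.1], ?_⟩
      have : p.2 - x₀ = (p.1 - x₀) - (p.1 - p.2) := by abel
      simp only [this]
      linarith [norm_sub_le (p.1 - x₀) (p.1 - p.2), hp.1, hp.2]
  have hcont : Continuous (doubled α β κ x₀ S₁ S₂) := by
    unfold doubled
    fun_prop
  have h0 : (x₀, y₀) ∈ K := ⟨by simpa using hD.le, hy₀⟩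
  obtain ⟨⟨x, y⟩, hxy, hmax⟩ := hKc.exists_isMaxOn ⟨_, h0⟩ hcont.continuousOn
  have hge := hmax h0
  simp only [doubled, mem_ofPred_eq, sub_self, norm_zero] at hge
  have hβ0 : 0 ≤ β * ‖x₀ - y₀‖ ^ 2 := by positivity
  have hrho : ∀ s, 0 ≤ s → s ≤ r → s ≤ α * s - β * s ^ 2 := by
    intro s hs hsr
    have h1 : 1 ≤ α - β * r := by
      refine le_of_mul_le_mul_right ?_ hr
      linarith
    have h2 : β * s ≤ β * r := by gcongr
    have h3 : s * 1 ≤ s * (α - β * s) := mul_le_mul_of_nonneg_left (by linarith) hs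
    linarith
  have hxD := hxy.1
  have hxr := hxy.2
  simp only at hxD hxr
  have hsum := hbd x y hxD hxr
  have hr1 := hrho _ (norm_nonneg (x - y)) hxr
  have hn1 := norm_nonneg (x - y)
  have hk1 : 0 ≤ κ * ‖x - x₀‖ ^ 2 := by positivity
  have hx : ‖x - x₀‖ < D := by
    refine lt_of_le_of_ne hxD fun h => ?_
    rw [h] at hge
    linarith
  have hy : ‖x - y‖ < r := by
    refine lt_of_le_of_ne hxr fun h => ?_
    rw [h] at hge hr1
    linarith
  refine ⟨x, y, hx, hy, by linarith, ?_⟩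
  have : K ∈ 𝓝 (x, y) := by
    have h1 : ∀ᶠ p : EuclideanSpace ℝ (Fin n) × EuclideanSpace ℝ (Fin n) in 𝓝 (x, y),
        ‖p.1 - x₀‖ < D :=
      ContinuousAt.eventually_lt (by fun_prop) (by fun_prop) hx
    have h2 : ∀ᶠ p : EuclideanSpace ℝ (Fin n) × EuclideanSpace ℝ (Fin n) in 𝓝 (x, y),
        ‖p.1 - p.2‖ < r :=
      ContinuousAt.eventually_lt (by fun_prop) (by fun_prop) hy
    filter_upwards [h1, h2] with p hp1 hp2 using ⟨hp1.le, hp2.le⟩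
  exact hmax.isLocalMax this

theorem IsLocalMax.doubled_mono {S₁ S₂ ψ₁ ψ₂ : EuclideanSpace ℝ (Fin n) → ℝ}
    {x₀ x y : EuclideanSpace ℝ (Fin n)} {α β κ : ℝ}
    (h : IsLocalMax (doubled α β κ x₀ S₁ S₂) (x, y)) (h₁ : ∀ z, ψ₁ z ≤ S₁ z) (h₁' : ψ₁ x = S₁ x)
    (h₂ : ∀ z, ψ₂ z ≤ S₂ z) (h₂' : ψ₂ y = S₂ y) :
    IsLocalMax (doubled α β κ x₀ ψ₁ ψ₂) (x, y) := by
  filter_upwards [h] with p hp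
  simp only [doubled] at hp ⊢
  rw [h₁', h₂']
  linarith [h₁ p.1, h₂ p.2]

/-- The improved two-point bound for the heights. -/
theorem height_add_height_le (hB : Barrier a C b c η A ε F F1 F2 G G1 G2) (ha : 0 < a)
    (hC : 0 < C) (hη : 0 < η) (hη' : η ≤ 1 / 10) (hA : 0 < A)
    (hFI : ∀ y, 0 < y → F (I y) = y) (hI : ∀ y, 0 < y → HasDerivAt I (F1 (I y))⁻¹ y)
    (hGJ : ∀ y, 0 < y → G (J y) = y) (hJ : ∀ y, 0 < y → HasDerivAt J (G1 (J y))⁻¹ y)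
    {u v : EuclideanSpace ℝ (Fin n) → ℝ} (hs : IsSolution u v)
    {x₀ : EuclideanSpace ℝ (Fin n)} {φ₀ K D r e P : ℝ} (hD : 0 < D) (hr : 1 ≤ r)
    (hP : 0 ≤ P) (hPD : 2 * P / D ≤ η / 8) (hPD2 : 2 * ε + 2 * (P / D ^ 2) * n < η / r)
    (hφ1 : 4 * (3 * (η * A) + 2 * a) ≤ φ₀)
    (hφ2 : 16 * (2 * C + 1) ≤ φ₀) (hφ3 : 2 * K ≤ φ₀)
    (hKc : a * Real.exp (-(a * K)) ≤ c) (heφ : 2 * e ≤ φ₀) (hP' : r + 2 * e ≤ P)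
    (hbd : ∀ x y, ‖x - x₀‖ ≤ D → ‖x - y‖ ≤ r → height I J u v x + height I J v u y ≤ r + 2 * e)
    {y₀ : EuclideanSpace ℝ (Fin n)} (hy₀ : ‖x₀ - y₀‖ ≤ r) :
    height I J u v x₀ + height I J v u y₀ ≤ φ₀ + (1 + η / 8) * ‖x₀ - y₀‖ := by
  by_contra! hneg
  have hr0 : 0 < r := by linarith
  have hβ : 0 ≤ η / (8 * r) := by positivity
  have hκ : 0 ≤ P / D ^ 2 := by positivity
  have hβr : η / (8 * r) * r = η / 8 := by field_simp
  obtain ⟨x, y, hxD, hxr, hsum, hmax⟩ := exists_isLocalMax_doubled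
    (continuous_height hI hJ hs.1.continuous hs.2.1.continuous hs.2.2.1 hs.2.2.2.1)
    (continuous_height hI hJ hs.2.1.continuous hs.1.continuous hs.2.2.2.1 hs.2.2.1)
    hD hβ hκ hr0 heφ (by linarith) (α := 1 + η / 8)
    (by rw [sq, ← mul_assoc, hβr]; linarith) (by rwa [div_mul_cancel₀ _ (by positivity)]) hbd hy₀ hneg
  obtain ⟨ψ₁, w₁, H₁, L₁, hψ₁, hψ₁', hj₁, ht₁⟩ := exists_touch hB hFI hI hGJ hJ hs x
  obtain ⟨ψ₂, w₂, H₂, L₂, hψ₂, hψ₂', hj₂, ht₂⟩ := exists_touch hB hFI hI hGJ hJ hs.symm y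
  have hmax' := hmax.doubled_mono hψ₁ hψ₁' hψ₂ hψ₂'
  have hκx : 2 * (P / D ^ 2) * ‖x - x₀‖ ≤ η / 8 := by
    calc _ ≤ 2 * (P / D ^ 2) * D := by gcongr
      _ = 2 * P / D := by field_simp
      _ ≤ _ := hPD
  by_cases hxy : x = y
  · subst hxy
    obtain ⟨hw₁, hw₂⟩ := gradient_le_of_isLocalMax_eq hκ (by linarith) hj₁ hj₂ hmax'
    have hL := laplacian_le_of_isLocalMax_eq hj₁ hj₂ hmax'
    have : η / r ≤ 1 := by
      rw [div_le_one hr0]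
      linarith
    have := touch_sum_le hB ha hC hφ1 hφ2 hφ3 (by positivity) hKc (hs.2.2.1 x)
      (hs.2.2.2.1 x) (by linarith) hL (by linarith) (by linarith) ht₁ ht₂
    linarith
  · obtain ⟨hw₁, hw₂⟩ := gradient_eq_of_isLocalMax hxy hj₁ hj₂ hmax'
    have hL := laplacian_le_of_isLocalMax_ne hxy hj₁ hj₂ hmax'
    have hpos : 0 < ‖x - y‖ := norm_pos_iff.2 (sub_ne_zero.2 hxy)
    have hβρ : η / (8 * r) * ‖x - y‖ ≤ η / 8 := by
      rw [← hβr]; gcongr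
    have hβρ0 : 0 ≤ η / (8 * r) * ‖x - y‖ := by positivity
    set z := ((1 + η / 8 - 2 * (η / (8 * r)) * ‖x - y‖) / ‖x - y‖) • (x - y) with hz
    have hzn : ‖z‖ = 1 + η / 8 - 2 * (η / (8 * r)) * ‖x - y‖ := by
      rw [hz, norm_smul, Real.norm_of_nonneg, div_mul_cancel₀ _ hpos.ne']
      exact div_nonneg (by linarith) hpos.le
    have hw₂' : ‖w₂‖ = ‖z‖ := by rw [hw₂, norm_neg]
    have hsm : ‖(2 * (P / D ^ 2)) • (x - x₀)‖ ≤ η / 8 := by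
      rw [norm_smul, Real.norm_of_nonneg (by positivity)]
      exact hκx
    have hw₁a : ‖w₁‖ ≤ ‖z‖ + η / 8 := by
      rw [hw₁]
      linarith [norm_add_le z ((2 * (P / D ^ 2)) • (x - x₀))]
    have hw₁b : ‖z‖ - η / 8 ≤ ‖w₁‖ := by
      have := norm_sub_le w₁ ((2 * (P / D ^ 2)) • (x - x₀))
      rw [hw₁, add_sub_cancel_right, ← hw₁] at this
      linarith
    have l₁ := ht₁.lower (by linarith) (by linarith)
    have l₂ := ht₂.lower (by linarith) (by linarith)
    have : 8 * (η / (8 * r)) = η / r := by field_simp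
    linarith

end

/-- The comparison gauge: exponential on the left, linear on the right. -/
def gauge₁ (b h : ℝ) : ℝ := if h ≤ 0 then Real.exp (b * h) else 1 + h

/-- A two-point bound in terms of the gauge. -/
def Coarse {n : ℕ} (b : ℝ) (u v : EuclideanSpace ℝ (Fin n) → ℝ)
    (x y : EuclideanSpace ℝ (Fin n)) (Φ : ℝ) : Prop :=
  ∃ h k, h + k ≤ Φ ∧ u x ≤ gauge₁ b h ∧ -h ≤ v x ∧ v y ≤ gauge₁ b k ∧ -k ≤ u y

section

variable {n : ℕ} {a C b c η A ε e K : ℝ} {F F1 F2 G G1 G2 I J : ℝ → ℝ}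

theorem cube_le_exp {x : ℝ} (hx : 0 ≤ x) : x ^ 3 / 6 ≤ Real.exp x := by
  have := Real.pow_div_factorial_le_exp x hx 3
  simpa [Nat.factorial] using this

theorem Barrier.G_nonpos (hB : Barrier a C b c η A ε F F1 F2 G G1 G2) (ha : 0 < a)
    (hKc : a * Real.exp (-(a * K)) ≤ c) {h : ℝ} (hh : K ≤ h) : G h ≤ 0 := by
  by_contra! hG
  have h1 := hB.G_exp h hG
  have h2 : Real.exp (-(a * h)) ≤ Real.exp (-(a * K)) := by gcongr
  have h3 : a * Real.exp (-(a * h)) ≤ a * Real.exp (-(a * K)) := by gcongr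
  linarith

theorem Barrier.gauge_le (hB : Barrier a C b c η A ε F F1 F2 G G1 G2) (hb : 0 < b)
    (hc : 0 < c) (hηA : 0 ≤ η * A) (he : 4 * (η * A + 1) ≤ e)
    (hec : 2 ≤ c * Real.exp (b * (e / 2))) (h : ℝ) : gauge₁ b h ≤ F (h + e) := by
  have h0 := hB.le_F (h + e)
  unfold gauge₁
  split_ifs with hh
  · rcases le_total (-(e / 2)) h with h1 | h1
    · have : Real.exp (b * h) ≤ 1 := Real.exp_le_one_iff.2 (mul_nonpos_of_nonneg_of_nonpos hb.le hh)
      linarith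
    · refine le_trans ?_ (hB.exp_le_F (h + e))
      rcases le_total (h + e) 0 with h2 | h2
      · have h3 : Real.exp (b * (h + e)) ≤ 1 :=
          Real.exp_le_one_iff.2 (mul_nonpos_of_nonneg_of_nonpos hb.le h2)
        rw [min_eq_right h3, mul_add, Real.exp_add]
        have h4 : Real.exp (b * (e / 2)) ≤ Real.exp (b * e) :=
          Real.exp_le_exp.2 (by gcongr; linarith)
        have h5 : 2 ≤ c * Real.exp (b * e) := hec.trans (by gcongr)
        have h6 := Real.exp_pos (b * h)
        have h7 := mul_le_mul_of_nonneg_right h5 h6.le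
        linarith
      · have h3 : 1 ≤ Real.exp (b * (h + e)) := Real.one_le_exp (by positivity)
        rw [min_eq_left h3]
        have h4 : Real.exp (b * h) * Real.exp (b * (e / 2)) ≤ 1 := by
          rw [← Real.exp_add, Real.exp_le_one_iff, ← mul_add]
          exact mul_nonpos_of_nonneg_of_nonpos hb.le (by linarith)
        have h5 := mul_le_mul_of_nonneg_right hec (Real.exp_pos (b * h)).le
        have h6 := mul_le_mul_of_nonneg_left h4 hc.le
        linarith
  · linarith

theorem Barrier.G_add_le (hB : Barrier a C b c η A ε F F1 F2 G G1 G2) (ha : 0 < a) (ha1 : a ≤ 1)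
    (hηA : 0 ≤ η * A) (he : 4 * (η * A + 1) ≤ e) (heK : 2 * K ≤ e)
    (hKc : a * Real.exp (-(a * K)) ≤ c) (h : ℝ) : G (h + e) ≤ max (-h) 0 := by
  rcases le_total (-(e / 2)) h with h1 | h1
  · exact (hB.G_nonpos ha hKc (by linarith)).trans (le_max_right _ _)
  · refine (hB.G_le (h + e)).trans (le_trans ?_ (le_max_left _ _))
    rcases le_total (h + e) 0 with h2 | h2
    · rw [max_eq_left (by linarith)]; linarith
    · rw [max_eq_right (by linarith)]; linarith

theorem Barrier.F_le_gauge (hB : Barrier a C (a / 4) c η A ε F F1 F2 G G1 G2) (ha : 0 < a)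
    (ha1 : a ≤ 1) (h : ℝ) : F h ≤ gauge₁ (a / 4) (h + 5) := by
  unfold gauge₁
  have key : ∀ t, t ≤ 0 → (a + 1) * Real.exp (a / 4 * (t - 4)) ≤ Real.exp (a / 4 * t) := by
    intro t _
    have h1 := Real.add_one_le_exp a
    calc _ ≤ Real.exp a * Real.exp (a / 4 * (t - 4)) := by gcongr
      _ = _ := by rw [← Real.exp_add]; congr 1; ring
  split_ifs with hh
  · have h1 := hB.F_le_exp h (by linarith)
    refine h1.trans (le_trans ?_ (key (h + 5) hh))
    gcongr
    linarith
  · rcases le_total 0 h with h0 | h0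
    · linarith [hB.F_le h h0]
    · have h1 := hB.F_le_exp h h0
      refine h1.trans ?_
      rcases le_total 0 (h + 4) with h2 | h2
      · have : Real.exp (a / 4 * h) ≤ 1 :=
          Real.exp_le_one_iff.2 (mul_nonpos_of_nonneg_of_nonpos (by positivity) h0)
        have : (a + 1) * Real.exp (a / 4 * h) ≤ (a + 1) * 1 := by gcongr
        linarith
      · have h3 := key (h + 4) h2
        have : Real.exp (a / 4 * (h + 4)) ≤ 1 :=
          Real.exp_le_one_iff.2 (mul_nonpos_of_nonneg_of_nonpos (by positivity) h2)
        rw [add_sub_cancel_right] at h3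
        linarith

theorem Barrier.neg_le (hB : Barrier a C b c η A ε F F1 F2 G G1 G2) (hc : 2 * c ≤ 5) {h v : ℝ}
    (hv : 0 < v) (hG : G h ≤ v) : -(h + 5) ≤ v := by
  rcases le_total h 0 with h0 | h0
  · linarith [hB.le_G h h0]
  · linarith

theorem height_add_height_le_of_coarse (hB : Barrier a C b c η A ε F F1 F2 G G1 G2) (ha : 0 < a)
    (ha1 : a ≤ 1) (hb : 0 < b) (hc : 0 < c) (hηA : 0 ≤ η * A) (he : 4 * (η * A + 1) ≤ e)
    (heK : 2 * K ≤ e) (hKc : a * Real.exp (-(a * K)) ≤ c) (hec : 2 ≤ c * Real.exp (b * (e / 2)))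
    (hFI : ∀ y, 0 < y → F (I y) = y) (hGJ : ∀ y, 0 < y → G (J y) = y)
    {u v : EuclideanSpace ℝ (Fin n) → ℝ} (hu : ∀ x, 0 < u x) (hv : ∀ x, 0 < v x)
    {x y : EuclideanSpace ℝ (Fin n)} {Φ : ℝ} (h : Coarse b u v x y Φ) :
    height I J u v x + height I J v u y ≤ Φ + 2 * e := by
  obtain ⟨h, k, hsum, h1, h2, h3, h4⟩ := h
  have key : ∀ {p q : ℝ}, 0 < p → 0 < q → ∀ h, p ≤ gauge₁ b h → -h ≤ q →
      max (I p) (J q) ≤ h + e := by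
    intro p q hp hq h hph hqh
    refine max_le ?_ ?_
    · rw [← hB.mono_F.le_iff_le, hFI _ hp]
      exact hph.trans (hB.gauge_le hb hc hηA he hec h)
    · rw [← hB.anti_G.le_iff_ge, hGJ _ hq]
      exact (hB.G_add_le ha ha1 hηA he heK hKc h).trans (max_le hqh hq.le)
  have e1 := key (hu x) (hv x) h h1 h2
  have e2 := key (hv y) (hu y) k h3 h4
  unfold height
  linarith

theorem coarse_of_height_add_height_le (hB : Barrier a C (a / 4) c η A ε F F1 F2 G G1 G2)
    (ha : 0 < a) (ha1 : a ≤ 1) (hc : 2 * c ≤ 5)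
    (hFI : ∀ y, 0 < y → F (I y) = y) (hGJ : ∀ y, 0 < y → G (J y) = y)
    {u v : EuclideanSpace ℝ (Fin n) → ℝ} (hu : ∀ x, 0 < u x) (hv : ∀ x, 0 < v x)
    {x y : EuclideanSpace ℝ (Fin n)} {Φ : ℝ}
    (h : height I J u v x + height I J v u y + 10 ≤ Φ) : Coarse (a / 4) u v x y Φ := by
  have key : ∀ {p q : ℝ}, 0 < p → 0 < q → p ≤ gauge₁ (a / 4) (max (I p) (J q) + 5) ∧
      -(max (I p) (J q) + 5) ≤ q := by
    intro p q hp hq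
    constructor
    · refine le_trans ?_ (hB.F_le_gauge ha ha1 _)
      conv_lhs => rw [← hFI _ hp]
      exact hB.mono_F.monotone (le_max_left _ _)
    · refine hB.neg_le hc hq ?_
      conv_rhs => rw [← hGJ _ hq]
      exact hB.anti_G.antitone (le_max_right _ _)
  exact ⟨_, _, by unfold height at h; linarith, (key (hu x) (hv x)).1, (key (hu x) (hv x)).2,
    (key (hv y) (hu y)).1, (key (hv y) (hu y)).2⟩

theorem le_mul_exp_of_cube {X M r : ℝ} (hX : 1 ≤ X) (hM : 0 < M) (hr : 0 < r) (hη : 0 < η)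
    (h1 : 1 ≤ η ^ 2 * r) : X / (6 * M) ≤ η / (M * r) * Real.exp (X * (η * r)) := by
  have h2 : (X * (η * r)) ^ 3 / 6 ≤ Real.exp (X * (η * r)) := cube_le_exp (by positivity)
  have h3 : 0 ≤ η / (M * r) := by positivity
  refine le_trans ?_ (mul_le_mul_of_nonneg_left h2 h3)
  have h4 : η / (M * r) * ((X * (η * r)) ^ 3 / 6) = X / (6 * M) * (X ^ 2 * (η ^ 2 * r) ^ 2) := by
    field_simp
  rw [h4]
  have h5 : 1 ≤ X ^ 2 * (η ^ 2 * r) ^ 2 := one_le_mul_of_one_le_of_one_le (one_le_pow₀ hX)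
    (one_le_pow₀ h1)
  have h6 : 0 ≤ X / (6 * M) := by positivity
  calc X / (6 * M) = X / (6 * M) * 1 := by ring
    _ ≤ _ := by gcongr

theorem exp_error_le {r : ℝ} (ha : 0 < a) (hη : 0 < η) (hη' : η ≤ 1) (hr : 0 < r)
    (hr' : 8 / a ^ 2 ≤ r)
    (h1 : 1 ≤ η ^ 2 * r) : 4 * a * Real.exp (-(a * (16 * r / 5))) ≤ η / (8 * r) := by
  have h2 : (3 * a * r) ^ 3 / 6 ≤ Real.exp (a * (16 * r / 5)) :=
    (cube_le_exp (by positivity)).trans (Real.exp_le_exp.2 (by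
      have : 0 < a * r := by positivity
      linarith))
  rw [div_le_iff₀ (by positivity)] at hr'
  have h3 : 1 ≤ η * r := by
    have : η ^ 2 * r = η * (η * r) := by ring
    have h4 : η * (η * r) ≤ 1 * (η * r) := by gcongr
    linarith
  have h5 : 8 * r * (4 * a) ≤ η * ((3 * a * r) ^ 3 / 6) := by
    have h6 : η * ((3 * a * r) ^ 3 / 6) = 4.5 * (r * a) * (η * r) * (r * a ^ 2) := by ring
    rw [h6]
    have h7 : 0 < r * a := by positivity
    calc 8 * r * (4 * a) ≤ 4.5 * (r * a) * 1 * 8 := by linarith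
      _ ≤ _ := by gcongr
  rw [Real.exp_neg, ← div_eq_mul_inv, div_le_div_iff₀ (Real.exp_pos _) (by positivity)]
  calc 4 * a * (8 * r) = 8 * r * (4 * a) := by ring
    _ ≤ _ := h5
    _ ≤ _ := by gcongr

end

set_option maxHeartbeats 1000000 in
/-- One step of the improvement of two-point bounds, from scale `r` to scale `r / 2`. -/
theorem exists_coarse_step (n : ℕ) : ∃ b Λ r₁ : ℝ, 0 < b ∧ 0 < Λ ∧ 1 ≤ r₁ ∧
    ∀ (r η D : ℝ) (u v : EuclideanSpace ℝ (Fin n) → ℝ) (x₀ : EuclideanSpace ℝ (Fin n)),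
      r₁ ≤ r → 0 < η → η ≤ 1 / 10 → 1 ≤ η ^ 2 * r → Λ * r / η ≤ D → IsSolution u v →
      (∀ x y, ‖x - x₀‖ ≤ D → ‖x - y‖ ≤ r → Coarse b u v x y r) →
      ∀ y, ‖x₀ - y‖ ≤ r / 2 → Coarse b u v x₀ y (r / 2 * (1 + Λ * η)) := by
  obtain ⟨U, U', a, C, hp⟩ := exists_profile
  have ha := hp.a_pos
  have ha1 := hp.a_le
  have hC := hp.C_pos
  set M : ℝ := 24 + 24 / a ^ 2 with hM
  have hM0 : 24 ≤ M := by rw [hM]; have : 0 < 24 / a ^ 2 := by positivity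
                          linarith
  have hMa : M * a ^ 2 = 24 * a ^ 2 + 24 := by rw [hM]; field_simp
  set CK : ℝ := (1 + 6 * M) / a with hCK
  have hCK0 : 0 < CK := by rw [hCK]; positivity
  set Ce : ℝ := 68 + 2 * CK + 8 * (1 + 12 * M) / a with hCe
  have hx : 0 < 8 * (1 + 12 * M) / a := by positivity
  have hCe0 : 68 + 2 * CK ≤ Ce := by linarith
  set Cφ : ℝ := 200 + 2 * CK + 2 * Ce + 16 * (2 * C + 1) with hCφ
  set CP : ℝ := 1 + 2 * Ce with hCP
  set CD : ℝ := 16 * (n + 1) * CP with hCD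
  have hCP0 : 0 < CP := by linarith
  have hCPD : 16 * CP ≤ CD := by
    have : 0 ≤ 16 * n * CP := by positivity
    rw [hCD]; linarith
  have hCφ0 : 0 < Cφ := by linarith
  refine ⟨a / 4, CD + (2 * Cφ + 21), 1 + 8 / a ^ 2, by positivity, by linarith,
    le_add_of_nonneg_right (by positivity), ?_⟩
  intro r η D u v x₀ hr1 hη hη' hηr hD hs hbd y hy
  have hr : 1 ≤ r := le_trans (le_add_of_nonneg_right (by positivity)) hr1
  have hr2 : 8 / a ^ 2 ≤ r := by linarith
  have hr0 : 0 < r := by linarith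
  have hT : 1 ≤ η * r := by
    have h1 : η ^ 2 * r = η * (η * r) := by ring
    have h2 : η * (η * r) ≤ 1 * (η * r) := by gcongr; linarith
    linarith
  have hTr : η * r ≤ r := by
    have h2 : η * r ≤ 1 * r := by gcongr; linarith
    linarith
  set T := η * r with hTdef
  have hA : 0 < 16 * r := by linarith
  have hηA : η * (16 * r) = 16 * T := by rw [hTdef]; ring
  have hc : 0 < η / (M * r) := by positivity
  have hca : η / (M * r) ≤ a / 2 := by
    rw [div_le_iff₀ (by positivity)]
    have h1 : 24 ≤ M * a ^ 2 := by rw [hMa]; have := sq_nonneg a; linarith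
    have h2 : M * a ^ 2 ≤ M * a := by
      have : a ^ 2 ≤ a := by rw [sq]; exact mul_le_of_le_one_left ha.le ha1
      gcongr
    have h3 : 24 * 1 ≤ M * a * r := mul_le_mul (by linarith) hr (by norm_num) (by linarith)
    linarith
  obtain ⟨F, F1, F2, G, G1, G2, hB⟩ := exists_barrier hp hη hη' hA hc hca
  obtain ⟨I, hFI, hI⟩ := exists_inverse hB.dF hB.F1_pos (hB.surj_F ha (by positivity))
  obtain ⟨J, hGJ, hJ⟩ := exists_inverse_of_neg hB.dG hB.G1_neg (hB.surj_G ha hc)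
  have hKc : a * Real.exp (-(a * (CK * T))) ≤ η / (M * r) := by
    have h1 : a * CK = 1 + 6 * M := by rw [hCK]; field_simp
    have h2 := le_mul_exp_of_cube (X := a * CK) (M := M) (by linarith) (by linarith) hr0 hη hηr
    have h3 : 1 ≤ a * CK / (6 * M) := by
      rw [h1, le_div_iff₀ (by positivity)]; linarith
    rw [Real.exp_neg, ← div_eq_mul_inv, div_le_iff₀ (Real.exp_pos _), ← mul_assoc]
    linarith
  have hec : 2 ≤ η / (M * r) * Real.exp (a / 4 * (Ce * T / 2)) := by
    have h1 : 1 + 12 * M ≤ a / 8 * Ce := by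
      have h2 : a / 8 * (8 * (1 + 12 * M) / a) = 1 + 12 * M := by field_simp
      have h3 : 0 ≤ a / 8 * (68 + 2 * CK) := by positivity
      have h4 : a / 8 * Ce = a / 8 * (68 + 2 * CK) + a / 8 * (8 * (1 + 12 * M) / a) := by
        rw [hCe]; ring
      linarith
    have h2 := le_mul_exp_of_cube (X := a / 8 * Ce) (M := M) (by linarith) (by linarith) hr0 hη hηr
    have h3 : 2 ≤ a / 8 * Ce / (6 * M) := by
      rw [le_div_iff₀ (by positivity)]; linarith
    have h4 : a / 4 * (Ce * T / 2) = a / 8 * Ce * (η * r) := by rw [hTdef]; ring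
    rw [h4]
    linarith
  have he : 4 * (η * (16 * r) + 1) ≤ Ce * T := by
    rw [hηA]
    have : 68 * T ≤ Ce * T := by gcongr; linarith
    linarith
  have heK : 2 * (CK * T) ≤ Ce * T := by
    rw [← mul_assoc]; gcongr; linarith
  have hDpos : 0 < D := lt_of_lt_of_le (by have : 0 < CD := by linarith
                                           positivity) hD
  have hD' : CD * r ≤ η * D := by
    rw [div_le_iff₀ hη] at hD
    have : 0 ≤ (2 * Cφ + 21) * r := by positivity
    linarith
  have hPD : 2 * (CP * r) / D ≤ η / 8 := by
    rw [div_le_div_iff₀ hDpos (by norm_num)]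
    have : 16 * CP * r ≤ CD * r := by gcongr
    linarith
  have hPD2 : 2 * (CP * r / D ^ 2) * n ≤ η / (8 * r) := by
    have h1 : 2 * (CP * r / D ^ 2) * n = 2 * CP * r * n / D ^ 2 := by ring
    rw [h1, div_le_div_iff₀ (by positivity) (by positivity)]
    have h2 : (CD * r) ^ 2 ≤ (η * D) ^ 2 := by gcongr
    have h3 : 16 * CP * n * r ^ 2 ≤ (CD * r) ^ 2 := by
      have h4 : 16 * CP * n ≤ CD := by rw [hCD]; linarith
      have h5 : CD * 1 ≤ CD * CD := by gcongr; linarith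
      have h6 : 16 * CP * n ≤ CD ^ 2 := by rw [sq]; linarith
      rw [mul_pow]
      gcongr
    have h7 : η ^ 2 ≤ η := by
      have : η ^ 2 ≤ 1 * η := by rw [sq]; gcongr; linarith
      linarith
    have h8 : η ^ 2 * D ^ 2 ≤ η * D ^ 2 := by gcongr
    rw [mul_pow η D] at h2
    linarith
  have hεr : 2 * (2 * (η / (16 * r)) + (3 + 3 / a ^ 2) * (η / (M * r)) +
      2 * a * Real.exp (-(a * (16 * r / 5)))) + 2 * (CP * r / D ^ 2) * n < η / r := by
    have h1 := exp_error_le ha hη (by linarith) hr0 hr2 hηr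
    have h2 : 2 * (2 * (η / (16 * r))) = η / (4 * r) := by field_simp; norm_num
    have h3 : 2 * ((3 + 3 / a ^ 2) * (η / (M * r))) = η / (4 * r) := by
      have : 3 + 3 / a ^ 2 = M / 8 := by rw [hM]; ring
      rw [this]; field_simp; norm_num
    have h4 : η / (4 * r) = η / r / 4 := by field_simp
    have h5 : η / (8 * r) = η / r / 8 := by field_simp
    have h6 : 0 < η / r := by positivity
    linarith
  have hCeT : Ce * T ≤ Ce * r := by gcongr
  have main := height_add_height_le (x₀ := x₀) (φ₀ := Cφ * T) (K := CK * T) (D := D) (r := r)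
    (e := Ce * T) (P := CP * r) (y₀ := y) hB ha hC hη hη' hA hFI hI hGJ hJ hs hDpos hr (by positivity)
    hPD hεr
    (by
      rw [hηA]
      have : 200 * T ≤ Cφ * T := by gcongr; linarith
      linarith)
    (by
      have : 16 * (2 * C + 1) * T ≤ Cφ * T := by gcongr; linarith
      have : 16 * (2 * C + 1) * 1 ≤ 16 * (2 * C + 1) * T := by gcongr
      linarith)
    (by rw [← mul_assoc]; gcongr; linarith) hKc (by rw [← mul_assoc]; gcongr; linarith)
    (by rw [hCP]; linarith)
    (fun x z hxz hz => height_add_height_le_of_coarse hB ha ha1 (by positivity) hc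
      (by positivity) he heK hKc hec hFI hGJ hs.2.2.1 hs.2.2.2.1 (hbd x z hxz hz))
    (by linarith)
  refine coarse_of_height_add_height_le hB ha ha1 (by linarith) hFI hGJ hs.2.2.1 hs.2.2.2.1 ?_
  have h1 : (1 + η / 8) * ‖x₀ - y‖ ≤ (1 + η / 8) * (r / 2) := by gcongr
  have h2 : r / 2 * (1 + (CD + (2 * Cφ + 21)) * η) =
    r / 2 + CD / 2 * T + Cφ * T + 21 / 2 * T := by rw [hTdef]; ring
  have h3 : (1 + η / 8) * (r / 2) = r / 2 + T / 16 := by rw [hTdef]; ring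
  have h4 : 0 ≤ CD / 2 * T := by
    have : 0 < CD := by linarith
    positivity
  rw [h2]
  linarith

section

variable {n : ℕ} {b : ℝ} {u v : EuclideanSpace ℝ (Fin n) → ℝ}

theorem lap_scale (hu : ContDiff ℝ (⊤ : ℕ∞) u) (μ : ℝ) (z : EuclideanSpace ℝ (Fin n)) :
    lap (fun z => μ * u (μ • z)) z = μ ^ 3 * lap u (μ • z) := by
  have hd : Differentiable ℝ u := hu.differentiable (by simp)
  have hd2 : Differentiable ℝ (fderiv ℝ u) :=
    (hu.fderiv_right (m := (⊤ : ℕ∞)) (by simp)).differentiable (by simp)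
  have hs : ∀ z : EuclideanSpace ℝ (Fin n), HasFDerivAt (fun z => μ • z)
      (μ • ContinuousLinearMap.id ℝ (EuclideanSpace ℝ (Fin n))) z :=
    fun z => (hasFDerivAt_id z).const_smul μ
  have h1 : fderiv ℝ (fun z => μ * u (μ • z)) = fun z => μ ^ 2 • fderiv ℝ u (μ • z) := by
    funext z
    have := ((hd (μ • z)).hasFDerivAt.comp z (hs z)).const_mul μ
    refine this.fderiv.trans ?_
    ext w
    simp
    ring
  have h2 : fderiv ℝ (fun z => μ ^ 2 • fderiv ℝ u (μ • z)) z =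
      μ ^ 3 • fderiv ℝ (fderiv ℝ u) (μ • z) := by
    have := ((hd2 (μ • z)).hasFDerivAt.comp z (hs z)).const_smul (μ ^ 2)
    refine this.fderiv.trans ?_
    ext w w'
    simp
    ring
  simp only [lap, iteratedFDeriv_two_apply, h1, h2, Finset.mul_sum]
  simp

theorem IsSolution.scale (hs : IsSolution u v) {μ : ℝ} (hμ : 0 < μ) :
    IsSolution (fun z => μ * u (μ • z)) (fun z => μ * v (μ • z)) := by
  obtain ⟨hu, hv, hu0, hv0, hlu, hlv⟩ := hs
  have hc : ContDiff ℝ (⊤ : ℕ∞) fun z : EuclideanSpace ℝ (Fin n) => μ • z :=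
    contDiff_id.const_smul μ
  refine ⟨contDiff_const.mul (hu.comp hc), contDiff_const.mul (hv.comp hc),
    fun x => mul_pos hμ (hu0 _), fun x => mul_pos hμ (hv0 _), fun x => ?_, fun x => ?_⟩
  · rw [lap_scale hu, hlu]; ring
  · rw [lap_scale hv, hlv]; ring

theorem mul_gauge_le (hb : 0 < b) {μ : ℝ} (hμ : 0 < μ) (hμ1 : μ ≤ 1) (h : ℝ) :
    μ * gauge₁ b h ≤ gauge₁ b (μ * h) := by
  unfold gauge₁
  rcases le_or_gt h 0 with hh | hh
  · rw [if_pos hh, if_pos (mul_nonpos_of_nonneg_of_nonpos hμ.le hh)]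
    have h1 : h ≤ μ * h := by
      have := mul_le_mul_of_nonpos_right hμ1 hh
      linarith
    calc μ * Real.exp (b * h) ≤ 1 * Real.exp (b * (μ * h)) := by gcongr
      _ = _ := one_mul _
  · rw [if_neg hh.not_ge, if_neg (mul_pos hμ hh).not_ge]
    linarith

theorem gauge_mul_le (hb : 0 < b) {h k Φ : ℝ} (hΦ : 0 ≤ Φ) (hsum : h + k ≤ Φ) :
    gauge₁ b h * gauge₁ b k ≤ (1 + Φ) ^ 2 + 1 / b := by
  have hb' : 0 < 1 / b := by positivity
  have mixed : ∀ h k, h + k ≤ Φ → h ≤ 0 → 0 < k →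
      Real.exp (b * h) * (1 + k) ≤ (1 + Φ) ^ 2 + 1 / b := by
    intro h k hsum hh hk
    have h1 : Real.exp (b * h) ≤ 1 := Real.exp_le_one_iff.2 (mul_nonpos_of_nonneg_of_nonpos hb.le hh)
    have h2 : -h * Real.exp (b * h) ≤ 1 / b := by
      rw [le_div_iff₀ hb]
      have h3 := Real.add_one_le_exp (-(b * h))
      have h4 := mul_le_mul_of_nonneg_right (by linarith : -(b * h) ≤ Real.exp (-(b * h)))
        (Real.exp_pos (b * h)).le
      rw [← Real.exp_add, neg_add_cancel, Real.exp_zero] at h4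
      linarith
    have h5 : Real.exp (b * h) * (1 + k) ≤ Real.exp (b * h) * (1 + Φ - h) := by
      gcongr; linarith
    have h6 : Real.exp (b * h) * (1 + Φ) ≤ 1 * (1 + Φ) := by gcongr
    have := sq_nonneg Φ
    linarith
  have hone : (1 : ℝ) ≤ (1 + Φ) ^ 2 := one_le_pow₀ (by linarith)
  unfold gauge₁
  split_ifs with h1 h2 h2
  · have e1 : Real.exp (b * h) ≤ 1 := Real.exp_le_one_iff.2 (mul_nonpos_of_nonneg_of_nonpos hb.le h1)
    have e2 : Real.exp (b * k) ≤ 1 := Real.exp_le_one_iff.2 (mul_nonpos_of_nonneg_of_nonpos hb.le h2)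
    have := mul_le_one₀ e1 (Real.exp_pos _).le e2
    linarith
  · exact mixed h k hsum h1 (not_le.1 h2)
  · rw [mul_comm]
    exact mixed k h (by linarith) h2 (not_le.1 h1)
  · have : (1 + h) * (1 + k) ≤ (1 + Φ) * (1 + Φ) :=
      mul_le_mul (by linarith) (by linarith) (by linarith) (by linarith)
    linarith

theorem Coarse.mono {x y : EuclideanSpace ℝ (Fin n)} {Φ Φ' : ℝ} (h : Coarse b u v x y Φ)
    (hΦ : Φ ≤ Φ') : Coarse b u v x y Φ' := by
  obtain ⟨h, k, h1, h2⟩ := h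
  exact ⟨h, k, h1.trans hΦ, h2⟩

theorem Coarse.scale (hb : 0 < b) {x y : EuclideanSpace ℝ (Fin n)} {Φ μ : ℝ}
    (hμ : 0 < μ) (hμ1 : μ ≤ 1) (h : Coarse b u v x y Φ) :
    Coarse b (fun z => μ * u z) (fun z => μ * v z) x y (μ * Φ) := by
  obtain ⟨h, k, h1, h2, h3, h4, h5⟩ := h
  refine ⟨μ * h, μ * k, ?_, ?_, ?_, ?_, ?_⟩
  · rw [← mul_add]; gcongr
  · exact (mul_le_mul_of_nonneg_left h2 hμ.le).trans (mul_gauge_le hb hμ hμ1 h)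
  · have := mul_le_mul_of_nonneg_left h3 hμ.le
    linarith
  · exact (mul_le_mul_of_nonneg_left h4 hμ.le).trans (mul_gauge_le hb hμ hμ1 k)
  · have := mul_le_mul_of_nonneg_left h5 hμ.le
    linarith

theorem Coarse.mul_le (hb : 0 < b) {x : EuclideanSpace ℝ (Fin n)} {Φ m : ℝ} (hm : 0 < m)
    (hΦ : 0 ≤ Φ) (hu : ∀ x, 0 < u x) (hv : ∀ x, 0 < v x)
    (h : Coarse b (fun z => m⁻¹ * u z) (fun z => m⁻¹ * v z) x x Φ) :
    u x * v x ≤ m ^ 2 * ((1 + Φ) ^ 2 + 1 / b) := by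
  obtain ⟨h, k, h1, h2, -, h4, -⟩ := h
  have hu := hu x
  have hv := hv x
  have h5 := mul_le_mul h2 h4 (by positivity) (le_trans (by positivity) h2)
  have h6 := h5.trans (gauge_mul_le hb hΦ h1)
  calc u x * v x = m ^ 2 * (m⁻¹ * u x * (m⁻¹ * v x)) := by field_simp
    _ ≤ _ := by gcongr

/-- The property furnished by `exists_coarse_step`. -/
def StepProperty (n : ℕ) (b Λ r₁ : ℝ) : Prop :=
  ∀ (r η D : ℝ) (u v : EuclideanSpace ℝ (Fin n) → ℝ) (x₀ : EuclideanSpace ℝ (Fin n)),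
    r₁ ≤ r → 0 < η → η ≤ 1 / 10 → 1 ≤ η ^ 2 * r → Λ * r / η ≤ D → IsSolution u v →
    (∀ x y, ‖x - x₀‖ ≤ D → ‖x - y‖ ≤ r → Coarse b u v x y r) →
    ∀ y, ‖x₀ - y‖ ≤ r / 2 → Coarse b u v x₀ y (r / 2 * (1 + Λ * η))

theorem StepProperty.scaled {Λ r₁ : ℝ} (hP : StepProperty n b Λ r₁) (hb : 0 < b) (hΛ : 0 < Λ)
    (hs : IsSolution u v) {m r η d : ℝ} {x₀ : EuclideanSpace ℝ (Fin n)} (hm : 1 ≤ m)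
    (hr0 : 0 < r) (hr : r₁ ≤ r) (hη : 0 < η) (hη' : η ≤ 1 / 10) (hηr : 1 ≤ η ^ 2 * r)
    (hd : Λ * r / η ≤ d)
    (h : ∀ x y, ‖x - x₀‖ ≤ d → ‖x - y‖ ≤ r →
      Coarse b (fun z => m⁻¹ * u z) (fun z => m⁻¹ * v z) x y (m * r))
    {y : EuclideanSpace ℝ (Fin n)} (hy : ‖x₀ - y‖ ≤ r / 2) :
    Coarse b (fun z => (m * (1 + Λ * η))⁻¹ * u z) (fun z => (m * (1 + Λ * η))⁻¹ * v z) x₀ y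
      (m * (1 + Λ * η) * (r / 2)) := by
  have hm0 : 0 < m := by linarith
  have hrm : r ≤ m * r := le_mul_of_one_le_left hr0.le hm
  have hl : 1 ≤ 1 + Λ * η := le_add_of_nonneg_right (by positivity)
  have hnorm : ∀ x y : EuclideanSpace ℝ (Fin n), ‖m⁻¹ • x - y‖ = m⁻¹ * ‖x - m • y‖ := by
    intro x y
    have : m⁻¹ • x - y = m⁻¹ • (x - m • y) := by
      rw [smul_sub, smul_smul, inv_mul_cancel₀ hm0.ne', one_smul]
    rw [this, norm_smul, Real.norm_of_nonneg (by positivity)]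
  have h1 := hP (m * r) η (m * d) _ _ (m • x₀) (hr.trans hrm) hη hη'
    (hηr.trans (by gcongr))
    (by calc Λ * (m * r) / η = m * (Λ * r / η) := by ring
          _ ≤ m * d := by gcongr)
    (hs.scale (inv_pos.2 hm0))
    (fun x y hx hy => by
      refine h (m⁻¹ • x) (m⁻¹ • y) ?_ ?_
      · rw [hnorm, inv_mul_le_iff₀ hm0]
        exact hx
      · rw [hnorm, smul_smul, mul_inv_cancel₀ hm0.ne', one_smul, inv_mul_le_iff₀ hm0]
        exact hy)
    (m • y) (by
      rw [← smul_sub, norm_smul, Real.norm_of_nonneg hm0.le]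
      have := mul_le_mul_of_nonneg_left hy hm0.le
      linarith)
  have h2 := h1.scale hb (inv_pos.2 (by linarith : 0 < 1 + Λ * η)) (inv_le_one_of_one_le₀ hl)
  have h3 : Coarse b (fun z => (m * (1 + Λ * η))⁻¹ * u z) (fun z => (m * (1 + Λ * η))⁻¹ * v z) x₀ y
      ((1 + Λ * η)⁻¹ * (m * r / 2 * (1 + Λ * η))) := by
    simpa only [Coarse, smul_smul, inv_mul_cancel₀ hm0.ne', one_smul, mul_inv_rev, mul_assoc] using h2
  refine h3.mono ?_
  have e1 : (1 + Λ * η)⁻¹ * (m * r / 2 * (1 + Λ * η)) = m * 1 * (r / 2) := by field_simp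
  rw [e1]
  gcongr

theorem StepProperty.iterate {Λ r₁ : ℝ} (hP : StepProperty n b Λ r₁) (hb : 0 < b) (hΛ : 0 < Λ)
    (hs : IsSolution u v) {m₀ r₀ : ℝ} (hm₀ : 1 ≤ m₀) (hr₀ : r₁ ≤ r₀) (hr₀' : 400 ≤ r₀) (J : ℕ)
    {x₀ : EuclideanSpace ℝ (Fin n)}
    (hstart : ∀ x y, ‖x - x₀‖ ≤ 60 * Λ * r₀ * 2 ^ J → ‖x - y‖ ≤ r₀ * 2 ^ J →
      Coarse b (fun z => m₀⁻¹ * u z) (fun z => m₀⁻¹ * v z) x y (m₀ * (r₀ * 2 ^ J))) :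
    ∃ m, m₀ ≤ m ∧ m ≤ m₀ * Real.exp Λ ∧
      Coarse b (fun z => m⁻¹ * u z) (fun z => m⁻¹ * v z) x₀ x₀ (m * r₀) := by
  have hr0 : 0 < r₀ := by linarith
  have main : ∀ i k : ℕ, i + k = J → ∃ m, m₀ ≤ m ∧
      m ≤ m₀ * Real.exp (Λ / 20 * (4 * (1 - (3 / 4 : ℝ) ^ i) + 4 * (3 / 4 : ℝ) ^ (k + 1))) ∧
      ∀ x y, ‖x - x₀‖ ≤ 60 * Λ * r₀ * 2 ^ J * (2 / 3) ^ i → ‖x - y‖ ≤ r₀ * 2 ^ k →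
        Coarse b (fun z => m⁻¹ * u z) (fun z => m⁻¹ * v z) x y (m * (r₀ * 2 ^ k)) := by
    intro i
    induction i with
    | zero =>
      intro k hk
      rw [zero_add] at hk
      subst hk
      refine ⟨m₀, le_rfl, ?_, ?_⟩
      · refine le_mul_of_one_le_right (by linarith) (Real.one_le_exp ?_)
        rw [pow_zero, sub_self, mul_zero, zero_add]
        positivity
      · simpa using hstart
    | succ i ih =>
      intro k hk
      obtain ⟨m, hm1, hm2, hm⟩ := ih (k + 1) (by omega)
      have hp1 : (0 : ℝ) < (3 / 4) ^ i := by positivity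
      have hp2 : (0 : ℝ) < (3 / 4) ^ (k + 1) := by positivity
      have hp1' : (3 / 4 : ℝ) ^ i ≤ 1 := pow_le_one₀ (by norm_num) (by norm_num)
      have hp2' : (3 / 4 : ℝ) ^ (k + 1) ≤ 1 := pow_le_one₀ (by norm_num) (by norm_num)
      set η : ℝ := 1 / 20 * ((3 / 4) ^ i + (3 / 4) ^ (k + 1)) with hη
      have hη0 : 0 < η := by positivity
      have hp3 : (1 : ℝ) ≤ 2 ^ (k + 1) := one_le_pow₀ (by norm_num)
      have hrk : r₀ ≤ r₀ * 2 ^ (k + 1) := le_mul_of_one_le_right hr0.le hp3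
      refine ⟨m * (1 + Λ * η), ?_, ?_, fun x y hx hy => ?_⟩
      · exact hm1.trans (le_mul_of_one_le_right (by linarith)
          (le_add_of_nonneg_right (by positivity)))
      · have h1 : 1 + Λ * η ≤ Real.exp (Λ * η) := by
          linarith [Real.add_one_le_exp (Λ * η)]
        calc m * (1 + Λ * η) ≤ _ * Real.exp (Λ * η) :=
              mul_le_mul hm2 h1 (by positivity) (by positivity)
          _ = _ := by
              rw [mul_assoc, ← Real.exp_add]
              congr 2
              rw [hη]
              ring
      · have h2 : r₀ * 2 ^ k = r₀ * 2 ^ (k + 1) / 2 := by ring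
        rw [h2] at hy ⊢
        refine hP.scaled hb hΛ hs (d := 20 * Λ * r₀ * 2 ^ J * (2 / 3) ^ i) (by linarith)
          (by linarith) (hr₀.trans hrk) hη0 (by rw [hη]; linarith) ?_ ?_ (fun x' y' hx' hy' => ?_) hy
        · have h3 : 1 / 20 * (3 / 4) ^ (k + 1) ≤ η := by rw [hη]; linarith
          have h4 : (1 / 20 * (3 / 4 : ℝ) ^ (k + 1)) ^ 2 * (r₀ * 2 ^ (k + 1)) ≤
              η ^ 2 * (r₀ * 2 ^ (k + 1)) := by gcongr
          refine le_trans ?_ h4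
          have h5 : (1 / 20 * (3 / 4 : ℝ) ^ (k + 1)) ^ 2 * (r₀ * 2 ^ (k + 1)) =
              r₀ / 400 * (9 / 8) ^ (k + 1) := by
            have : (9 / 8 : ℝ) ^ (k + 1) = (3 / 4) ^ (k + 1) * (3 / 4) ^ (k + 1) * 2 ^ (k + 1) := by
              rw [← mul_pow, ← mul_pow]; norm_num
            rw [this]; ring
          rw [h5]
          exact one_le_mul_of_one_le_of_one_le (by linarith) (one_le_pow₀ (by norm_num))
        · have h3 : 1 / 20 * (3 / 4) ^ i ≤ η := by rw [hη]; linarith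
          rw [div_le_iff₀ hη0]
          have h4 : (2 : ℝ) ^ J * (2 / 3) ^ i * (3 / 4) ^ i = 2 ^ (k + 1) := by
            rw [← hk, mul_assoc, ← mul_pow, show i + 1 + k = i + (k + 1) by ring, pow_add,
              mul_right_comm, ← mul_pow]
            norm_num
          calc Λ * (r₀ * 2 ^ (k + 1)) =
              20 * Λ * r₀ * 2 ^ J * (2 / 3) ^ i * (1 / 20 * (3 / 4) ^ i) := by rw [← h4]; ring
            _ ≤ _ := by gcongr
        · refine hm x' y' ?_ hy'
          have h3 : x' - x₀ = (x' - x) + (x - x₀) := by abel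
          have h4 := norm_add_le (x' - x) (x - x₀)
          rw [h3]
          rw [pow_succ] at hx
          linarith
  obtain ⟨m, hm1, hm2, hm⟩ := main J 0 (by simp)
  refine ⟨m, hm1, hm2.trans ?_, ?_⟩
  · have : (0 : ℝ) < (3 / 4) ^ J := by positivity
    gcongr
    have h2 : 4 * (1 - (3 / 4 : ℝ) ^ J) + 4 * (3 / 4 : ℝ) ^ (0 + 1) ≤ 20 := by
      norm_num; linarith
    have := mul_le_mul_of_nonneg_left h2 (by positivity : 0 ≤ Λ / 20)
    linarith
  · have := hm x₀ x₀ (by simp; positivity) (by simp; positivity)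
    simpa using this

/-- The trivial two-point bound at the largest scale. -/
theorem coarse_of_le {x y : EuclideanSpace ℝ (Fin n)} {m R Q : ℝ} (hm : 1 + 2 * Q ≤ m)
    (hQ : 0 ≤ Q) (hR : 0 < R) (hu : ∀ x, 0 < u x) (hv : ∀ x, 0 < v x)
    (hx : u x ≤ Q * R) (hy : v y ≤ Q * R) :
    Coarse b (fun z => m⁻¹ * u z) (fun z => m⁻¹ * v z) x y (m * R) := by
  have hm0 : 0 < m := by linarith
  have hmR : 0 < m * R / 2 := by positivity
  have key : ∀ p, p ≤ Q * R → m⁻¹ * p ≤ gauge₁ b (m * R / 2) := by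
    intro p hp
    rw [gauge₁, if_neg hmR.not_ge, inv_mul_le_iff₀ hm0]
    have h1 : Q * R ≤ m / 2 * R := by gcongr; linarith
    have h2 : m / 2 * R * 1 ≤ m / 2 * R * m := by gcongr; linarith
    linarith
  have hv' := hv x
  have hu' := hu y
  refine ⟨m * R / 2, m * R / 2, by linarith, key _ hx, ?_, key _ hy, ?_⟩
  · have : 0 < m⁻¹ * v x := by positivity
    linarith
  · have : 0 < m⁻¹ * u y := by positivity
    linarith

end

end

/-- For an entire solution with linear growth, the product uv is uniformly bounded. -/
theorem product_bounded {n : ℕ} (hn : 2 ≤ n)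
    (u v : EuclideanSpace ℝ (Fin n) → ℝ) (hsol : IsSolution u v)
    (C₀ : ℝ) (hC₀ : 0 < C₀) (hgrowth : ∀ x, u x + v x ≤ C₀ * (1 + ‖x‖)) :
    ∃ C : ℝ, 0 < C ∧ ∀ x : EuclideanSpace ℝ (Fin n), u x * v x ≤ C := by
  obtain ⟨b, Λ, r₁, hb, hΛ, hr₁, hP⟩ := exists_coarse_step n
  have hu := hsol.2.2.1
  have hv := hsol.2.2.2.1
  set r₀ := r₁ + 400 with hr₀
  have hr0 : 0 < r₀ := by linarith
  set Q := C₀ * (2 + 60 * Λ * r₀ + r₀) with hQ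
  have hQ0 : 0 < Q := by positivity
  set m₀ := 1 + 2 * Q with hm₀
  set m₁ := m₀ * Real.exp Λ with hm₁
  have hm₁0 : 0 < m₁ := by positivity
  refine ⟨m₁ ^ 2 * ((1 + m₁ * r₀) ^ 2 + 1 / b), by positivity, fun x₀ => ?_⟩
  obtain ⟨J, hJ⟩ := pow_unbounded_of_one_lt ‖x₀‖ (by norm_num : (1 : ℝ) < 2)
  have hJ1 : (1 : ℝ) ≤ 2 ^ J := one_le_pow₀ (by norm_num)
  have hball : ∀ z : EuclideanSpace ℝ (Fin n), ‖z - x₀‖ ≤ (60 * Λ * r₀ + r₀) * 2 ^ J →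
      u z + v z ≤ Q * (r₀ * 2 ^ J) := by
    intro z hz
    have h1 := norm_add_le (z - x₀) x₀
    rw [sub_add_cancel] at h1
    calc u z + v z ≤ C₀ * (1 + ‖z‖) := hgrowth z
      _ ≤ C₀ * ((2 + 60 * Λ * r₀ + r₀) * 2 ^ J) := by gcongr; linarith
      _ = Q * (1 * 2 ^ J) := by rw [hQ]; ring
      _ ≤ _ := by gcongr; linarith
  obtain ⟨m, hm1, hm2, hm⟩ := StepProperty.iterate hP hb hΛ hsol (m₀ := m₀) (r₀ := r₀)
    (by linarith) (by linarith) (by linarith) J (x₀ := x₀) (fun x y hx hy => by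
      have h1 := hball x (by
        have : 0 ≤ r₀ * 2 ^ J := by positivity
        linarith)
      have h2 := hball y (by
        have h3 : y - x₀ = (x - x₀) - (x - y) := by abel
        have h4 := norm_sub_le (x - x₀) (x - y)
        rw [h3]
        linarith)
      exact coarse_of_le le_rfl hQ0.le (by positivity) hu hv (by linarith [hv x])
        (by linarith [hu y]))
  have hm0 : 0 < m := by linarith
  refine (hm.mul_le hb hm0 (by positivity) hu hv).trans ?_
  gcongr
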